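/- Let P and P' be 2-dimensional convex and compact sets in ℝ² (i.e., compact convex sets with nonempty interior). If g_P(x) = g_{P'}(x) for all x ∈ ℝ², then P and P' are strongly congruent, i.e., there exist v ∈ ℝ² and ε ∈ {−1, 1} with P' = εP + v. -/

import Mathlib

open MeasureTheory

/-- The covariogram of a set `P ⊆ ℝⁿ`: `g_P(x) = λₙ(P ∩ (P + x))`. -/
noncomputable def covariogram {n : ℕ} (P : Set (EuclideanSpace ℝ (Fin n)))
    (x : EuclideanSpace ℝ (Fin n)) : ℝ :=
  (volume (P ∩ ((fun p => p + x) '' P))).toReal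

section
open MeasureTheory Set Filter Topology

namespace Planar

/-- Discrete Abel summation: dividing by nondecreasing weights preserves nonnegativity. -/
lemma sum_nonneg_of_weighted {y δ : ℕ → ℝ} (hδ : Monotone δ) (hδ0 : 0 ≤ δ 0)
    (hz : ∀ k, δ k = 0 → 0 ≤ y k) (n : ℕ)
    (hP : ∀ k ≤ n, 0 ≤ ∑ j ∈ Finset.range k, y j * δ j) :
    0 ≤ ∑ j ∈ Finset.range n, y j := by
  have key : ∀ k ≤ n, 0 ≤ ∑ j ∈ Finset.range k, y j ∧
      ∑ j ∈ Finset.range k, y j * δ j ≤ δ k * ∑ j ∈ Finset.range k, y j := by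
    intro k
    induction k with
    | zero => intro _; simp
    | succ k ih =>
      intro hk
      obtain ⟨h1, h2⟩ := ih (by omega)
      have h3 := hP (k + 1) hk
      have hk0 : 0 ≤ δ k := hδ0.trans (hδ (Nat.zero_le k))
      rw [Finset.sum_range_succ] at h3 ⊢
      rw [Finset.sum_range_succ]
      have h4 : 0 ≤ ∑ j ∈ Finset.range k, y j + y k := by
        rcases hk0.eq_or_lt with h | h
        · have := hz k h.symm
          linarith
        · by_contra hneg
          push Not at hneg
          have := mul_neg_of_pos_of_neg h hneg
          linarith
      refine ⟨h4, ?_⟩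
      have h5 := mul_le_mul_of_nonneg_right (hδ (Nat.le_succ k)) h4
      simp only [Nat.succ_eq_add_one] at h5
      linarith
  exact (key n le_rfl).1

lemma convexOn_monotoneOn {D : ℝ → ℝ} {L : ℝ} (hconv : ConvexOn ℝ (Icc 0 L) D)
    (h0 : D 0 = 0) (hnn : ∀ x ∈ Icc 0 L, 0 ≤ D x) : MonotoneOn D (Icc 0 L) := by
  intro x hx y hy hxy
  rcases eq_or_lt_of_le hx.1 with h | h
  · rw [← h, h0]; exact hnn y hy
  · have hy0 : 0 < y := h.trans_le hxy
    have hm0 : (0 : ℝ) ∈ Icc 0 L := ⟨le_rfl, hy.1.trans hy.2⟩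
    have ha : 0 ≤ 1 - x / y := by rw [sub_nonneg, div_le_one hy0]; exact hxy
    have hb : 0 ≤ x / y := by positivity
    have h1 := hconv.2 hm0 hy ha hb (by ring)
    simp only [smul_eq_mul, mul_zero, zero_add, h0] at h1
    rw [div_mul_cancel₀ _ hy0.ne'] at h1
    have : x / y ≤ 1 := by rw [div_le_one hy0]; exact hxy
    nlinarith [hnn y hy]

lemma deriv_nonneg_of_nonneg_right {X X' : ℝ → ℝ} {B : ℝ} (hB : 0 < B)
    (hX : ∀ c, HasDerivAt X (X' c) c) (hX0 : X 0 = 0) (hXn : ∀ c ∈ Icc 0 B, 0 ≤ X c) :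
    0 ≤ X' 0 := by
  have h := (hX 0).tendsto_slope_zero_right
  refine ge_of_tendsto h ?_
  filter_upwards [Ioo_mem_nhdsGT hB] with t ht
  simp only [zero_add, hX0, sub_zero, smul_eq_mul]
  exact mul_nonneg (inv_nonneg.2 ht.1.le) (hXn t ⟨ht.1.le, ht.2.le⟩)

lemma integral_comp_nonneg_one_sided {D X X' : ℝ → ℝ} {L B : ℝ} (hL : 0 ≤ L) (hB : 0 < B)
    (hD : Continuous D) (hconv : ConvexOn ℝ (Icc 0 L) D) (h0 : D 0 = 0)
    (hnn : ∀ x ∈ Icc 0 L, 0 ≤ D x) (hDB : ∀ x ∈ Icc 0 L, D x ≤ B)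
    (hX : ∀ c, HasDerivAt X (X' c) c) (hX' : Continuous X') (hX0 : X 0 = 0)
    (hXn : ∀ c ∈ Icc 0 B, 0 ≤ X c) : 0 ≤ ∫ x in (0 : ℝ)..L, X' (D x) := by
  rcases hL.eq_or_lt with h | hL
  · simp [← h]
  have hmono := convexOn_monotoneOn hconv h0 hnn
  have hX'0 := deriv_nonneg_of_nonneg_right hB hX hX0 hXn
  have huc : UniformContinuousOn (fun x => X' (D x)) (Icc 0 L) :=
    isCompact_Icc.uniformContinuousOn_of_continuous (by fun_prop)
  suffices H : ∀ ε > 0, -(ε * L) ≤ ∫ x in (0 : ℝ)..L, X' (D x) by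
    by_contra hneg
    push Not at hneg
    have := H (-(∫ x in (0 : ℝ)..L, X' (D x)) / (2 * L)) (by apply div_pos <;> linarith)
    have e : -(∫ x in (0 : ℝ)..L, X' (D x)) / (2 * L) * L
      = -(∫ x in (0 : ℝ)..L, X' (D x)) / 2 := by field_simp
    rw [e] at this
    linarith
  intro ε hε
  obtain ⟨η, hη, hu⟩ := Metric.uniformContinuousOn_iff.1 huc ε hε
  obtain ⟨n, hn⟩ := exists_nat_gt (L / η)
  have hn0 : (0 : ℝ) < n := (div_pos hL hη).trans hn
  set t : ℝ := L / n with ht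
  have ht0 : 0 < t := div_pos hL hn0
  have htη : t < η := by rw [ht, div_lt_iff₀ hn0]; rw [div_lt_iff₀ hη] at hn; linarith
  have htn : n * t = L := by rw [ht]; field_simp
  have hmem : ∀ k : ℕ, k ≤ n → (k * t) ∈ Icc 0 L := fun k hk =>
    ⟨by positivity, by rw [← htn]; gcongr⟩
  -- choose sample points
  have hpt : ∀ k : ℕ, ∃ x, k < n → x ∈ Icc (k * t) ((k + 1 : ℕ) * t) ∧
      X' (D x) * (D ((k + 1 : ℕ) * t) - D (k * t)) = X (D ((k + 1 : ℕ) * t)) - X (D (k * t)) ∧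
      (D ((k + 1 : ℕ) * t) = D (k * t) → x = k * t) := by
    intro k
    by_cases hk : k < n
    · have hle : (k : ℝ) * t ≤ (k + 1 : ℕ) * t := by gcongr; simp
      have hle2 := hmono (hmem k hk.le) (hmem (k + 1) hk) hle
      rcases hle2.eq_or_lt with h | h
      · exact ⟨k * t, fun _ => ⟨⟨le_rfl, hle⟩, by rw [← h]; ring, fun _ => rfl⟩⟩
      · obtain ⟨c, hc, hc2⟩ := exists_hasDerivAt_eq_slope X X' h
          (fun x _ => (hX x).continuousAt.continuousWithinAt) (fun x _ => hX x)
        obtain ⟨x, hx, hxc⟩ := intermediate_value_Icc hle hD.continuousOn ⟨hc.1.le, hc.2.le⟩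
        refine ⟨x, fun _ => ⟨hx, ?_, fun h' => absurd h' h.ne'⟩⟩
        rw [hxc, hc2, div_mul_cancel₀]
        linarith
    · exact ⟨0, fun h => absurd h hk⟩
  choose p hp using hpt
  -- weights
  set δ : ℕ → ℝ := fun k => if k < n then D ((k + 1 : ℕ) * t) - D (k * t)
    else D (n * t) - D ((n - 1 : ℕ) * t) with hδ
  have hn1 : 1 ≤ n := by exact_mod_cast hn0
  have hδm : Monotone δ := by
    apply monotone_nat_of_le_succ
    intro k
    simp only [hδ]
    by_cases hk1 : k + 1 < n
    · rw [if_pos (by omega : k < n), if_pos hk1]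
      have := hconv.2 (hmem k (by omega)) (hmem (k + 2) (by omega))
        (by norm_num : (0 : ℝ) ≤ 1 / 2) (by norm_num : (0 : ℝ) ≤ 1 / 2) (by norm_num)
      simp only [smul_eq_mul] at this
      have e : (1 / 2 : ℝ) * (k * t) + 1 / 2 * ((k + 2 : ℕ) * t) = (k + 1 : ℕ) * t := by
        push_cast; ring
      rw [e] at this
      have e2 : k + 1 + 1 = k + 2 := rfl
      rw [e2]
      linarith
    · rw [if_neg hk1]
      by_cases hk : k < n
      · rw [if_pos hk]
        have : n = k + 1 := by omega
        subst this
        simp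
      · rw [if_neg hk]
  have hδk : ∀ k < n, δ k = D ((k + 1 : ℕ) * t) - D (k * t) := fun k hk => by simp [hδ, hk]
  have hδ0 : 0 ≤ δ 0 := by
    rw [hδk 0 hn1]
    simp only [Nat.cast_zero, zero_mul, h0, sub_zero]
    exact hnn _ (hmem _ hn1)
  set y : ℕ → ℝ := fun k => if k < n then X' (D (p k)) else 0 with hy
  have hyk : ∀ k < n, y k = X' (D (p k)) := fun k hk => by simp [hy, hk]
  have hsum : ∀ k ≤ n, ∑ j ∈ Finset.range k, y j * δ j = X (D (k * t)) := by
    intro k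
    induction k with
    | zero => intro _; simp [h0, hX0]
    | succ k ih =>
      intro hk
      rw [Finset.sum_range_succ, ih (by omega), hyk k hk, hδk k hk, (hp k hk).2.1]
      ring
  have hS : 0 ≤ ∑ j ∈ Finset.range n, y j := by
    refine sum_nonneg_of_weighted hδm hδ0 ?_ n ?_
    · intro k hk
      by_cases hkn : k < n
      · rw [hyk k hkn]
        have hd := hδk k hkn
        rw [hk] at hd
        rw [(hp k hkn).2.2 (by linarith)]
        have hz : ∀ j ≤ k, D (j * t) = 0 := by
          intro j
          induction j with
          | zero => intro _; simpa using h0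
          | succ j ih =>
            intro hj
            have h1 := hδk j (by omega)
            have h2 : δ j = 0 := le_antisymm (by rw [← hk]; exact hδm (by omega))
              (hδ0.trans (hδm (Nat.zero_le j)))
            rw [h2, ih (by omega)] at h1
            linarith
        rw [hz k le_rfl]
        exact hX'0
      · simp [hy, hkn]
    · intro k hk
      rw [hsum k hk]
      exact hXn _ ⟨hnn _ (hmem k hk), hDB _ (hmem k hk)⟩
  have hii : ∀ a b : ℝ, IntervalIntegrable (fun x => X' (D x)) volume a b := fun a b =>
    (hX'.comp hD).intervalIntegrable a b
  have hsplit : ∫ x in (0 : ℝ)..L, X' (D x)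
      = ∑ k ∈ Finset.range n, ∫ x in (k * t)..((k + 1 : ℕ) * t), X' (D x) := by
    rw [intervalIntegral.sum_integral_adjacent_intervals (a := fun k : ℕ => (k : ℝ) * t)
      (fun k _ => hii _ _)]
    simp [htn]
  rw [hsplit]
  have hpiece : ∀ k ∈ Finset.range n, t * (y k - ε)
      ≤ ∫ x in (k * t)..((k + 1 : ℕ) * t), X' (D x) := by
    intro k hk
    rw [Finset.mem_range] at hk
    have hle : (k : ℝ) * t ≤ (k + 1 : ℕ) * t := by gcongr; simp
    have e : t * (y k - ε) = ∫ x in (k * t)..((k + 1 : ℕ) * t), (y k - ε) := by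
      rw [intervalIntegral.integral_const, smul_eq_mul]; push_cast; ring
    rw [e]
    refine intervalIntegral.integral_mono_on hle (by simp) (hii _ _) ?_
    intro x hx
    have hpk := (hp k hk).1
    have hxm : x ∈ Icc 0 L := ⟨(hmem k hk.le).1.trans hx.1, hx.2.trans (hmem (k+1) hk).2⟩
    have hpm : p k ∈ Icc 0 L := ⟨(hmem k hk.le).1.trans hpk.1, hpk.2.trans (hmem (k+1) hk).2⟩
    have hdist : dist x (p k) < η := by
      refine lt_of_le_of_lt ?_ htη
      rw [Real.dist_eq, abs_le]
      have h1 := hx.1; have h2 := hx.2; have h3 := hpk.1; have h4 := hpk.2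
      push_cast at h2 h4
      constructor <;> nlinarith
    have := hu x hxm (p k) hpm hdist
    rw [Real.dist_eq, abs_lt] at this
    rw [hyk k hk]
    linarith [this.1]
  refine le_trans ?_ (Finset.sum_le_sum hpiece)
  rw [← Finset.mul_sum, Finset.sum_sub_distrib]
  simp only [Finset.sum_const, Finset.card_range, nsmul_eq_mul]
  have : t * (n * ε) = ε * L := by rw [← htn]; ring
  nlinarith [mul_nonneg ht0.le hS]

lemma ConvexOn_comp_affine {D : ℝ → ℝ} {s : Set ℝ} (h : ConvexOn ℝ s D) (a c : ℝ) {t : Set ℝ}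
    (ht : Convex ℝ t) (hts : ∀ x ∈ t, a * x + c ∈ s) : ConvexOn ℝ t (fun x => D (a * x + c)) := by
  refine ⟨ht, fun x hx y hy α β hα hβ hαβ => ?_⟩
  have := h.2 (hts x hx) (hts y hy) hα hβ hαβ
  convert this using 2
  simp only [smul_eq_mul]
  linear_combination -c * hαβ

/-- `D` is a nonnegative continuous function, convex on `[0,l]`, bounded by `B` there, with a zero. -/
structure Depth (l B : ℝ) (D : ℝ → ℝ) : Prop where
  cont : Continuous D
  conv : ConvexOn ℝ (Icc 0 l) D
  nonneg : ∀ x ∈ Icc 0 l, 0 ≤ D x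
  le : ∀ x ∈ Icc 0 l, D x ≤ B
  zero : ∃ x ∈ Icc 0 l, D x = 0

lemma Depth.integral_comp_nonneg {l B : ℝ} {D X X' : ℝ → ℝ} (hD : Depth l B D) (hB : 0 < B)
    (hX : ∀ c, HasDerivAt X (X' c) c) (hX' : Continuous X') (hX0 : X 0 = 0)
    (hXn : ∀ c ∈ Icc 0 B, 0 ≤ X c) : 0 ≤ ∫ x in (0 : ℝ)..l, X' (D x) := by
  obtain ⟨x0, hx0, hz⟩ := hD.zero
  have hc : Continuous (fun x => X' (D x)) := hX'.comp hD.cont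
  have h1 : 0 ≤ ∫ x in (0 : ℝ)..(l - x0), X' (D (x + x0)) := by
    have := integral_comp_nonneg_one_sided (D := fun x => D (1 * x + x0)) (L := l - x0)
      (by linarith [hx0.2]) hB (hD.cont.comp (by fun_prop))
      (ConvexOn_comp_affine hD.conv 1 x0 (convex_Icc _ _)
        (fun x hx => ⟨by linarith [hx.1, hx0.1], by linarith [hx.2]⟩))
      (by simp [hz]) (fun x hx => hD.nonneg _ ⟨by linarith [hx.1, hx0.1], by linarith [hx.2]⟩)
      (fun x hx => hD.le _ ⟨by linarith [hx.1, hx0.1], by linarith [hx.2]⟩) hX hX' hX0 hXn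
    simpa using this
  have h2 : 0 ≤ ∫ x in (0 : ℝ)..x0, X' (D (x0 - x)) := by
    have := integral_comp_nonneg_one_sided (D := fun x => D ((-1) * x + x0)) (L := x0)
      hx0.1 hB (hD.cont.comp (by fun_prop))
      (ConvexOn_comp_affine hD.conv (-1) x0 (convex_Icc _ _)
        (fun x hx => ⟨by linarith [hx.2], by linarith [hx.1, hx0.2]⟩))
      (by simp [hz]) (fun x hx => hD.nonneg _ ⟨by linarith [hx.2], by linarith [hx.1, hx0.2]⟩)
      (fun x hx => hD.le _ ⟨by linarith [hx.2], by linarith [hx.1, hx0.2]⟩) hX hX' hX0 hXn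
    have e : ∀ x, -1 * x + x0 = x0 - x := fun x => by ring
    simpa only [e] using this
  rw [intervalIntegral.integral_comp_add_right (fun x => X' (D x))] at h1
  rw [intervalIntegral.integral_comp_sub_left (fun x => X' (D x))] at h2
  simp only [zero_add, sub_add_cancel, sub_self, sub_zero] at h1 h2
  rw [← intervalIntegral.integral_add_adjacent_intervals
    (hc.intervalIntegrable 0 x0) (hc.intervalIntegrable x0 l)]
  linarith

lemma Depth.norm_integral_comp_le {l B : ℝ} {D Ψ Ψ' : ℝ → ℝ} {X X' : ℝ → ℂ} (hD : Depth l B D)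
    (hB : 0 < B) (hX : ∀ c, HasDerivAt X (X' c) c) (hX' : Continuous X') (hX0 : X 0 = 0)
    (hΨ : ∀ c, HasDerivAt Ψ (Ψ' c) c) (hΨ' : Continuous Ψ') (hΨ0 : Ψ 0 = 0)
    (hle : ∀ c ∈ Icc 0 B, ‖X c‖ ≤ Ψ c) :
    ‖∫ x in (0 : ℝ)..l, X' (D x)‖ ≤ ∫ x in (0 : ℝ)..l, Ψ' (D x) := by
  set I := ∫ x in (0 : ℝ)..l, X' (D x) with hI
  have hcX : Continuous (fun x => X' (D x)) := hX'.comp hD.cont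
  have hcΨ : Continuous (fun x => Ψ' (D x)) := hΨ'.comp hD.cont
  obtain ⟨u, hu, huI⟩ : ∃ u : ℂ, ‖u‖ = 1 ∧ u * I = (‖I‖ : ℂ) := by
    by_cases h : I = 0
    · exact ⟨1, by simp, by simp [h]⟩
    · have hn : (‖I‖ : ℂ) ≠ 0 := by simpa using h
      refine ⟨(‖I‖ : ℂ) / I, by simp [h], by field_simp⟩
  have hre : ∀ c, HasDerivAt (fun c => Ψ c - (u * X c).re) (Ψ' c - (u * X' c).re) c := by
    intro c
    have h1 := ((hX c).const_mul u)
    have h2 : HasDerivAt (fun c => (u * X c).re) ((u * X' c).re) c := by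
      exact (Complex.reCLM.hasFDerivAt (x := u * X c)).comp_hasDerivAt c h1
    exact (hΨ c).sub h2
  have h := hD.integral_comp_nonneg hB hre (by fun_prop) (by simp [hX0, hΨ0]) (fun c hc => by
    have h1 := hle c hc
    have h2 := Complex.re_le_norm (u * X c)
    rw [norm_mul, hu, one_mul] at h2
    linarith)
  have hcre : Continuous (fun x => (u * X' (D x)).re) :=
    Complex.continuous_re.comp (continuous_const.mul hcX)
  rw [intervalIntegral.integral_sub (hcΨ.intervalIntegrable _ _)
    (hcre.intervalIntegrable _ _)] at h
  have e : ∫ x in (0 : ℝ)..l, (u * X' (D x)).re = ‖I‖ := by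
    have : ∫ x in (0 : ℝ)..l, (u * X' (D x)) = (‖I‖ : ℂ) := by
      rw [intervalIntegral.integral_const_mul, ← hI, huI]
    have h3 := Complex.reCLM.intervalIntegral_comp_comm (μ := volume)
      (Continuous.intervalIntegrable (continuous_const.mul hcX : Continuous fun x => u * X' (D x)) 0 l)
    simp only [Complex.reCLM_apply, Pi.mul_apply] at h3
    rw [h3, this, Complex.ofReal_re]
  linarith

end Planar

end

section
open MeasureTheory Set Filter Topology

namespace Planar

/-- The weighted exponential integral `∫₀ˡ w(x) exp(z₁ x + z₂ φ(x)) dx`. -/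
noncomputable def expInt (l : ℝ) (w φ : ℝ → ℝ) (z : ℂ × ℂ) : ℂ :=
  ∫ x in (0 : ℝ)..l, (w x : ℂ) * Complex.exp (z.1 * x + z.2 * φ x)

lemma hasFDerivAt_expInt (l : ℝ) {w φ : ℝ → ℝ} (hw : Continuous w) (hφ : Continuous φ)
    (z : ℂ × ℂ) :
    HasFDerivAt (expInt l w φ)
      (expInt l (fun x => w x * x) φ z • ContinuousLinearMap.fst ℂ ℂ ℂ +
        expInt l (fun x => w x * φ x) φ z • ContinuousLinearMap.snd ℂ ℂ ℂ) z := by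
  set F' : ℂ × ℂ → ℝ → (ℂ × ℂ) →L[ℂ] ℂ := fun z x =>
    ((w x * x : ℝ) * Complex.exp (z.1 * x + z.2 * φ x)) • ContinuousLinearMap.fst ℂ ℂ ℂ +
    ((w x * φ x : ℝ) * Complex.exp (z.1 * x + z.2 * φ x)) • ContinuousLinearMap.snd ℂ ℂ ℂ with hF'
  set bound : ℝ → ℝ := fun x => (|w x * x| + |w x * φ x|) *
    Real.exp ((‖z‖ + 1) * |x| + (‖z‖ + 1) * |φ x|) with hbound
  have hcF' : ∀ z, Continuous (F' z) := fun z => by simp only [hF']; fun_prop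
  have hcb : Continuous bound := by simp only [hbound]; fun_prop
  have key := intervalIntegral.hasFDerivAt_integral_of_dominated_of_fderiv_le (μ := volume)
    (𝕜 := ℂ) (a := 0) (b := l) (s := Metric.ball z 1)
    (F := fun (z : ℂ × ℂ) x => (w x : ℂ) * Complex.exp (z.1 * x + z.2 * φ x)) (F' := F')
    (x₀ := z) (bound := bound) (Metric.ball_mem_nhds z one_pos)
    (Filter.Eventually.of_forall fun z => Continuous.aestronglyMeasurable (by fun_prop))
    (Continuous.intervalIntegrable (by fun_prop) _ _)
    (hcF' z).aestronglyMeasurable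
    (Filter.Eventually.of_forall fun x _ y hy => by
      have hyn : ‖y‖ ≤ ‖z‖ + 1 := by
        have := norm_sub_norm_le y z
        rw [mem_ball_iff_norm] at hy
        linarith
      have h1 : ‖y.1‖ ≤ ‖z‖ + 1 := (norm_fst_le y).trans hyn
      have h2 : ‖y.2‖ ≤ ‖z‖ + 1 := (norm_snd_le y).trans hyn
      have he : ‖Complex.exp (y.1 * x + y.2 * φ x)‖ ≤
          Real.exp ((‖z‖ + 1) * |x| + (‖z‖ + 1) * |φ x|) := by
        rw [Complex.norm_exp]
        apply Real.exp_le_exp.2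
        refine (Complex.re_le_norm _).trans ((norm_add_le _ _).trans ?_)
        rw [norm_mul, norm_mul, Complex.norm_real, Complex.norm_real, Real.norm_eq_abs,
          Real.norm_eq_abs]
        gcongr
      simp only [hF', hbound]
      refine (norm_add_le _ _).trans ?_
      rw [norm_smul, norm_smul, norm_mul, norm_mul, Complex.norm_real, Complex.norm_real,
        Real.norm_eq_abs, Real.norm_eq_abs, add_mul]
      have hf := ContinuousLinearMap.norm_fst_le ℂ ℂ ℂ
      have hs := ContinuousLinearMap.norm_snd_le ℂ ℂ ℂ
      apply add_le_add
      · calc _ ≤ |w x * x| * Real.exp ((‖z‖ + 1) * |x| + (‖z‖ + 1) * |φ x|) * 1 := by gcongr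
          _ = _ := mul_one _
      · calc _ ≤ |w x * φ x| * Real.exp ((‖z‖ + 1) * |x| + (‖z‖ + 1) * |φ x|) * 1 := by gcongr
          _ = _ := mul_one _)
    (hcb.intervalIntegrable _ _)
    (Filter.Eventually.of_forall fun x _ y _ => by
      have h1 : HasFDerivAt (fun z : ℂ × ℂ => z.1 * x + z.2 * φ x)
          ((x : ℂ) • ContinuousLinearMap.fst ℂ ℂ ℂ + (φ x : ℂ) • ContinuousLinearMap.snd ℂ ℂ ℂ) y :=
        (hasFDerivAt_fst.mul_const (x : ℂ)).add (hasFDerivAt_snd.mul_const (φ x : ℂ))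
      have h2 := (h1.cexp).const_mul (w x : ℂ)
      refine h2.congr_fderiv ?_
      ext <;> simp [hF'] <;> ring)
  refine HasFDerivAt.congr_fderiv key ?_
  have e : ∫ x in (0 : ℝ)..l, F' z x = (∫ x in (0 : ℝ)..l, ((w x * x : ℝ) *
      Complex.exp (z.1 * x + z.2 * φ x)) • ContinuousLinearMap.fst ℂ ℂ ℂ) +
      ∫ x in (0 : ℝ)..l, ((w x * φ x : ℝ) *
      Complex.exp (z.1 * x + z.2 * φ x)) • ContinuousLinearMap.snd ℂ ℂ ℂ := by
    rw [← intervalIntegral.integral_add]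
    · exact Continuous.intervalIntegrable (by fun_prop) _ _
    · exact Continuous.intervalIntegrable (by fun_prop) _ _
  rw [e, intervalIntegral.integral_smul_const, intervalIntegral.integral_smul_const]
  simp [expInt]

lemma contDiff_expInt (l : ℝ) {w φ : ℝ → ℝ} (hw : Continuous w) (hφ : Continuous φ) :
    ContDiff ℂ 1 (expInt l w φ) := by
  rw [contDiff_one_iff_hasFDerivAt]
  refine ⟨_, ?_, hasFDerivAt_expInt l hw hφ⟩
  have h1 : Continuous (expInt l (fun x => w x * x) φ) := continuous_iff_continuousAt.2 fun z =>
    (hasFDerivAt_expInt l (by fun_prop) hφ z).continuousAt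
  have h2 : Continuous (expInt l (fun x => w x * φ x) φ) := continuous_iff_continuousAt.2 fun z =>
    (hasFDerivAt_expInt l (by fun_prop) hφ z).continuousAt
  fun_prop

end Planar

end

section
open MeasureTheory Set Filter Topology

namespace Planar

/-- The exponential integral `∫₀ˡ exp(λ D(x)) dx`. -/
noncomputable def depthInt (l : ℝ) (D : ℝ → ℝ) (z : ℂ) : ℂ :=
  ∫ x in (0 : ℝ)..l, Complex.exp (z * D x)

lemma re_intervalIntegral {f : ℝ → ℂ} (hf : Continuous f) (a b : ℝ) :
    (∫ x in a..b, f x).re = ∫ x in a..b, (f x).re := by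
  have h3 := Complex.reCLM.intervalIntegral_comp_comm (μ := volume) (hf.intervalIntegrable a b)
  simpa using h3.symm

lemma depthInt_eq_expInt (l : ℝ) (D : ℝ → ℝ) (z : ℂ) :
    depthInt l D z = expInt l (fun _ => 1) D (0, z) := by
  simp [depthInt, expInt]

lemma differentiable_depthInt (l : ℝ) {D : ℝ → ℝ} (hD : Continuous D) :
    Differentiable ℂ (depthInt l D) := by
  have h : depthInt l D = fun z => expInt l (fun _ => 1) D (0, z) := by
    funext z; exact depthInt_eq_expInt l D z
  rw [h]
  exact ((contDiff_expInt l continuous_const hD).differentiable one_ne_zero).comp (by fun_prop)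

lemma depthInt_conj (l : ℝ) (D : ℝ → ℝ) (z : ℂ) :
    depthInt l D (starRingEnd ℂ z) = starRingEnd ℂ (depthInt l D z) := by
  rw [depthInt, depthInt, intervalIntegral.intervalIntegral_eq_integral_uIoc,
    intervalIntegral.intervalIntegral_eq_integral_uIoc]
  simp only [Complex.real_smul, map_mul, Complex.conj_ofReal]
  rw [← integral_conj]
  simp only [← Complex.exp_conj, map_mul, Complex.conj_ofReal]

lemma norm_depthInt_le {l B : ℝ} (hl : 0 ≤ l) {D : ℝ → ℝ} (z : ℂ)
    (h : ∀ x ∈ Icc 0 l, z.re * D x ≤ B) : ‖depthInt l D z‖ ≤ l * Real.exp B := by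
  have := intervalIntegral.norm_integral_le_of_norm_le_const (a := 0) (b := l)
    (f := fun x => Complex.exp (z * D x)) (C := Real.exp B) (fun x hx => by
      rw [uIoc_of_le hl] at hx
      rw [Complex.norm_exp]
      apply Real.exp_le_exp.2
      simpa using h x ⟨hx.1.le, hx.2⟩)
  rw [sub_zero, abs_of_nonneg hl] at this
  rw [depthInt]; linarith

lemma hasDerivAt_re_mul_exp (u μ : ℂ) (c : ℝ) :
    HasDerivAt (fun c : ℝ => (u * Complex.exp (μ * c)).re) (u * μ * Complex.exp (μ * c)).re c := by
  have h1 : HasDerivAt (fun c : ℝ => μ * (c : ℂ)) (μ * 1) c :=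
    (Complex.ofRealCLM.hasDerivAt (x := c)).const_mul μ
  have h2 := (h1.cexp).const_mul u
  have h3 := (Complex.reCLM.hasFDerivAt (x := u * Complex.exp (μ * c))).comp_hasDerivAt c h2
  refine h3.congr_deriv ?_
  simp only [Complex.reCLM_apply]
  congr 1; ring

lemma Depth.re_exp_le {l B : ℝ} {D : ℝ → ℝ} (hD : Depth l B D) (hB : 0 < B) (a k β : ℝ) (u μ : ℂ)
    (h : ∀ c ∈ Icc 0 B, 0 ≤ k * Real.exp (a * c) - (u * Complex.exp (μ * c)).re - (k - u.re) + β * c) :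
    (u * μ * depthInt l D μ).re ≤ k * a * (∫ x in (0 : ℝ)..l, Real.exp (a * D x)) + β * l := by
  have hc := hD.cont
  have key := hD.integral_comp_nonneg hB
    (X := fun c => k * Real.exp (a * c) - (u * Complex.exp (μ * c)).re - (k - u.re) + β * c)
    (X' := fun c => k * a * Real.exp (a * c) - (u * μ * Complex.exp (μ * c)).re + β)
    (fun c => by
      have h1 : HasDerivAt (fun c : ℝ => k * Real.exp (a * c)) (k * (Real.exp (a * c) * (a * 1))) c :=
        (((hasDerivAt_id c).const_mul a).exp).const_mul k
      have h4 : HasDerivAt (fun c : ℝ => β * c) (β * 1) c := (hasDerivAt_id c).const_mul β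
      have := ((h1.sub (hasDerivAt_re_mul_exp u μ c)).sub_const (k - u.re)).add h4
      refine this.congr_deriv ?_
      ring)
    (by
      have : Continuous fun c : ℝ => (u * μ * Complex.exp (μ * c)).re :=
        Complex.continuous_re.comp (by fun_prop)
      fun_prop)
    (by simp) h
  have c1 : Continuous fun x => k * a * Real.exp (a * D x) := by fun_prop
  have c2 : Continuous fun x => (u * μ * Complex.exp (μ * D x)) := by fun_prop
  have c3 : Continuous fun x => (u * μ * Complex.exp (μ * D x)).re := Complex.continuous_re.comp c2
  have c4 : Continuous fun x => k * a * Real.exp (a * D x) -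
    (u * μ * Complex.exp (μ * D x)).re := c1.sub c3
  rw [intervalIntegral.integral_add (c4.intervalIntegrable _ _) (by simp),
    intervalIntegral.integral_sub (c1.intervalIntegrable _ _) (c3.intervalIntegrable _ _),
    ← re_intervalIntegral c2, intervalIntegral.integral_const_mul,
    intervalIntegral.integral_const_mul, intervalIntegral.integral_const] at key
  simp only [smul_eq_mul, sub_zero] at key
  rw [depthInt]
  linarith

/-- A pair of depth functions (top and bottom) of a convex body inside a slab of width `W`. -/
structure Slab (l W : ℝ) (d s : ℝ → ℝ) : Prop where
  l_pos : 0 < l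
  W_pos : 0 < W
  top : Depth l W d
  bot : Depth l W s
  gap_nonneg : ∀ x ∈ Icc 0 l, d x + s x ≤ W
  gap_pos : ∀ x ∈ Ioo 0 l, d x + s x < W

lemma Slab.swap {l W : ℝ} {d s : ℝ → ℝ} (h : Slab l W d s) : Slab l W s d :=
  ⟨h.l_pos, h.W_pos, h.bot, h.top, fun x hx => by rw [add_comm]; exact h.gap_nonneg x hx,
    fun x hx => by rw [add_comm]; exact h.gap_pos x hx⟩

noncomputable def slabA (l W : ℝ) (d s : ℝ → ℝ) (z : ℂ) : ℂ :=
  Complex.exp (z * W) * depthInt l d (-z) - depthInt l s z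

noncomputable def slabR (l W : ℝ) (d s : ℝ → ℝ) (a : ℝ) : ℝ :=
  Real.exp (a * W) * (∫ x in (0 : ℝ)..l, Real.exp (-a * d x)) - ∫ x in (0 : ℝ)..l, Real.exp (a * s x)

lemma slabR_eq {l W : ℝ} {d s : ℝ → ℝ} (h : Slab l W d s) (a : ℝ) :
    slabR l W d s a = ∫ x in (0 : ℝ)..l, (Real.exp (a * (W - d x)) - Real.exp (a * s x)) := by
  have := h.top.cont
  have := h.bot.cont
  rw [intervalIntegral.integral_sub (Continuous.intervalIntegrable (by fun_prop) _ _)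
    (Continuous.intervalIntegrable (by fun_prop) _ _), slabR, ← intervalIntegral.integral_const_mul]
  congr 2
  funext x
  rw [← Real.exp_add]; ring_nf

lemma differentiable_slabA {l W : ℝ} {d s : ℝ → ℝ} (h : Slab l W d s) :
    Differentiable ℂ (slabA l W d s) := by
  have h1 := differentiable_depthInt l h.top.cont
  have h2 := differentiable_depthInt l h.bot.cont
  have h3 : Differentiable ℂ fun z => depthInt l d (-z) := h1.comp differentiable_neg
  unfold slabA
  fun_prop

lemma slabA_neg (l W : ℝ) (d s : ℝ → ℝ) (z : ℂ) :
    slabA l W d s (-z) = -Complex.exp (-z * W) * slabA l W s d z := by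
  simp only [slabA, neg_neg]
  have : Complex.exp (-z * W) * Complex.exp (z * W) = 1 := by
    rw [← Complex.exp_add]; simp
  linear_combination (depthInt l s (-z)) * this

lemma slabA_conj (l W : ℝ) (d s : ℝ → ℝ) (z : ℂ) :
    slabA l W d s (starRingEnd ℂ z) = starRingEnd ℂ (slabA l W d s z) := by
  simp only [slabA, map_sub, map_mul, ← depthInt_conj, ← Complex.exp_conj, Complex.conj_ofReal,
    map_neg]

lemma slabR_pos {l W : ℝ} {d s : ℝ → ℝ} (h : Slab l W d s) {a : ℝ} (ha : a ≠ 0) :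
    0 < a * slabR l W d s a := by
  have h1 := h.top.cont
  have h2 := h.bot.cont
  rw [slabR_eq h, ← intervalIntegral.integral_const_mul]
  refine intervalIntegral.intervalIntegral_pos_of_pos_on
    (Continuous.intervalIntegrable (by fun_prop) _ _) ?_ h.l_pos
  intro x hx
  have hg := h.gap_pos x hx
  rcases lt_or_gt_of_ne ha with hneg | hpos
  · apply mul_pos_of_neg_of_neg hneg
    rw [sub_neg]
    exact Real.exp_lt_exp.2 (mul_lt_mul_of_neg_left (by linarith) hneg)
  · apply mul_pos hpos
    rw [sub_pos]
    exact Real.exp_lt_exp.2 (mul_lt_mul_of_pos_left (by linarith) hpos)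

lemma Slab.re_ge_of_line {l W : ℝ} {d s : ℝ → ℝ} (h : Slab l W d s) {z : ℂ} {m : ℤ}
    (hz : z.im * W = m * (2 * Real.pi)) :
    z.re * slabR l W d s z.re ≤ (z * slabA l W d s z).re := by
  have hexp : ∀ c : ℝ, (Complex.exp (z * c)).re ≤ Real.exp (z.re * c) := fun c => by
    refine (Complex.re_le_norm _).trans ?_
    rw [Complex.norm_exp]; simp
  have hW : Complex.exp (z * W) = Real.exp (z.re * W) := by
    have : z * W = (z.re * W : ℝ) + m * (2 * Real.pi * Complex.I) := by
      apply Complex.ext <;> simp [hz]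
    rw [this, Complex.exp_add, Complex.exp_int_mul_two_pi_mul_I]; simp
  have hb := h.bot.re_exp_le h.W_pos z.re 1 0 1 z (fun c _ => by
    simpa using hexp c)
  have ht := h.top.re_exp_le h.W_pos (-z.re) (Real.exp (z.re * W)) 0 (Complex.exp (z * W)) (-z)
    (fun c _ => by
      have e1 : Complex.exp (z * W) * Complex.exp (-z * c) = Complex.exp (z * ((W - c : ℝ) : ℂ)) := by
        rw [← Complex.exp_add]; push_cast; ring_nf
      have e2 : Real.exp (z.re * W) * Real.exp (-z.re * c) = Real.exp (z.re * (W - c)) := by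
        rw [← Real.exp_add]; ring_nf
      rw [e1, e2, hW, Complex.ofReal_re]
      have := hexp (W - c)
      linarith)
  have e : z * slabA l W d s z = -(Complex.exp (z * W) * -z * depthInt l d (-z))
      - 1 * z * depthInt l s z := by
    rw [slabA]; ring
  rw [e, Complex.sub_re, Complex.neg_re, slabR]
  linarith

lemma Slab.re_ge_of_nonneg {l W : ℝ} {d s : ℝ → ℝ} (h : Slab l W d s) {z : ℂ} (hz : 0 ≤ z.re) :
    z.re * slabR l W d s z.re - |z.im| * l ≤
      (Complex.exp (-(z.im * W : ℝ) * Complex.I) * (z * slabA l W d s z)).re := by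
  have hre : ∀ c : ℝ, (Complex.exp (z * c)).re ≤ Real.exp (z.re * c) := fun c => by
    refine (Complex.re_le_norm _).trans ?_
    rw [Complex.norm_exp]; simp
  set u : ℂ := Complex.exp (-(z.im * W : ℝ) * Complex.I) with hu
  have huW : u * Complex.exp (z * W) = (Real.exp (z.re * W) : ℝ) := by
    rw [hu, ← Complex.exp_add, Complex.ofReal_exp]
    congr 1
    apply Complex.ext <;> simp
  have hb := h.bot.re_exp_le h.W_pos z.re 1 |z.im| u z (fun c hc => by
    have e1 : (u * Complex.exp (z * c)).re = Real.exp (z.re * c) * Real.cos (z.im * (W - c)) := by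
      rw [hu, ← Complex.exp_add, Complex.exp_re]
      congr 1
      · simp
      · rw [← Real.cos_neg]; congr 1; simp; ring
    have e2 : u.re = Real.cos (z.im * W) := by
      rw [hu, Complex.exp_re]; simp
    rw [e1, e2]
    have h1 : 1 ≤ Real.exp (z.re * c) := Real.one_le_exp (mul_nonneg hz hc.1)
    have h2 := Real.cos_le_one (z.im * (W - c))
    have h3 : Real.cos (z.im * (W - c)) - Real.cos (z.im * W) ≤ |z.im| * c := by
      refine (le_abs_self _).trans ?_
      have := Real.abs_cos_sub_cos_le (z.im * (W - c)) (z.im * W)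
      refine this.trans (le_of_eq ?_)
      rw [← abs_of_nonneg hc.1, ← abs_mul, abs_of_nonneg hc.1, ← abs_neg]; congr 1; ring
    nlinarith)
  have ht := h.top.re_exp_le h.W_pos (-z.re) (Real.exp (z.re * W)) 0 (Real.exp (z.re * W) : ℝ) (-z)
    (fun c _ => by
      rw [Complex.re_ofReal_mul, Complex.ofReal_re]
      have : (Complex.exp (-z * c)).re ≤ Real.exp (-z.re * c) := by
        refine (Complex.re_le_norm _).trans ?_
        rw [Complex.norm_exp]; simp
      have h1 := mul_le_mul_of_nonneg_left this (Real.exp_pos (z.re * W)).le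
      linarith)
  have e : u * (z * slabA l W d s z) = -(((Real.exp (z.re * W) : ℝ) : ℂ) * -z * depthInt l d (-z))
      - u * z * depthInt l s z := by
    rw [slabA, ← huW]; ring
  rw [e, Complex.sub_re, Complex.neg_re, slabR]
  linarith

end Planar

end

section
open MeasureTheory Set Filter Topology

namespace Planar

/-- A positive lower-bound constant depending only on the thickness function `g`. -/
noncomputable def gapConst (l : ℝ) (g : ℝ → ℝ) : ℝ :=
  1 / 2 * ∫ x in (0 : ℝ)..l, (1 - Real.exp (-g x / 2))

lemma gapConst_pos {l : ℝ} {g : ℝ → ℝ} (hl : 0 < l) (hg : Continuous g) (hpos : ∀ x ∈ Ioo 0 l, 0 < g x) :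
    0 < gapConst l g := by
  refine mul_pos (by norm_num) ?_
  refine intervalIntegral.intervalIntegral_pos_of_pos_on
    (Continuous.intervalIntegrable (by fun_prop) _ _) ?_ hl
  intro x hx
  rw [sub_pos, Real.exp_lt_one_iff]
  linarith [hpos x hx]

lemma Slab.slabR_ge {l W : ℝ} {d s : ℝ → ℝ} (h : Slab l W d s) {a : ℝ} (ha : 1 ≤ a) :
    gapConst l (fun x => W - d x - s x) * Real.exp (a * W / 2) ≤ slabR l W d s a := by
  have h1 := h.top.cont
  have h2 := h.bot.cont
  obtain ⟨x0, hx0, hz⟩ := h.top.zero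
  rw [slabR_eq h]
  set F : ℝ → ℝ := fun x => Real.exp (a * (W - d x)) - Real.exp (a * s x) with hF
  have hFc : Continuous F := by simp only [hF]; fun_prop
  have hFn : ∀ x ∈ Icc 0 l, 0 ≤ F x := fun x hx => by
    have := h.gap_nonneg x hx
    simp only [hF]
    rw [sub_nonneg]
    apply Real.exp_le_exp.2
    apply mul_le_mul_of_nonneg_left <;> linarith
  have hsub : ∫ x in (x0 / 2)..(x0 / 2 + l / 2), F x ≤ ∫ x in (0 : ℝ)..l, F x := by
    refine intervalIntegral.integral_mono_interval (by linarith [hx0.1]) (by linarith [h.l_pos])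
      (by linarith [hx0.2]) ?_ (hFc.intervalIntegrable _ _)
    filter_upwards [ae_restrict_mem measurableSet_Ioc] with x hx
    exact hFn x ⟨hx.1.le, hx.2⟩
  refine le_trans ?_ hsub
  have hsc : ∫ x in (x0 / 2)..(x0 / 2 + l / 2), F x
      = 1 / 2 * ∫ x in (0 : ℝ)..l, F (1 / 2 * x + x0 / 2) := by
    rw [intervalIntegral.integral_comp_mul_add F (by norm_num : (1 / 2 : ℝ) ≠ 0)]
    simp only [smul_eq_mul, mul_zero, zero_add]
    have e : 1 / 2 * l + x0 / 2 = x0 / 2 + l / 2 := by ring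
    rw [e]; ring
  rw [hsc, gapConst, mul_assoc, ← intervalIntegral.integral_mul_const]
  refine mul_le_mul_of_nonneg_left ?_ (by norm_num)
  refine intervalIntegral.integral_mono_on h.l_pos.le
    (Continuous.intervalIntegrable (by fun_prop) _ _)
    (Continuous.intervalIntegrable (by fun_prop) _ _) ?_
  intro x hx
  have hh : (0 : ℝ) ≤ 1 / 2 := by norm_num
  have hd := h.top.conv.2 hx hx0 hh hh (by norm_num)
  have hs := h.bot.conv.2 hx hx0 hh hh (by norm_num)
  simp only [smul_eq_mul, hz, mul_zero, add_zero] at hd hs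
  have e : 1 / 2 * x + 1 / 2 * x0 = 1 / 2 * x + x0 / 2 := by ring
  rw [e] at hd hs
  have g0 := h.gap_nonneg x0 hx0
  rw [hz] at g0
  have gx := h.gap_nonneg x hx
  have dx := h.top.le x hx
  set y := 1 / 2 * x + x0 / 2
  have hfac : F y = Real.exp (a * (W - d y)) * (1 - Real.exp (-(a * (W - d y - s y)))) := by
    have e1 : Real.exp (a * s y) = Real.exp (a * (W - d y)) * Real.exp (-(a * (W - d y - s y))) := by
      rw [← Real.exp_add]; ring_nf
    simp only [hF]
    rw [e1]; ring
  rw [hfac, mul_comm]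
  have hgap : (W - d x - s x) / 2 ≤ W - d y - s y := by linarith
  have ha0 : (0 : ℝ) ≤ a := by linarith
  apply mul_le_mul
  · apply Real.exp_le_exp.2
    have := mul_le_mul_of_nonneg_left (show W / 2 ≤ W - d y by linarith) ha0
    linarith
  · apply sub_le_sub_left
    apply Real.exp_le_exp.2
    nlinarith
  · rw [sub_nonneg, Real.exp_le_one_iff]; linarith
  · exact (Real.exp_pos _).le

lemma Slab.norm_ge {l W : ℝ} {d s : ℝ → ℝ} (h : Slab l W d s) {z : ℂ} (hz : 1 ≤ z.re) :
    z.re * (gapConst l (fun x => W - d x - s x) * Real.exp (z.re * W / 2)) - |z.im| * l ≤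
      ‖z * slabA l W d s z‖ := by
  have h1 := h.re_ge_of_nonneg (z := z) (by linarith)
  have h2 := mul_le_mul_of_nonneg_left (h.slabR_ge hz) (by linarith : 0 ≤ z.re)
  have h3 := Complex.re_le_norm (Complex.exp (-(z.im * W : ℝ) * Complex.I) * (z * slabA l W d s z))
  rw [norm_mul, ← Complex.ofReal_neg, Complex.norm_exp_ofReal_mul_I, one_mul] at h3
  rw [← Complex.ofReal_neg] at h1
  linarith

lemma Slab.norm_exp_div_le {l W b : ℝ} {d s : ℝ → ℝ} (h : Slab l W d s) {z : ℂ} (hz : 1 ≤ |z.re|)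
    (hb : |z.im| ≤ b) (hR : 0 < |z.re| * gapConst l (fun x => W - d x - s x) - b * l) :
    ‖Complex.exp (z * W / 2) / (z * slabA l W d s z)‖ ≤
      1 / (|z.re| * gapConst l (fun x => W - d x - s x) - b * l) := by
  have main : ∀ {d s : ℝ → ℝ}, Slab l W d s → ∀ {z : ℂ}, 1 ≤ z.re → |z.im| ≤ b →
      0 < z.re * gapConst l (fun x => W - d x - s x) - b * l →
      ‖Complex.exp (z * W / 2) / (z * slabA l W d s z)‖ ≤
      1 / (z.re * gapConst l (fun x => W - d x - s x) - b * l) := by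
    intro d s h z hz hb hR
    have h1 := h.norm_ge hz
    have hre : (z * W / 2).re = z.re * W / 2 := by
      rw [show z * W / 2 = z * (W / 2 : ℝ) by push_cast; ring, Complex.re_mul_ofReal]; ring
    rw [norm_div, Complex.norm_exp, hre]
    have hE : 1 ≤ Real.exp (z.re * W / 2) := Real.one_le_exp (by have := h.W_pos; positivity)
    have h2 : Real.exp (z.re * W / 2) * (z.re * gapConst l (fun x => W - d x - s x) - b * l) ≤
        ‖z * slabA l W d s z‖ := by
      refine le_trans ?_ h1
      have hbl : 0 ≤ b * l := mul_nonneg ((abs_nonneg _).trans hb) h.l_pos.le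
      have := mul_le_mul_of_nonneg_right hb h.l_pos.le
      nlinarith
    have hpos : 0 < ‖z * slabA l W d s z‖ :=
      lt_of_lt_of_le (mul_pos (Real.exp_pos _) hR) h2
    rw [div_le_div_iff₀ hpos hR, one_mul]
    exact h2
  rcases le_or_gt 0 z.re with h0 | h0
  · rw [abs_of_nonneg h0] at hz hR ⊢
    exact main h hz hb hR
  · rw [abs_of_neg h0] at hz hR ⊢
    have hg : (fun x => W - d x - s x) = fun x => W - s x - d x := by funext x; ring
    have := main h.swap (z := -z) (by simpa using hz) (by simpa using hb)
      (by rw [← hg]; simpa using hR)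
    rw [← hg, Complex.neg_re] at this
    convert this using 2
    have e := slabA_neg l W s d z
    rw [e]
    have : Complex.exp (z * W / 2) * Complex.exp (-z * W) = Complex.exp (-z * W / 2) := by
      rw [← Complex.exp_add]; congr 1; ring
    rw [← this]
    have hne := Complex.exp_ne_zero (-z * W)
    by_cases hA : z * slabA l W d s z = 0
    · have : -z * (-Complex.exp (-z * W) * slabA l W d s z) = 0 := by
        linear_combination Complex.exp (-z * W) * hA
      rw [hA, this]; simp
    · rw [show -z * (-Complex.exp (-z * W) * slabA l W d s z) =
        Complex.exp (-z * W) * (z * slabA l W d s z) by ring]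
      field_simp

lemma Slab.ne_zero_of_line {l W : ℝ} {d s : ℝ → ℝ} (h : Slab l W d s) {z : ℂ} {m : ℤ}
    (hz : z.im * W = m * (2 * Real.pi)) (hre : z.re ≠ 0) : 0 < (z * slabA l W d s z).re :=
  (slabR_pos h hre).trans_le (h.re_ge_of_line hz)

lemma Slab.exists_zero {l W : ℝ} {d s : ℝ → ℝ} (h : Slab l W d s) {m : ℤ} (hm : 1 ≤ m)
    (h1 : slabA l W d s ((m * (2 * Real.pi) / W : ℝ) * Complex.I) ≠ 0)
    (h2 : slabA l W d s (((m + 1 : ℤ) * (2 * Real.pi) / W : ℝ) * Complex.I) ≠ 0) :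
    ∃ p : ℂ, p.im ∈ Ioo (m * (2 * Real.pi) / W) ((m + 1 : ℤ) * (2 * Real.pi) / W) ∧
      slabA l W d s p = 0 := by
  by_contra hcon
  push Not at hcon
  have hW := h.W_pos
  have hπ := Real.pi_pos
  have hm' : (1 : ℝ) ≤ m := by exact_mod_cast hm
  set b1 : ℝ := m * (2 * Real.pi) / W with hb1
  set b2 : ℝ := (m + 1 : ℤ) * (2 * Real.pi) / W with hb2
  have hb1W : b1 * W = m * (2 * Real.pi) := by rw [hb1]; field_simp
  have hb2W : b2 * W = (m + 1 : ℤ) * (2 * Real.pi) := by rw [hb2]; field_simp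
  have hb1p : 0 < b1 := by rw [hb1]; positivity
  have hb12 : b1 < b2 := by rw [hb1, hb2]; push_cast; gcongr; linarith
  have hG : ∀ z : ℂ, z.im ∈ Icc b1 b2 → z * slabA l W d s z ≠ 0 := by
    intro z hz hzero
    have hline : ∀ (k : ℤ) (b : ℝ), b * W = k * (2 * Real.pi) → slabA l W d s (b * Complex.I) ≠ 0 →
        z.im ≠ b := by
      intro k b hbW hA hb
      by_cases hre : z.re = 0
      · have : z = b * Complex.I := by apply Complex.ext <;> simp [hre, hb]
        rw [← this] at hA
        rcases mul_eq_zero.1 hzero with h0 | h0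
        · rw [h0] at hz; simp at hz; linarith [hz.1]
        · exact hA h0
      · have := h.ne_zero_of_line (z := z) (m := k) (by rw [hb, hbW]) hre
        rw [hzero] at this; simp at this
    have hn1 := hline m b1 hb1W h1
    have hn2 := hline (m + 1) b2 hb2W h2
    have hmem : z.im ∈ Ioo b1 b2 := ⟨lt_of_le_of_ne hz.1 (Ne.symm hn1), lt_of_le_of_ne hz.2 hn2⟩
    rcases mul_eq_zero.1 hzero with h0 | h0
    · rw [h0] at hz; simp at hz; linarith [hz.1]
    · exact hcon z hmem h0
  set G : ℂ → ℂ := fun z => z * slabA l W d s z with hGdef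
  have hGd : Differentiable ℂ G := differentiable_id.mul (differentiable_slabA h)
  set Y : ℂ → ℂ := fun z => Complex.exp (z * W / 2) / G z with hY
  have hYd : ∀ z : ℂ, z.im ∈ Icc b1 b2 → DifferentiableAt ℂ Y z := fun z hz =>
    DifferentiableAt.div (by fun_prop) (hGd z) (hG z hz)
  -- sign of the exponential factor on the two lines
  obtain ⟨σ, hσ1, hσr⟩ : ∃ σ : ℝ, σ * σ = 1 ∧ Complex.exp ((b1 * W / 2 : ℝ) * Complex.I) = σ := by
    have e : Complex.exp ((b1 * W / 2 : ℝ) * Complex.I) ^ 2 = 1 := by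
      rw [← Complex.exp_nat_mul, show ((2 : ℕ) : ℂ) * ((b1 * W / 2 : ℝ) * Complex.I)
        = m * (2 * Real.pi * Complex.I) by
          rw [hb1W]; push_cast; ring]
      exact Complex.exp_int_mul_two_pi_mul_I m
    rcases mul_self_eq_one_iff.1 ((sq _).symm.trans e) with h | h
    · exact ⟨1, by norm_num, by rw [h]; simp⟩
    · exact ⟨-1, by norm_num, by rw [h]; simp⟩
  have hσ2 : Complex.exp ((b2 * W / 2 : ℝ) * Complex.I) = -σ := by
    have : ((b2 * W / 2 : ℝ) : ℂ) * Complex.I = (b1 * W / 2 : ℝ) * Complex.I + Real.pi * Complex.I := by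
      rw [hb2W, hb1W]; push_cast; ring
    rw [this, Complex.exp_add, Complex.exp_pi_mul_I, hσr]; ring
  have hYline : ∀ (b τ : ℝ), Complex.exp ((b * W / 2 : ℝ) * Complex.I) = τ → ∀ a : ℝ,
      Y (a + b * Complex.I) = τ * (Real.exp (a * W / 2) * (G (a + b * Complex.I))⁻¹) := by
    intro b τ hτ a
    simp only [hY]
    rw [show (a + b * Complex.I) * W / 2 = (a * W / 2 : ℝ) + (b * W / 2 : ℝ) * Complex.I by
      push_cast; ring, Complex.exp_add, hτ, Complex.ofReal_exp]
    ring
  have himl : ∀ a b : ℝ, ((a : ℂ) + b * Complex.I).im = b := fun a b => by simp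
  have hrel : ∀ a b : ℝ, ((a : ℂ) + b * Complex.I).re = a := fun a b => by simp
  set k : ℝ → ℝ → ℝ := fun b a => (Real.exp (a * W / 2) * (G (a + b * Complex.I))⁻¹ : ℂ).re with hk
  have hkc : ∀ b ∈ Icc b1 b2, Continuous fun a : ℝ => (Real.exp (a * W / 2) * (G (a + b * Complex.I))⁻¹ : ℂ) := by
    intro b hb
    refine Continuous.mul (by fun_prop) (Continuous.inv₀ (hGd.continuous.comp (by fun_prop)) ?_)
    intro a
    exact hG _ (by rw [himl]; exact hb)
  have hkpos : ∀ (b : ℝ) (n : ℤ), b * W = n * (2 * Real.pi) → b ∈ Icc b1 b2 → ∀ a ≠ 0, 0 < k b a := by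
    intro b n hn hb a ha
    have hp := h.ne_zero_of_line (z := a + b * Complex.I) (m := n) (by rw [himl, hn]) (by simpa using ha)
    simp only [hk, hGdef]
    rw [Complex.re_ofReal_mul, Complex.inv_re]
    have : 0 < Complex.normSq ((a + b * Complex.I) * slabA l W d s (a + b * Complex.I)) :=
      Complex.normSq_pos.2 (hG _ (by rw [himl]; exact hb))
    positivity
  have hm1 : b1 ∈ Icc b1 b2 := ⟨le_rfl, hb12.le⟩
  have hm2 : b2 ∈ Icc b1 b2 := ⟨hb12.le, le_rfl⟩
  have hknn : ∀ (b : ℝ) (n : ℤ), b * W = n * (2 * Real.pi) → b ∈ Icc b1 b2 → ∀ a, 0 ≤ k b a := by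
    intro b n hn hb a
    have hc : Continuous (k b) := Complex.continuous_re.comp (hkc b hb)
    have hd : Dense ({0}ᶜ : Set ℝ) := dense_compl_singleton 0
    have hcl : IsClosed {a | 0 ≤ k b a} := isClosed_le continuous_const hc
    have : closure ({0}ᶜ : Set ℝ) ⊆ {a | 0 ≤ k b a} :=
      closure_minimal (fun a ha => (hkpos b n hn hb a ha).le) hcl
    exact this (hd a)
  set η : ℝ := ∫ a in (0 : ℝ)..1, k b1 a with hη
  have hηpos : 0 < η :=
    intervalIntegral.intervalIntegral_pos_of_pos_on
      ((Complex.continuous_re.comp (hkc b1 hm1)).intervalIntegrable _ _)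
      (fun a ha => hkpos b1 m hb1W hm1 a ha.1.ne') one_pos
  set c0 := gapConst l (fun x => W - d x - s x) with hc0
  have hc0p : 0 < c0 := by
    have c1 := h.top.cont
    have c2 := h.bot.cont
    exact gapConst_pos h.l_pos (by fun_prop) (fun x hx => by linarith [h.gap_pos x hx])
  -- choose a wide rectangle
  obtain ⟨R, hR1, hRpos, hRη⟩ : ∃ R : ℝ, 1 ≤ R ∧ 0 < R * c0 - b2 * l ∧
      2 * ((b2 - b1) * (1 / (R * c0 - b2 * l))) < η := by
    have hb2l : 0 ≤ b2 * l := mul_nonneg (hb1p.trans hb12).le h.l_pos.le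
    refine ⟨1 + (b2 * l + 4 * (b2 - b1) / η) / c0, ?_, ?_, ?_⟩
    · have : 0 ≤ (b2 * l + 4 * (b2 - b1) / η) / c0 := by
        have := sub_pos.2 hb12
        positivity
      linarith
    · rw [add_mul, div_mul_cancel₀ _ hc0p.ne']
      have := sub_pos.2 hb12
      have : 0 < 4 * (b2 - b1) / η := by positivity
      linarith
    · rw [add_mul, div_mul_cancel₀ _ hc0p.ne']
      have := sub_pos.2 hb12
      have h4 : 0 < 4 * (b2 - b1) / η := by positivity
      have e : 1 * c0 + (b2 * l + 4 * (b2 - b1) / η) - b2 * l = c0 + 4 * (b2 - b1) / η := by ring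
      rw [e, show 2 * ((b2 - b1) * (1 / (c0 + 4 * (b2 - b1) / η)))
        = (2 * (b2 - b1)) / (c0 + 4 * (b2 - b1) / η) by ring, div_lt_iff₀ (by positivity)]
      have e2 : η * (c0 + 4 * (b2 - b1) / η) = η * c0 + 4 * (b2 - b1) := by field_simp
      rw [e2]
      nlinarith [mul_pos hηpos hc0p]
  have hrect := Complex.integral_boundary_rect_eq_zero_of_differentiableOn Y
    (-R + b1 * Complex.I) (R + b2 * Complex.I) (fun z hz => by
      rw [Complex.mem_reProdIm] at hz
      have h2 := hz.2
      simp only [Complex.add_im, Complex.neg_im, Complex.ofReal_im, neg_zero, Complex.mul_im,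
        Complex.ofReal_re, Complex.I_im, mul_one, Complex.I_re, mul_zero, add_zero, zero_add] at h2
      rw [uIcc_of_le hb12.le] at h2
      exact (hYd z h2).differentiableWithinAt)
  have e1 : (-(R : ℂ) + b1 * Complex.I).re = -R := by simp
  have e2 : (-(R : ℂ) + b1 * Complex.I).im = b1 := by simp
  have e3 : ((R : ℂ) + b2 * Complex.I).re = R := by simp
  have e4 : ((R : ℂ) + b2 * Complex.I).im = b2 := by simp
  rw [e1, e2, e3, e4] at hrect
  have hvert : ∀ x : ℝ, |x| = R → ‖∫ y in b1..b2, Y (x + y * Complex.I)‖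
      ≤ (b2 - b1) * (1 / (R * c0 - b2 * l)) := by
    intro x hx
    have := intervalIntegral.norm_integral_le_of_norm_le_const (a := b1) (b := b2)
      (f := fun y : ℝ => Y (x + y * Complex.I)) (C := 1 / (R * c0 - b2 * l)) (fun y hy => by
        rw [uIoc_of_le hb12.le] at hy
        have hy2 : |y| ≤ b2 := by rw [abs_of_pos (hb1p.trans hy.1)]; exact hy.2
        have := h.norm_exp_div_le (z := x + y * Complex.I) (b := b2) (by rw [hrel, hx]; exact hR1)
          (by rw [himl]; exact hy2) (by rw [hrel, hx]; exact hRpos)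
        rw [hrel, hx] at this
        exact this)
    rw [abs_of_pos (sub_pos.2 hb12)] at this
    linarith
  have hv1 := hvert R (abs_of_pos (by linarith))
  have hv2 := hvert (-R) (by rw [abs_neg, abs_of_pos (by linarith)])
  set V1 := ∫ y in b1..b2, Y (R + y * Complex.I)
  set V2 := ∫ y in b1..b2, Y ((-R : ℝ) + y * Complex.I)
  have h_int : ∀ (b τ : ℝ), b ∈ Icc b1 b2 → Complex.exp ((b * W / 2 : ℝ) * Complex.I) = τ →
      ∃ w : ℂ, ∫ x in (-R)..R, Y (x + b * Complex.I) = τ * w ∧ w.re = ∫ x in (-R)..R, k b x := by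
    intro b τ hb hτ
    refine ⟨∫ x in (-R)..R, (Real.exp (x * W / 2) * (G (x + b * Complex.I))⁻¹ : ℂ), ?_, ?_⟩
    · rw [← intervalIntegral.integral_const_mul]
      congr 1; funext x; exact hYline b τ hτ x
    · rw [re_intervalIntegral (hkc b hb)]
  obtain ⟨w1, hw1, hw1r⟩ := h_int b1 σ hm1 hσr
  obtain ⟨w2, hw2, hw2r⟩ := h_int b2 (-σ) hm2 (by rw [hσ2]; push_cast; ring)
  rw [hw1, hw2] at hrect
  have hww : w1 + w2 = -(σ * (Complex.I * (V1 - V2))) := by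
    have hσc : (σ : ℂ) * σ = 1 := by rw [← Complex.ofReal_mul, hσ1]; simp
    simp only [smul_eq_mul] at hrect
    push_cast at hrect
    linear_combination σ * hrect - (w1 + w2) * hσc
  have hn : ‖-(σ * (Complex.I * (V1 - V2)))‖ ≤ 2 * ((b2 - b1) * (1 / (R * c0 - b2 * l))) := by
    have hσn : ‖(σ : ℂ)‖ = 1 := by
      have : |σ| * |σ| = 1 := by rw [← abs_mul, hσ1, abs_one]
      rw [Complex.norm_real, Real.norm_eq_abs]
      nlinarith [abs_nonneg σ]
    rw [norm_neg, norm_mul, norm_mul, hσn, Complex.norm_I, one_mul, one_mul]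
    refine (norm_sub_le _ _).trans ?_
    linarith
  have hre : (w1 + w2).re ≤ 2 * ((b2 - b1) * (1 / (R * c0 - b2 * l))) := by
    rw [hww]
    exact (Complex.re_le_norm _).trans hn
  rw [Complex.add_re, hw1r, hw2r] at hre
  have hlow1 : η ≤ ∫ x in (-R)..R, k b1 x := by
    refine intervalIntegral.integral_mono_interval (by linarith) zero_le_one hR1 ?_
      ((Complex.continuous_re.comp (hkc b1 hm1)).intervalIntegrable _ _)
    exact Filter.Eventually.of_forall fun x => hknn b1 m hb1W hm1 x
  have hlow2 : 0 ≤ ∫ x in (-R)..R, k b2 x :=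
    intervalIntegral.integral_nonneg (by linarith) fun x _ => hknn b2 (m + 1) hb2W hm2 x
  linarith

end Planar

end

section
open MeasureTheory Set Filter Topology

namespace Planar

lemma Slab.norm_slabA_le {l W : ℝ} {d s : ℝ → ℝ} (h : Slab l W d s) (z : ℂ) :
    ‖slabA l W d s z‖ ≤ 2 * l * (1 + Real.exp (z.re * W)) := by
  have hl := h.l_pos
  have hW := h.W_pos
  have e1 := Real.exp_pos (z.re * W)
  have hexp : ‖Complex.exp (z * W)‖ = Real.exp (z.re * W) := by
    rw [Complex.norm_exp, Complex.re_mul_ofReal]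
  unfold slabA
  refine (norm_sub_le _ _).trans ?_
  rw [norm_mul, hexp]
  rcases le_total 0 z.re with h0 | h0
  · have h1 : ‖depthInt l d (-z)‖ ≤ l * Real.exp 0 := norm_depthInt_le hl.le _ fun x hx => by
      have := h.top.nonneg x hx
      simp only [Complex.neg_re]; nlinarith
    have h2 : ‖depthInt l s z‖ ≤ l * Real.exp (z.re * W) := norm_depthInt_le hl.le _ fun x hx =>
      mul_le_mul_of_nonneg_left (h.bot.le x hx) h0
    rw [Real.exp_zero, mul_one] at h1
    nlinarith [mul_le_mul_of_nonneg_left h1 e1.le]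
  · have h1 : ‖depthInt l d (-z)‖ ≤ l * Real.exp (-z.re * W) := norm_depthInt_le hl.le _ fun x hx => by
      have := h.top.le x hx
      simp only [Complex.neg_re]; nlinarith
    have h2 : ‖depthInt l s z‖ ≤ l * Real.exp 0 := norm_depthInt_le hl.le _ fun x hx =>
      mul_nonpos_of_nonpos_of_nonneg h0 (h.bot.nonneg x hx)
    rw [Real.exp_zero, mul_one] at h2
    have h3 := mul_le_mul_of_nonneg_left h1 e1.le
    have : Real.exp (z.re * W) * (l * Real.exp (-z.re * W)) = l := by
      rw [mul_left_comm, ← Real.exp_add]; simp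
    rw [this] at h3
    nlinarith

lemma one_add_sq_le_of_far {r t : ℝ} (hr : 0 < r) (ht : 2 * r + 1 ≤ t ∨ (0 ≤ t ∧ t ≤ r / 2)) :
    1 + t ^ 2 ≤ (8 + 4 * (1 + r ^ 2) / r ^ 2) * (t - r) ^ 2 := by
  have hA : 0 ≤ 4 * (1 + r ^ 2) / r ^ 2 := by positivity
  have hs := sq_nonneg (t - r)
  rcases ht with ht | ⟨h0, ht⟩
  · have : 1 + t ^ 2 ≤ 8 * (t - r) ^ 2 := by nlinarith
    nlinarith [mul_nonneg hA hs]
  · have h1 : r ^ 2 / 4 ≤ (t - r) ^ 2 := by nlinarith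
    have h2 := mul_le_mul_of_nonneg_left h1 hA
    have h3 : 4 * (1 + r ^ 2) / r ^ 2 * (r ^ 2 / 4) = 1 + r ^ 2 := by field_simp
    nlinarith

/-- In a period strip, a zero of `slabA` excludes any further zero and is simple. -/
lemma Slab.zero_rigid {l W : ℝ} {d s : ℝ → ℝ} (h : Slab l W d s) {m : ℤ} {p c : ℂ}
    (hp : p.im ∈ Ioo (m * (2 * Real.pi) / W) ((m + 1 : ℤ) * (2 * Real.pi) / W))
    (hA : slabA l W d s p = 0)
    (hc : c.im ∈ Ioo (m * (2 * Real.pi) / W) ((m + 1 : ℤ) * (2 * Real.pi) / W))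
    (hz : dslope (fun z => z * slabA l W d s z) p c = 0) : False := by
  have hW := h.W_pos
  have hl := h.l_pos
  have hπ := Real.pi_pos
  set b1 : ℝ := m * (2 * Real.pi) / W with hb1
  set b2 : ℝ := (m + 1 : ℤ) * (2 * Real.pi) / W with hb2
  have hb1W : b1 * W = m * (2 * Real.pi) := by rw [hb1]; field_simp
  have hb2W : b2 * W = (m + 1 : ℤ) * (2 * Real.pi) := by rw [hb2]; field_simp
  have hb21 : b2 * W = b1 * W + 2 * Real.pi := by rw [hb1W, hb2W]; push_cast; ring
  have hb12 : b1 < b2 := by nlinarith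
  set G : ℂ → ℂ := fun z => z * slabA l W d s z with hG
  have hGd : Differentiable ℂ G := differentiable_id.mul (differentiable_slabA h)
  have hGp : G p = 0 := by simp [hG, hA]
  set ω : ℂ → ℂ := fun z => Complex.exp (z * W / 2) with hω
  have hωd : Differentiable ℂ ω := by simp only [hω]; fun_prop
  have hωn : ∀ z, ‖ω z‖ = Real.exp (z.re * W / 2) := fun z => by
    simp only [hω]
    rw [Complex.norm_exp, show z * W / 2 = z * (W / 2 : ℝ) by push_cast; ring,
      Complex.re_mul_ofReal]; ring_nf
  have hωinj : ∀ u v : ℂ, ω u = ω v → |u.im - v.im| < 4 * Real.pi / W → u = v := by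
    intro u v huv hlt
    obtain ⟨n, hn⟩ := Complex.exp_eq_exp_iff_exists_int.1 huv
    have hWc : (W : ℂ) ≠ 0 := by exact_mod_cast hW.ne'
    have e : u - v = (n * (4 * Real.pi / W) : ℝ) * Complex.I := by
      push_cast; field_simp; linear_combination 2 * hn
    have e2 : u.im - v.im = n * (4 * Real.pi / W) := by
      have := congrArg Complex.im e
      simpa using this
    have hpos : 0 < 4 * Real.pi / W := by positivity
    rw [e2, abs_mul, abs_of_pos hpos] at hlt
    have h1 : |(n : ℝ)| < 1 := by
      by_contra hcon
      push Not at hcon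
      nlinarith
    have : n = 0 := by
      have h2 : |n| < 1 := by exact_mod_cast h1
      exact Int.abs_lt_one_iff.1 h2
    rw [this] at e
    simp at e
    exact sub_eq_zero.1 e
  have hconjω : ∀ z, (starRingEnd ℂ) (ω z) = ω ((starRingEnd ℂ) z) := fun z => by
    simp only [hω]
    rw [← Complex.exp_conj]
    simp only [map_div₀, map_mul, Complex.conj_ofReal, map_ofNat]
  -- the denominator factor at the conjugate does not vanish on the closed strip
  have hrefl : ∀ z, (starRingEnd ℂ) (ω z) = ω ((starRingEnd ℂ) z + 2 * b1 * Complex.I) := by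
    intro z
    rw [hconjω]
    simp only [hω]
    rw [Complex.exp_eq_exp_iff_exists_int]
    refine ⟨-m, ?_⟩
    have : (b1 : ℂ) * W = m * (2 * Real.pi) := by exact_mod_cast hb1W
    push_cast; linear_combination -Complex.I * this
  have h4 : 4 * Real.pi / W = 2 * (b2 - b1) := by
    rw [hb1, hb2]; push_cast; field_simp; ring
  have hne2 : ∀ z : ℂ, z.im ∈ Icc b1 b2 → ω z - (starRingEnd ℂ) (ω p) ≠ 0 := by
    intro z hz h0
    rw [hrefl, sub_eq_zero] at h0
    have him : ((starRingEnd ℂ) p + 2 * b1 * Complex.I).im = -p.im + 2 * b1 := by simp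
    have := hωinj _ _ h0 (by
      rw [him, h4, abs_lt]; constructor <;> linarith [hz.1, hz.2, hp.1, hp.2])
    have := congrArg Complex.im this
    rw [him] at this
    linarith [hz.1, hp.1]
  set w := dslope ω p with hw
  have hwne : ∀ z : ℂ, z.im ∈ Icc b1 b2 → w z ≠ 0 := by
    intro z hz h0
    by_cases hzp : z = p
    · rw [hzp, hw, dslope_same] at h0
      have hd : HasDerivAt ω (Complex.exp (p * W / 2) * (1 * W / 2)) p := by
        simp only [hω]
        exact (((hasDerivAt_id p).mul_const (W : ℂ)).div_const 2).cexp
      rw [hd.deriv] at h0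
      have hWc : (W : ℂ) ≠ 0 := by exact_mod_cast hW.ne'
      rcases mul_eq_zero.1 h0 with h0 | h0
      · exact Complex.exp_ne_zero _ h0
      · apply hWc; linear_combination 2 * h0
    · have := sub_smul_dslope ω p z
      rw [← hw, h0, smul_zero] at this
      refine hzp (hωinj _ _ (sub_eq_zero.1 this.symm) ?_)
      rw [h4, abs_lt]; constructor <;> linarith [hz.1, hz.2, hp.1, hp.2]
  set g := dslope G p with hg
  have hgd : Differentiable ℂ g := by
    rw [← differentiableOn_univ, hg, Complex.differentiableOn_dslope univ_mem]
    exact hGd.differentiableOn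
  have hwd : Differentiable ℂ w := by
    rw [← differentiableOn_univ, hw, Complex.differentiableOn_dslope univ_mem]
    exact hωd.differentiableOn
  set G1 : ℂ → ℂ := fun z => g z / (w z * (ω z - (starRingEnd ℂ) (ω p))) with hG1
  have hGeq : ∀ z, z ≠ p → G1 z = G z / ((ω z - ω p) * (ω z - (starRingEnd ℂ) (ω p))) := by
    intro z hz
    have e1 := sub_smul_dslope G p z
    have e2 := sub_smul_dslope ω p z
    rw [smul_eq_mul] at e1 e2
    have hne := sub_ne_zero.2 hz
    simp only [hG1]
    rw [← e2, show G z = G z - G p by rw [hGp, sub_zero], ← e1, mul_assoc,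
      mul_div_mul_left _ _ hne]
  have hG1d : DiffContOnCl ℂ G1 (Complex.im ⁻¹' Ioo b1 b2) := by
    apply DifferentiableOn.diffContOnCl
    rw [Complex.closure_preimage_im, closure_Ioo hb12.ne]
    intro z hz
    exact ((hgd z).div ((hwd z).mul ((hωd z).sub_const _))
      (mul_ne_zero (hwne z hz) (hne2 z hz))).differentiableWithinAt
  -- sign on the lines
  have hline : ∀ (n : ℤ) (z : ℂ), z.im * W = n * (2 * Real.pi) → z.im ∈ Icc b1 b2 → z ≠ p →
      ∃ D : ℝ, 0 < D ∧ (G1 z).re = (G z).re / D := by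
    intro n z hzn hz hzp
    refine ⟨‖ω z - ω p‖ ^ 2, ?_, ?_⟩
    · have : ω z - ω p ≠ 0 := fun h0 => hwne z hz (by
        have := sub_smul_dslope ω p z
        rw [h0, smul_eq_mul] at this
        exact (mul_eq_zero.1 this).resolve_left (sub_ne_zero.2 hzp))
      positivity
    · rw [hGeq z hzp]
      have hreal : (starRingEnd ℂ) (ω z) = ω z := by
        rw [hconjω]
        simp only [hω]
        rw [Complex.exp_eq_exp_iff_exists_int]
        refine ⟨-n, ?_⟩
        have e : (starRingEnd ℂ) z = z - 2 * z.im * Complex.I := by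
          apply Complex.ext <;> simp; ring
        have e2 : (z.im : ℂ) * W = n * (2 * Real.pi) := by exact_mod_cast hzn
        rw [e]; push_cast; linear_combination -Complex.I * e2
      have : (ω z - ω p) * (ω z - (starRingEnd ℂ) (ω p)) = ((‖ω z - ω p‖ ^ 2 : ℝ) : ℂ) := by
        nth_rw 2 [← hreal]
        rw [← map_sub, Complex.mul_conj, Complex.normSq_eq_norm_sq]
      rw [this, Complex.div_ofReal_re]
  have hne_line : ∀ z : ℂ, z.im = b1 ∨ z.im = b2 → z ≠ p := by
    intro z hz hzp
    rw [hzp] at hz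
    rcases hz with hz | hz
    · exact hp.1.ne' hz
    · exact hp.2.ne hz
  have hnonneg : ∀ z : ℂ, z.im = b1 ∨ z.im = b2 → 0 ≤ (G1 z).re := by
    intro z hz
    obtain ⟨n, hn, hmem⟩ : ∃ n : ℤ, z.im * W = n * (2 * Real.pi) ∧ z.im ∈ Icc b1 b2 := by
      rcases hz with hz | hz
      · exact ⟨m, by rw [hz, hb1W], by rw [hz]; exact ⟨le_rfl, hb12.le⟩⟩
      · exact ⟨m + 1, by rw [hz, hb2W], by rw [hz]; exact ⟨hb12.le, le_rfl⟩⟩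
    obtain ⟨D, hD, hDe⟩ := hline n z hn hmem (hne_line z hz)
    rw [hDe]
    refine div_nonneg ?_ hD.le
    have := h.re_ge_of_line (z := z) hn
    refine le_trans ?_ this
    by_cases hre : z.re = 0
    · rw [hre]; simp
    · exact (slabR_pos h hre).le
  -- growth
  set r := ‖ω p‖ with hr
  have hrp : 0 < r := by rw [hr, hωn]; exact Real.exp_pos _
  have hfar : ∀ᶠ z : ℂ in comap (abs ∘ Complex.re) atTop,
      2 * r + 1 ≤ ‖ω z‖ ∨ (0 ≤ ‖ω z‖ ∧ ‖ω z‖ ≤ r / 2) := by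
    rw [eventually_comap]
    have t1 : Tendsto (fun a : ℝ => Real.exp (a * W / 2)) atTop atTop :=
      Real.tendsto_exp_atTop.comp ((tendsto_id.atTop_mul_const hW).atTop_div_const two_pos)
    have t2 : Tendsto (fun a : ℝ => Real.exp (-(a * W / 2))) atTop (𝓝 0) :=
      Real.tendsto_exp_neg_atTop_nhds_zero.comp
        ((tendsto_id.atTop_mul_const hW).atTop_div_const two_pos)
    filter_upwards [t1.eventually_ge_atTop (2 * r + 1),
      t2.eventually_le_const (show (0 : ℝ) < r / 2 by positivity)] with a h1 h2 z hza
    simp only [Function.comp] at hza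
    rw [hωn]
    rcases le_total 0 z.re with h0 | h0
    · rw [abs_of_nonneg h0] at hza
      left; rw [hza]; exact h1
    · rw [abs_of_nonpos h0] at hza
      right
      refine ⟨(Real.exp_pos _).le, ?_⟩
      rw [show z.re * W / 2 = -(a * W / 2) by rw [← hza]; ring]
      exact h2
  set C := 8 + 4 * (1 + r ^ 2) / r ^ 2 with hC
  have hCp : 0 < C := by positivity
  have hgrow : ∀ᶠ z : ℂ in comap (abs ∘ Complex.re) atTop ⊓ 𝓟 (Complex.im ⁻¹' Ioo b1 b2),
      ‖G1 z‖ ≤ ‖z‖ * (2 * l * C) := by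
    filter_upwards [hfar.filter_mono inf_le_left] with z hz
    have hzp : z ≠ p := by
      rintro rfl
      rcases hz with hz | hz <;> linarith
    have htr : 0 < (‖ω z‖ - r) ^ 2 := by
      have : ‖ω z‖ - r ≠ 0 := by rcases hz with hz | hz <;> intro h0 <;> linarith
      positivity
    have hb := one_add_sq_le_of_far hrp hz
    have n1 : |‖ω z‖ - r| ≤ ‖ω z - ω p‖ := abs_norm_sub_norm_le _ _
    have n2 : |‖ω z‖ - r| ≤ ‖ω z - (starRingEnd ℂ) (ω p)‖ := by
      have := abs_norm_sub_norm_le (ω z) ((starRingEnd ℂ) (ω p))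
      rwa [Complex.norm_conj] at this
    have n3 : (‖ω z‖ - r) ^ 2 ≤ ‖(ω z - ω p) * (ω z - (starRingEnd ℂ) (ω p))‖ := by
      rw [norm_mul, ← sq_abs, sq]
      exact mul_le_mul n1 n2 (abs_nonneg _) (norm_nonneg _)
    have n4 : ‖G z‖ ≤ ‖z‖ * (2 * l * (1 + ‖ω z‖ ^ 2)) := by
      have := h.norm_slabA_le z
      simp only [hG, norm_mul]
      refine mul_le_mul_of_nonneg_left (this.trans_eq ?_) (norm_nonneg _)
      rw [hωn, ← Real.exp_nat_mul]
      congr 3; push_cast; ring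
    rw [hGeq z hzp, norm_div, div_le_iff₀ (htr.trans_le n3)]
    calc ‖G z‖ ≤ ‖z‖ * (2 * l * (1 + ‖ω z‖ ^ 2)) := n4
      _ ≤ ‖z‖ * (2 * l * (C * (‖ω z‖ - r) ^ 2)) := by gcongr
      _ ≤ ‖z‖ * (2 * l * (C * ‖(ω z - ω p) * (ω z - (starRingEnd ℂ) (ω p))‖)) := by gcongr
      _ = _ := by ring
  have hPL : ∀ z : ℂ, z.im ∈ Icc b1 b2 → ‖Complex.exp (-G1 z)‖ ≤ 1 := by
    intro z hz
    have hbd : ∀ z : ℂ, z.im = b1 ∨ z.im = b2 → ‖Complex.exp (-G1 z)‖ ≤ 1 := fun z hz => by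
      rw [Complex.norm_exp, Real.exp_le_one_iff, Complex.neg_re]
      linarith [hnonneg z hz]
    refine PhragmenLindelof.horizontal_strip (f := fun z => Complex.exp (-G1 z)) (a := b1) (b := b2)
      (Differentiable.comp_diffContOnCl Complex.differentiable_exp hG1d.neg) ?_
      (fun z hz => hbd z (Or.inl hz)) (fun z hz => hbd z (Or.inr hz)) hz.1 hz.2
    have hbb : Real.pi / (b2 - b1) = W / 2 := by
      rw [div_eq_div_iff (sub_pos.2 hb12).ne' two_ne_zero]; linarith
    set M := max |b1| |b2|
    refine ⟨W / 4, by rw [hbb]; linarith, 2 * l * C * (4 / W + M), ?_⟩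
    apply Asymptotics.IsBigO.of_bound 1
    filter_upwards [hgrow, mem_inf_of_right (mem_principal_self _)] with z hz hzs
    rw [one_mul, Complex.norm_exp, Real.norm_eq_abs, Real.abs_exp]
    apply Real.exp_le_exp.2
    have h1 : (-G1 z).re ≤ ‖G1 z‖ := by
      have := Complex.re_le_norm (-G1 z); rwa [norm_neg] at this
    refine h1.trans (hz.trans ?_)
    have h2 : ‖z‖ ≤ |z.re| + M := by
      refine (Complex.norm_le_abs_re_add_abs_im z).trans ?_
      gcongr
      exact abs_le_max_abs_abs hzs.1.le hzs.2.le
    have h3 : |z.re| + M ≤ (4 / W + M) * Real.exp (W / 4 * |z.re|) := by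
      have e1 := Real.add_one_le_exp (W / 4 * |z.re|)
      have e2 : (4 / W) * (W / 4 * |z.re|) = |z.re| := by field_simp
      have hM : 0 ≤ M := (abs_nonneg _).trans (le_max_left _ _)
      have h4W : 0 < 4 / W := by positivity
      have e3 : 0 ≤ W / 4 * |z.re| := by positivity
      nlinarith [mul_le_mul_of_nonneg_left e1 h4W.le, mul_le_mul_of_nonneg_left e1 hM,
        mul_nonneg hM e3]
    have h4 : 0 ≤ 2 * l * C := by positivity
    nlinarith [mul_le_mul_of_nonneg_right (h2.trans h3) h4]
  have hG1c : G1 c = 0 := by simp only [hG1]; rw [hz, zero_div]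
  have hopen : IsOpen (Complex.im ⁻¹' Ioo b1 b2) := isOpen_Ioo.preimage Complex.continuous_im
  have hconv : Convex ℝ (Complex.im ⁻¹' Ioo b1 b2) :=
    (convex_Ioo b1 b2).is_linear_preimage (f := Complex.im) Complex.imLm.isLinear
  have hEq := Complex.eqOn_closure_of_isPreconnected_of_isMaxOn_norm
    (f := fun z => Complex.exp (-G1 z)) (c := c) hconv.isPreconnected hopen
    (Differentiable.comp_diffContOnCl Complex.differentiable_exp hG1d.neg) hc (by
      intro z hz
      simp only [mem_ofPred_eq, Function.comp, hG1c, neg_zero, Complex.exp_zero, norm_one]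
      exact hPL z ⟨hz.1.le, hz.2.le⟩)
  rw [Complex.closure_preimage_im, closure_Ioo hb12.ne] at hEq
  have him : ((1 : ℂ) + b1 * Complex.I).im = b1 := by simp
  have hre : ((1 : ℂ) + b1 * Complex.I).re = 1 := by simp
  have hmem : ((1 : ℂ) + b1 * Complex.I).im ∈ Icc b1 b2 := by rw [him]; exact ⟨le_rfl, hb12.le⟩
  have h1 := congrArg norm (hEq (x := 1 + b1 * Complex.I) hmem)
  simp only [Function.const, hG1c, neg_zero, Complex.exp_zero, norm_one, Complex.norm_exp,
    Complex.neg_re, Real.exp_eq_one_iff] at h1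
  obtain ⟨D, hD, hDe⟩ := hline m (1 + b1 * Complex.I) (by rw [him, hb1W]) hmem
    (hne_line _ (Or.inl him))
  have hpos := h.ne_zero_of_line (z := 1 + b1 * Complex.I) (m := m) (by rw [him, hb1W])
    (by rw [hre]; norm_num)
  have : 0 < (G1 (1 + b1 * Complex.I)).re := by rw [hDe]; exact div_pos hpos hD
  linarith

lemma Slab.zero_unique {l W : ℝ} {d s : ℝ → ℝ} (h : Slab l W d s) {m : ℤ} {p c : ℂ}
    (hp : p.im ∈ Ioo (m * (2 * Real.pi) / W) ((m + 1 : ℤ) * (2 * Real.pi) / W))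
    (hA : slabA l W d s p = 0)
    (hc : c.im ∈ Ioo (m * (2 * Real.pi) / W) ((m + 1 : ℤ) * (2 * Real.pi) / W))
    (hAc : slabA l W d s c = 0) : c = p := by
  by_contra hne
  refine h.zero_rigid hp hA hc ?_
  have := sub_smul_dslope (fun z => z * slabA l W d s z) p c
  simp only [hA, hAc, mul_zero, sub_zero, smul_eq_mul] at this
  exact (mul_eq_zero.1 this).resolve_left (sub_ne_zero.2 hne)

lemma Slab.deriv_ne_zero {l W : ℝ} {d s : ℝ → ℝ} (h : Slab l W d s) {m : ℤ} {p : ℂ}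
    (hp : p.im ∈ Ioo (m * (2 * Real.pi) / W) ((m + 1 : ℤ) * (2 * Real.pi) / W))
    (hA : slabA l W d s p = 0) : deriv (slabA l W d s) p ≠ 0 := by
  intro h0
  refine h.zero_rigid hp hA hp ?_
  rw [dslope_same]
  have := (hasDerivAt_id p).mul ((differentiable_slabA h) p).hasDerivAt
  have e := this.deriv
  simp only [id] at e
  rw [show (fun z => z * slabA l W d s z) = (id * slabA l W d s) from rfl, e, h0, hA]
  simp

end Planar

end

section
open MeasureTheory Set Filter Topology

namespace Planar

/-- The maximum of `f x - q x` over `[0, l]`. -/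
noncomputable def tiltMax (l : ℝ) (f : ℝ → ℝ) (q : ℝ) : ℝ :=
  sSup ((fun x => f x - q * x) '' Icc 0 l)

/-- The depth of the point `(x, f x)` below the supporting line of slope `q`. -/
noncomputable def dep (l : ℝ) (f : ℝ → ℝ) (q x : ℝ) : ℝ := tiltMax l f q - (f x - q * x)

section
variable {l : ℝ} {f : ℝ → ℝ}

lemma tiltMax_exists (hl : 0 ≤ l) (hf : Continuous f) (q : ℝ) :
    ∃ x ∈ Icc 0 l, tiltMax l f q = f x - q * x := by
  obtain ⟨x, hx, he⟩ := isCompact_Icc.exists_sSup_image_eq (nonempty_Icc.2 hl)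
    (f := fun x => f x - q * x) (by fun_prop)
  exact ⟨x, hx, he⟩

lemma le_tiltMax (hf : Continuous f) (q : ℝ) {x : ℝ} (hx : x ∈ Icc 0 l) :
    f x - q * x ≤ tiltMax l f q :=
  le_csSup (isCompact_Icc.bddAbove_image (f := fun x => f x - q * x) (by fun_prop))
    (mem_image_of_mem _ hx)

lemma dep_nonneg (hf : Continuous f) (q : ℝ) {x : ℝ} (hx : x ∈ Icc 0 l) : 0 ≤ dep l f q x := by
  have := le_tiltMax hf q hx
  unfold dep; linarith

lemma dep_zero (hl : 0 ≤ l) (hf : Continuous f) (q : ℝ) : ∃ x ∈ Icc 0 l, dep l f q x = 0 := by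
  obtain ⟨x, hx, he⟩ := tiltMax_exists hl hf q
  exact ⟨x, hx, by rw [dep, he, sub_self]⟩

lemma continuous_dep (l : ℝ) (hf : Continuous f) (q : ℝ) : Continuous (dep l f q) := by
  unfold dep; fun_prop

lemma convexOn_dep (hf : ConcaveOn ℝ (Icc 0 l) f) (q : ℝ) : ConvexOn ℝ (Icc 0 l) (dep l f q) := by
  have h1 : ConvexOn ℝ (Icc 0 l) (fun x => q * x + tiltMax l f q) :=
    ⟨convex_Icc _ _, fun x _ y _ a b _ _ hab => le_of_eq (by
      simp only [smul_eq_mul]; linear_combination -(tiltMax l f q) * hab)⟩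
  have := h1.sub hf
  refine this.congr fun x _ => ?_
  simp only [dep, Pi.sub_apply]; ring

lemma tiltMax_lipschitz (hl : 0 ≤ l) (hf : Continuous f) (q r : ℝ) :
    tiltMax l f q - tiltMax l f r ≤ l * |q - r| := by
  obtain ⟨x, hx, he⟩ := tiltMax_exists hl hf q
  have := le_tiltMax hf r hx
  have h1 : (r - q) * x ≤ |q - r| * l := by
    rw [abs_sub_comm]
    exact mul_le_mul (le_abs_self _) hx.2 hx.1 (abs_nonneg _)
  nlinarith

lemma continuous_tiltMax (hl : 0 ≤ l) (hf : Continuous f) : Continuous (tiltMax l f) := by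
  have : LipschitzWith (Real.toNNReal l) (tiltMax l f) := LipschitzWith.of_dist_le_mul fun q r => by
    rw [Real.dist_eq, Real.dist_eq, Real.coe_toNNReal l hl, abs_le]
    have h1 := tiltMax_lipschitz hl hf q r
    have h2 := tiltMax_lipschitz hl hf r q
    rw [abs_sub_comm] at h2
    constructor <;> linarith
  exact this.continuous

end

/-- A planar convex body written as the region between a convex and a concave graph over `[0, l]`. -/
structure GraphBody (l : ℝ) (f b : ℝ → ℝ) : Prop where
  l_pos : 0 < l
  f_cont : Continuous f
  b_cont : Continuous b
  f_conc : ConcaveOn ℝ (Icc 0 l) f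
  b_conv : ConvexOn ℝ (Icc 0 l) b
  le : ∀ x ∈ Icc 0 l, b x ≤ f x
  lt : ∀ x ∈ Ioo 0 l, b x < f x

/-- The width of the region between the graphs in the direction `(-q, 1)`. -/
noncomputable def width (l : ℝ) (f b : ℝ → ℝ) (q : ℝ) : ℝ :=
  tiltMax l f q + tiltMax l (fun x => -b x) (-q)

section
variable {l : ℝ} {f b : ℝ → ℝ}

lemma width_eq_add (q x : ℝ) :
    width l f b q = dep l f q x + dep l (fun x => -b x) (-q) x + (f x - b x) := by
  simp only [width, dep]; ring

lemma GraphBody.slab (h : GraphBody l f b) (q : ℝ) :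
    Slab l (width l f b q) (dep l f q) (dep l (fun x => -b x) (-q)) := by
  have hl := h.l_pos
  have hnb : Continuous fun x => -b x := h.b_cont.neg
  have n1 : ∀ x ∈ Icc 0 l, 0 ≤ dep l f q x := fun x hx => dep_nonneg h.f_cont q hx
  have n2 : ∀ x ∈ Icc 0 l, 0 ≤ dep l (fun x => -b x) (-q) x := fun x hx => dep_nonneg hnb _ hx
  have hw := fun x => width_eq_add (l := l) (f := f) (b := b) q x
  have hmid : l / 2 ∈ Ioo 0 l := ⟨by linarith, by linarith⟩
  refine ⟨hl, ?_, ⟨continuous_dep l h.f_cont q, convexOn_dep h.f_conc q, n1, fun x hx => ?_,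
    dep_zero hl.le h.f_cont q⟩, ⟨continuous_dep l hnb _, convexOn_dep h.b_conv.neg _, n2,
    fun x hx => ?_, dep_zero hl.le hnb _⟩, fun x hx => ?_, fun x hx => ?_⟩
  · rw [hw (l / 2)]
    have := h.lt _ hmid
    have := n1 _ (Ioo_subset_Icc_self hmid)
    have := n2 _ (Ioo_subset_Icc_self hmid)
    linarith
  · rw [hw x]; linarith [n2 x hx, h.le x hx]
  · rw [hw x]; linarith [n1 x hx, h.le x hx]
  · rw [hw x]; linarith [h.le x hx]
  · rw [hw x]; linarith [h.lt x hx]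

lemma GraphBody.continuous_width (h : GraphBody l f b) : Continuous (width l f b) :=
  (continuous_tiltMax h.l_pos.le h.f_cont).add
    ((continuous_tiltMax h.l_pos.le (f := fun x => -b x) h.b_cont.neg).comp continuous_neg)

lemma GraphBody.width_pos (h : GraphBody l f b) (q : ℝ) : 0 < width l f b q := (h.slab q).W_pos

/-- The exponential transform of the region between the graphs. -/
noncomputable def bodyTr (l : ℝ) (f b : ℝ → ℝ) (z : ℂ × ℂ) : ℂ :=
  expInt l (fun _ => 1) f z - expInt l (fun _ => 1) b z

/-- The one-variable function `slabA` attached to a body and a slope. -/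
noncomputable def tiltA (l : ℝ) (f b : ℝ → ℝ) (q : ℝ) (z : ℂ) : ℂ :=
  slabA l (width l f b q) (dep l f q) (dep l (fun x => -b x) (-q)) z

lemma contDiff_bodyTr (l : ℝ) (hf : Continuous f) (hb : Continuous b) :
    ContDiff ℂ 1 (bodyTr l f b) :=
  (contDiff_expInt l continuous_const hf).sub (contDiff_expInt l continuous_const hb)

lemma bodyTr_tilt (q : ℝ) (z : ℂ) :
    bodyTr l f b (-q * z, z) =
      Complex.exp (-z * tiltMax l (fun x => -b x) (-q)) * tiltA l f b q z := by
  simp only [bodyTr, expInt, tiltA, slabA, depthInt, mul_sub, ← mul_assoc]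
  rw [← Complex.exp_add, ← intervalIntegral.integral_const_mul,
    ← intervalIntegral.integral_const_mul]
  congr 1
  · refine intervalIntegral.integral_congr fun x _ => ?_
    simp only [← Complex.exp_add, Complex.ofReal_one, one_mul, width, dep]
    congr 1; push_cast; ring
  · refine intervalIntegral.integral_congr fun x _ => ?_
    simp only [← Complex.exp_add, Complex.ofReal_one, one_mul, dep]
    congr 1; push_cast; ring

lemma tiltA_conj (q : ℝ) (z : ℂ) :
    tiltA l f b q (starRingEnd ℂ z) = starRingEnd ℂ (tiltA l f b q z) := slabA_conj _ _ _ _ _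

end

/-- Two bodies over the same interval with the same widths and the same autocorrelation. -/
structure Homometric (l : ℝ) (f b g c : ℝ → ℝ) : Prop where
  left : GraphBody l f b
  right : GraphBody l g c
  width_eq : ∀ q, width l f b q = width l g c q
  tr_eq : ∀ z : ℂ × ℂ, bodyTr l f b z * bodyTr l f b (-z) = bodyTr l g c z * bodyTr l g c (-z)

section
variable {l : ℝ} {f b g c : ℝ → ℝ}

lemma tiltA_mul_neg (q : ℝ) (z : ℂ) :
    tiltA l f b q z * tiltA l f b q (-z) =
      bodyTr l f b (-q * z, z) * bodyTr l f b (-(-q * z, z)) := by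
  have e1 := bodyTr_tilt (l := l) (f := f) (b := b) q z
  have e2 := bodyTr_tilt (l := l) (f := f) (b := b) q (-z)
  have e3 : (-(-q * z, z) : ℂ × ℂ) = (-q * -z, -z) := by simp
  rw [e3, e1, e2]
  have : Complex.exp (-z * tiltMax l (fun x => -b x) (-q)) *
      Complex.exp (- -z * tiltMax l (fun x => -b x) (-q)) = 1 := by
    rw [← Complex.exp_add]; simp
  linear_combination -(tiltA l f b q z * tiltA l f b q (-z)) * this

lemma Homometric.tiltA_eq (h : Homometric l f b g c) (q : ℝ) (z : ℂ) :
    tiltA l f b q z * tiltA l f b q (-z) = tiltA l g c q z * tiltA l g c q (-z) := by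
  rw [tiltA_mul_neg, tiltA_mul_neg, h.tr_eq]

lemma Homometric.norm_tiltA_eq (h : Homometric l f b g c) (q t : ℝ) :
    ‖tiltA l f b q (t * Complex.I)‖ = ‖tiltA l g c q (t * Complex.I)‖ := by
  have key : ∀ f b : ℝ → ℝ, tiltA l f b q (t * Complex.I) * tiltA l f b q (-(t * Complex.I)) =
      ((‖tiltA l f b q (t * Complex.I)‖ ^ 2 : ℝ) : ℂ) := fun f b => by
    rw [show -((t : ℂ) * Complex.I) = starRingEnd ℂ (t * Complex.I) by simp, tiltA_conj,
      Complex.mul_conj, Complex.normSq_eq_norm_sq]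
  have := h.tiltA_eq q (t * Complex.I)
  rw [key, key] at this
  have h2 : ‖tiltA l f b q (t * Complex.I)‖ ^ 2 = ‖tiltA l g c q (t * Complex.I)‖ ^ 2 := by
    exact_mod_cast this
  exact (sq_eq_sq₀ (norm_nonneg _) (norm_nonneg _)).1 h2

/-- Reflection in a point of the region between two graphs. -/
lemma GraphBody.reflect (h : GraphBody l f b) :
    GraphBody l (fun x => -b (l - x)) (fun x => -f (l - x)) := by
  have hl := h.l_pos
  have hmem : ∀ x ∈ Icc 0 l, l - x ∈ Icc 0 l := fun x hx => ⟨by linarith [hx.2], by linarith [hx.1]⟩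
  have hfc := h.f_cont
  have hbc := h.b_cont
  refine ⟨hl, by fun_prop, by fun_prop, ⟨convex_Icc _ _, ?_⟩, ⟨convex_Icc _ _, ?_⟩, ?_, ?_⟩
  · intro x hx y hy s t hs ht hst
    have := h.b_conv.2 (hmem x hx) (hmem y hy) hs ht hst
    simp only [smul_eq_mul] at this ⊢
    have e : s * (l - x) + t * (l - y) = l - (s * x + t * y) := by linear_combination l * hst
    rw [e] at this; linarith
  · intro x hx y hy s t hs ht hst
    have := h.f_conc.2 (hmem x hx) (hmem y hy) hs ht hst
    simp only [smul_eq_mul] at this ⊢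
    have e : s * (l - x) + t * (l - y) = l - (s * x + t * y) := by linear_combination l * hst
    rw [e] at this; linarith
  · intro x hx
    have := h.le _ (hmem x hx)
    linarith
  · intro x hx
    have := h.lt (l - x) ⟨by linarith [hx.2], by linarith [hx.1]⟩
    linarith

lemma tiltMax_reflect (hl : 0 ≤ l) {φ : ℝ → ℝ} (hφ : Continuous φ) (q : ℝ) :
    tiltMax l (fun x => φ (l - x)) q = tiltMax l φ (-q) - q * l := by
  have hmem : ∀ x ∈ Icc 0 l, l - x ∈ Icc 0 l := fun x hx => ⟨by linarith [hx.2], by linarith [hx.1]⟩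
  apply le_antisymm
  · obtain ⟨x, hx, he⟩ := tiltMax_exists hl (f := fun x => φ (l - x)) (by fun_prop) q
    have := le_tiltMax hφ (-q) (hmem x hx)
    rw [he]; linarith
  · obtain ⟨x, hx, he⟩ := tiltMax_exists hl hφ (-q)
    have := le_tiltMax (l := l) (f := fun x => φ (l - x)) (by fun_prop) q (hmem x hx)
    rw [sub_sub_cancel] at this
    rw [he]; linarith

lemma GraphBody.width_reflect (h : GraphBody l f b) (q : ℝ) :
    width l (fun x => -b (l - x)) (fun x => -f (l - x)) q = width l f b q := by
  have e1 := tiltMax_reflect h.l_pos.le (φ := fun x => -b x) h.b_cont.neg q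
  have e2 := tiltMax_reflect h.l_pos.le h.f_cont (-q)
  simp only [width, neg_neg] at e1 e2 ⊢
  rw [e1, e2]; ring

lemma bodyTr_reflect (z : ℂ × ℂ) :
    bodyTr l (fun x => -b (l - x)) (fun x => -f (l - x)) z =
      -Complex.exp (z.1 * l) * bodyTr l f b (-z) := by
  have key : ∀ φ : ℝ → ℝ, expInt l (fun _ => 1) (fun x => -φ (l - x)) z =
      Complex.exp (z.1 * l) * expInt l (fun _ => 1) φ (-z) := by
    intro φ
    simp only [expInt]
    rw [← intervalIntegral.integral_const_mul]
    have := intervalIntegral.integral_comp_sub_left (a := 0) (b := l) (fun x : ℝ =>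
      Complex.exp (z.1 * l) * (((1 : ℝ) : ℂ) * Complex.exp ((-z).1 * x + (-z).2 * φ x))) l
    rw [sub_self, sub_zero] at this
    rw [← this]
    refine intervalIntegral.integral_congr fun x _ => ?_
    simp only [Complex.ofReal_one, one_mul, ← Complex.exp_add]
    congr 1; push_cast; simp; ring
  simp only [bodyTr, key]; ring

lemma Homometric.reflect (h : Homometric l f b g c) :
    Homometric l f b (fun x => -c (l - x)) (fun x => -g (l - x)) := by
  refine ⟨h.left, h.right.reflect, fun q => ?_, fun z => ?_⟩
  · rw [h.right.width_reflect, h.width_eq]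
  · rw [bodyTr_reflect, bodyTr_reflect, h.tr_eq, neg_neg]
    have : Complex.exp (z.1 * l) * Complex.exp ((-z).1 * l) = 1 := by
      rw [← Complex.exp_add]; simp
    linear_combination -(bodyTr l g c z * bodyTr l g c (-z)) * this

lemma tiltA_eq_zero_iff (q : ℝ) (z : ℂ) : tiltA l f b q z = 0 ↔ bodyTr l f b (-q * z, z) = 0 := by
  rw [bodyTr_tilt, mul_eq_zero, or_iff_right (Complex.exp_ne_zero _)]

lemma tiltA_reflect_eq_zero_iff (q : ℝ) (z : ℂ) :
    tiltA l (fun x => -b (l - x)) (fun x => -f (l - x)) q z = 0 ↔ tiltA l f b q (-z) = 0 := by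
  rw [tiltA_eq_zero_iff, tiltA_eq_zero_iff, bodyTr_reflect, mul_eq_zero,
    or_iff_right (neg_ne_zero.2 (Complex.exp_ne_zero _))]
  simp

end

/-- Quantitative bound on the real part of a zero of `slabA`. -/
lemma Slab.zero_re_pow_le {l W : ℝ} {d s : ℝ → ℝ} (h : Slab l W d s) {z : ℂ}
    (hz : slabA l W d s z = 0) :
    |z.re| ^ 4 ≤ 1 + 48 * l / (gapConst l (fun x => W - d x - s x) * W ^ 3) * |z.im| := by
  have main : ∀ {d s : ℝ → ℝ}, Slab l W d s → ∀ {z : ℂ}, 0 ≤ z.re → slabA l W d s z = 0 →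
      z.re ^ 4 ≤ 1 + 48 * l / (gapConst l (fun x => W - d x - s x) * W ^ 3) * |z.im| := by
    intro d s h z h0 hz
    have c1 := h.top.cont
    have c2 := h.bot.cont
    have hW := h.W_pos
    have hl := h.l_pos
    have hc : 0 < gapConst l (fun x => W - d x - s x) :=
      gapConst_pos h.l_pos (by fun_prop) (fun x hx => by linarith [h.gap_pos x hx])
    set c0 := gapConst l (fun x => W - d x - s x)
    have hnn : 0 ≤ 48 * l / (c0 * W ^ 3) * |z.im| := by positivity
    rcases le_total z.re 1 with h1 | h1
    · have : z.re ^ 4 ≤ 1 := pow_le_one₀ h0 h1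
      linarith
    · have h2 := h.norm_ge h1
      rw [hz, mul_zero, norm_zero] at h2
      have h3 : (z.re * W / 2) ^ 3 / 6 ≤ Real.exp (z.re * W / 2) := by
        have := Real.pow_div_factorial_le_exp (z.re * W / 2) (by positivity) 3
        norm_num [Nat.factorial] at this ⊢
        exact this
      have h4 : z.re * (c0 * ((z.re * W / 2) ^ 3 / 6)) ≤ z.re * (c0 * Real.exp (z.re * W / 2)) := by
        gcongr
      have h5 : z.re ^ 4 ≤ 48 * l / (c0 * W ^ 3) * |z.im| := by
        rw [div_mul_eq_mul_div, le_div_iff₀ (by positivity)]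
        nlinarith
      linarith
  rcases le_total 0 z.re with h0 | h0
  · rw [abs_of_nonneg h0]; exact main h h0 hz
  · rw [abs_of_nonpos h0]
    have := main h.swap (z := -z) (by simpa using h0) (by
      have := slabA_neg l W d s z
      have e := slabA_neg l W s d (-z)
      rw [slabA_neg, hz, mul_zero])
    simp only [Complex.neg_re, Complex.neg_im, abs_neg] at this
    rwa [show (fun x => W - s x - d x) = fun x => W - d x - s x by funext x; ring] at this

end Planar

end

section
open MeasureTheory Set Filter Topology

namespace Planar

section
variable {l : ℝ} {f b g c : ℝ → ℝ}

lemma GraphBody.zero_holomorphic (h : GraphBody l f b) {m : ℤ} {p : ℝ → ℂ}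
    (hp : ∀ q, (p q).im ∈ Ioo (m * (2 * Real.pi) / width l f b q)
      ((m + 1 : ℤ) * (2 * Real.pi) / width l f b q))
    (hA : ∀ q, tiltA l f b q (p q) = 0) (q₀ : ℝ) :
    ∃ ψ : ℂ → ℂ, AnalyticAt ℂ ψ q₀ ∧ ∀ᶠ q : ℝ in 𝓝 q₀, p q = ψ q := by
  set T : ℂ × ℂ → ℂ × ℂ := fun u => (-u.1 * u.2, u.2) with hT
  set Φ : ℂ × ℂ → ℂ := fun u => bodyTr l f b (T u) with hΦ
  have hTd : ContDiff ℂ 1 T := by simp only [hT]; fun_prop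
  have hΦd : ContDiff ℂ 1 Φ := (contDiff_bodyTr l h.f_cont h.b_cont).comp hTd
  set u : ℂ × ℂ := ((q₀ : ℂ), p q₀) with hu
  have hΦreal : ∀ (q : ℝ) (z : ℂ), Φ (q, z) =
      Complex.exp (-z * tiltMax l (fun x => -b x) (-q)) * tiltA l f b q z := fun q z => by
    simp only [hΦ, hT]; exact bodyTr_tilt q z
  have hΦu : Φ u = 0 := by rw [hu, hΦreal, hA, mul_zero]
  set L := fderiv ℂ Φ u ∘L ContinuousLinearMap.inr ℂ ℂ ℂ with hL
  have hderiv : HasDerivAt (fun z => Φ ((q₀ : ℂ), z)) (L 1) (p q₀) := by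
    have h1 : HasFDerivAt Φ (fderiv ℂ Φ u) u := (hΦd.differentiable one_ne_zero u).hasFDerivAt
    have h2 : HasDerivAt (fun z : ℂ => ((q₀ : ℂ), z)) ((0 : ℂ), (1 : ℂ)) (p q₀) :=
      (hasDerivAt_const _ _).prodMk (hasDerivAt_id _)
    exact h1.comp_hasDerivAt (p q₀) h2
  have hAd : Differentiable ℂ (tiltA l f b q₀) := differentiable_slabA (h.slab q₀)
  have hderiv2 : HasDerivAt (fun z => Φ ((q₀ : ℂ), z))
      (Complex.exp (-(p q₀) * tiltMax l (fun x => -b x) (-q₀)) * deriv (tiltA l f b q₀) (p q₀))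
      (p q₀) := by
    have h1 : Differentiable ℂ fun z : ℂ => Complex.exp (-z * tiltMax l (fun x => -b x) (-q₀)) := by
      fun_prop
    have h2 := (h1 (p q₀)).hasDerivAt.mul (hAd (p q₀)).hasDerivAt
    rw [hA, mul_zero, zero_add] at h2
    exact h2.congr_of_eventuallyEq (Eventually.of_forall fun z => hΦreal q₀ z)
  have hL1 : L 1 ≠ 0 := by
    rw [hderiv.unique hderiv2]
    exact mul_ne_zero (Complex.exp_ne_zero _) ((h.slab q₀).deriv_ne_zero (hp q₀) (hA q₀))
  have hinv : L.IsInvertible := by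
    refine ⟨ContinuousLinearEquiv.unitsEquivAut ℂ (Units.mk0 (L 1) hL1), ?_⟩
    ext
    simp
  have hcd : ContDiffAt ℂ 1 Φ u := hΦd.contDiffAt
  set ψ := hcd.implicitFunction one_ne_zero hinv with hψ
  have hψd : ContDiffAt ℂ 1 ψ q₀ := hcd.contDiffAt_implicitFunction one_ne_zero hinv
  have hψ0 : ψ q₀ = p q₀ := hcd.implicitFunction_apply_self one_ne_zero hinv
  have hev : ∀ᶠ x in 𝓝 (q₀ : ℂ), Φ (x, ψ x) = Φ u :=
    hcd.eventually_apply_implicitFunction one_ne_zero hinv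
  have hψa : AnalyticAt ℂ ψ q₀ := Complex.analyticAt_iff_eventually_differentiableAt.2
    ((hψd.eventually (by simp)).mono fun x hx => hx.differentiableAt one_ne_zero)
  refine ⟨ψ, hψa, ?_⟩
  have hof : Tendsto (fun q : ℝ => (q : ℂ)) (𝓝 q₀) (𝓝 (q₀ : ℂ)) :=
    Complex.continuous_ofReal.tendsto q₀
  have him : ContinuousAt (fun q : ℝ => (ψ q).im) q₀ :=
    Complex.continuous_im.continuousAt.comp (hψa.continuousAt.comp hof)
  have hW := h.continuous_width.continuousAt (x := q₀)
  have hW0 := (h.width_pos q₀).ne'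
  have e1 : ∀ᶠ q : ℝ in 𝓝 q₀, m * (2 * Real.pi) / width l f b q < (ψ q).im :=
    ContinuousAt.eventually_lt (continuousAt_const.div hW hW0) him (by rw [hψ0]; exact (hp q₀).1)
  have e2 : ∀ᶠ q : ℝ in 𝓝 q₀, (ψ q).im < (m + 1 : ℤ) * (2 * Real.pi) / width l f b q :=
    ContinuousAt.eventually_lt him (continuousAt_const.div hW hW0) (by rw [hψ0]; exact (hp q₀).2)
  filter_upwards [e1, e2, hof.eventually hev] with q h1 h2 h3
  rw [hΦu, hΦreal, mul_eq_zero, or_iff_right (Complex.exp_ne_zero _)] at h3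
  exact ((h.slab q).zero_unique ⟨h1, h2⟩ h3 (hp q) (hA q))

lemma analyticAt_real_of_complex {F : ℂ → ℂ} {u : ℝ → ℂ} {q₀ : ℝ} (hF : AnalyticAt ℂ F q₀)
    (hu : ∀ᶠ q : ℝ in 𝓝 q₀, u q = F q) : AnalyticAt ℝ u q₀ := by
  have h1 : AnalyticAt ℝ F (Complex.ofRealCLM q₀) := hF.restrictScalars
  have h2 : AnalyticAt ℝ (F ∘ Complex.ofRealCLM) q₀ := h1.comp (Complex.ofRealCLM.analyticAt q₀)
  exact h2.congr (hu.mono fun q hq => by simp [hq])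

/-- Infinitely many period strips in which the two bodies share, for each slope, a zero. -/
def CommonZeros (l : ℝ) (f b g c : ℝ → ℝ) : Prop :=
  ∃ᶠ m : ℕ in atTop, ∀ q, ∃ p : ℂ,
    p.im ∈ Ioo (m * (2 * Real.pi) / width l f b q) ((m + 1) * (2 * Real.pi) / width l f b q) ∧
      tiltA l f b q p = 0 ∧ tiltA l g c q p = 0

lemma Homometric.commonZeros_or (h : Homometric l f b g c)
    (hnc : ∀ (q : ℝ) (m : ℤ), 1 ≤ m →
      tiltA l f b q ((m * (2 * Real.pi) / width l f b q : ℝ) * Complex.I) ≠ 0) :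
    CommonZeros l f b g c ∨ CommonZeros l f b (fun x => -c (l - x)) (fun x => -g (l - x)) := by
  have key : ∀ m : ℕ, 1 ≤ m → (∀ q, ∃ p : ℂ,
      p.im ∈ Ioo (m * (2 * Real.pi) / width l f b q) ((m + 1) * (2 * Real.pi) / width l f b q) ∧
        tiltA l f b q p = 0 ∧ tiltA l g c q p = 0) ∨ (∀ q, ∃ p : ℂ,
      p.im ∈ Ioo (m * (2 * Real.pi) / width l f b q) ((m + 1) * (2 * Real.pi) / width l f b q) ∧
        tiltA l f b q p = 0 ∧
        tiltA l (fun x => -c (l - x)) (fun x => -g (l - x)) q p = 0) := by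
    intro m hm
    have hm' : (1 : ℤ) ≤ (m : ℤ) := by exact_mod_cast hm
    choose p hp hA using fun q => (h.left.slab q).exists_zero hm' (hnc q m hm')
      (hnc q (m + 1) (by omega))
    have hholo := h.left.zero_holomorphic hp hA
    have han : ∀ ε : ℂ, AnalyticOnNhd ℝ
        (fun q : ℝ => bodyTr l g c (-q * (ε * p q), ε * p q)) univ := by
      intro ε q₀ _
      obtain ⟨ψ, hψ, hev⟩ := hholo q₀
      refine analyticAt_real_of_complex (F := fun q => bodyTr l g c (-q * (ε * ψ q), ε * ψ q)) ?_
        (hev.mono fun q hq => by rw [hq])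
      rw [Complex.analyticAt_iff_eventually_differentiableAt] at hψ ⊢
      filter_upwards [hψ] with z hz
      have h1 : DifferentiableAt ℂ (fun q => (-q * (ε * ψ q), ε * ψ q)) z := by fun_prop
      exact ((contDiff_bodyTr l h.right.f_cont h.right.b_cont).differentiable one_ne_zero _).comp z h1
    have hprod : ∀ q ∈ (univ : Set ℝ), bodyTr l g c (-q * (1 * p q), 1 * p q) *
        bodyTr l g c (-q * (-1 * p q), -1 * p q) = 0 := by
      intro q _
      have h1 := h.tiltA_eq q (p q)
      have h2 : tiltA l f b q (p q) = 0 := hA q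
      rw [h2, zero_mul, eq_comm, mul_eq_zero, tiltA_eq_zero_iff, tiltA_eq_zero_iff] at h1
      rw [one_mul, neg_one_mul, mul_eq_zero]
      exact h1
    have him : ∀ q, (p q).im ∈ Ioo (m * (2 * Real.pi) / width l f b q)
        ((m + 1) * (2 * Real.pi) / width l f b q) := fun q => by
      have := hp q; push_cast at this; exact this
    rcases (han 1).eq_zero_or_eq_zero_of_mul_eq_zero (han (-1)) hprod isPreconnected_univ with h0 | h0
    · left
      intro q
      refine ⟨p q, him q, hA q, ?_⟩
      rw [tiltA_eq_zero_iff]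
      simpa using h0 q (mem_univ _)
    · right
      intro q
      refine ⟨p q, him q, hA q, ?_⟩
      rw [tiltA_reflect_eq_zero_iff, tiltA_eq_zero_iff]
      simpa using h0 q (mem_univ _)
  have hfr := ((eventually_ge_atTop 1).mono key).frequently
  exact frequently_or_distrib.1 hfr

end

end Planar

end

section
open MeasureTheory Set Filter Topology

namespace Planar

lemma hasDerivAt_cexp_mul_ofReal (z : ℂ) (c : ℝ) :
    HasDerivAt (fun c : ℝ => Complex.exp (z * c)) (z * Complex.exp (z * c)) c := by
  have h1 : HasDerivAt (fun c : ℝ => z * (c : ℂ)) (z * 1) c :=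
    (Complex.ofRealCLM.hasDerivAt (x := c)).const_mul z
  refine h1.cexp.congr_deriv ?_
  ring

lemma Depth.norm_mul_depthInt_sub_le {l B : ℝ} {D Ψ Ψ' : ℝ → ℝ} (hD : Depth l B D) (hB : 0 < B)
    (z w : ℂ) (hΨ : ∀ c, HasDerivAt Ψ (Ψ' c) c) (hΨ' : Continuous Ψ') (hΨ0 : Ψ 0 = 0)
    (hle : ∀ c ∈ Icc 0 B, ‖Complex.exp (-w * c) - Complex.exp (-z * c)‖ ≤ Ψ c) :
    ‖z * depthInt l D (-z) - w * depthInt l D (-w)‖ ≤ ∫ x in (0 : ℝ)..l, Ψ' (D x) := by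
  have hc := hD.cont
  have h := hD.norm_integral_comp_le hB
    (X := fun c => Complex.exp (-w * c) - Complex.exp (-z * c))
    (X' := fun c => z * Complex.exp (-z * c) - w * Complex.exp (-w * c))
    (fun c => ((hasDerivAt_cexp_mul_ofReal (-w) c).sub
      (hasDerivAt_cexp_mul_ofReal (-z) c)).congr_deriv (by ring)) (by fun_prop) (by simp)
    hΨ hΨ' hΨ0 hle
  have c1 : Continuous fun x => z * Complex.exp (-z * D x) := by fun_prop
  have c2 : Continuous fun x => w * Complex.exp (-w * D x) := by fun_prop
  rwa [intervalIntegral.integral_sub (c1.intervalIntegrable _ _) (c2.intervalIntegrable _ _),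
    intervalIntegral.integral_const_mul, intervalIntegral.integral_const_mul] at h

lemma norm_exp_I_sub_le (a b ρ c : ℝ) (hρ : |a - b| ≤ ρ) (hc : 0 ≤ c) :
    ‖Complex.exp (-(b * Complex.I) * c) - Complex.exp (-(a * Complex.I) * c)‖
      ≤ 3 * (1 - Real.exp (-ρ * c)) := by
  have hr0 : 0 ≤ ρ := (abs_nonneg _).trans hρ
  set t := ρ * c with ht
  have ht0 : 0 ≤ t := mul_nonneg hr0 hc
  have n1 : ∀ y : ℝ, ‖Complex.exp (-(y * Complex.I) * c)‖ = 1 := fun y => by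
    rw [Complex.norm_exp]; simp
  have h2 : ‖Complex.exp (-(b * Complex.I) * c) - Complex.exp (-(a * Complex.I) * c)‖ ≤ 2 :=
    (norm_sub_le _ _).trans (by rw [n1, n1]; norm_num)
  have h1 : ‖Complex.exp (-(b * Complex.I) * c) - Complex.exp (-(a * Complex.I) * c)‖ ≤ t := by
    have e : Complex.exp (-(b * Complex.I) * c) - Complex.exp (-(a * Complex.I) * c) =
        Complex.exp (-(a * Complex.I) * c) *
          (Complex.exp (Complex.I * ((a - b) * c : ℝ)) - 1) := by
      rw [mul_sub, mul_one, ← Complex.exp_add]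
      congr 2
      push_cast; ring
    rw [e, norm_mul, n1, one_mul]
    refine (Real.norm_exp_I_mul_ofReal_sub_one_le).trans ?_
    rw [Real.norm_eq_abs, abs_mul, abs_of_nonneg hc]
    exact mul_le_mul_of_nonneg_right hρ hc
  have h3 : Real.exp (-ρ * c) ≤ 1 / (1 + t) := by
    rw [neg_mul, ← ht, Real.exp_neg, one_div]
    exact inv_anti₀ (by linarith) (by linarith [Real.add_one_le_exp t])
  have h4 : 3 * (t / (1 + t)) ≤ 3 * (1 - Real.exp (-ρ * c)) := by
    have : t / (1 + t) = 1 - 1 / (1 + t) := by field_simp; ring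
    rw [this]; linarith
  refine le_trans ?_ h4
  rcases le_total t 2 with h | h
  · refine h1.trans ?_
    rw [mul_div_assoc', le_div_iff₀ (by linarith)]; nlinarith
  · refine h2.trans ?_
    rw [mul_div_assoc', le_div_iff₀ (by linarith)]; nlinarith

/-- The total mass of `exp (-κ D)` over `[0, l]`. -/
noncomputable def depthMass (l : ℝ) (D : ℝ → ℝ) (κ : ℝ) : ℝ :=
  ∫ x in (0 : ℝ)..l, Real.exp (-κ * D x)

lemma Depth.wave_sub_le {l B : ℝ} {D : ℝ → ℝ} (hD : Depth l B D) (hB : 0 < B) (a b : ℝ) {ρ : ℝ}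
    (hρ : |a - b| ≤ ρ) :
    ‖(a * Complex.I) * depthInt l D (-(a * Complex.I)) -
      (b * Complex.I) * depthInt l D (-(b * Complex.I))‖ ≤ 3 * ρ * depthMass l D ρ := by
  have h := hD.norm_mul_depthInt_sub_le hB (a * Complex.I) (b * Complex.I)
    (Ψ := fun c => 3 * (1 - Real.exp (-ρ * c))) (Ψ' := fun c => 3 * ρ * Real.exp (-ρ * c))
    (fun c => by
      have := (((hasDerivAt_id c).const_mul (-ρ)).exp.const_sub 1).const_mul 3
      refine this.congr_deriv ?_
      simp only [id_eq, mul_one]; ring) (by fun_prop) (by simp)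
    (fun c hc => norm_exp_I_sub_le a b ρ c hρ hc.1)
  rwa [intervalIntegral.integral_const_mul] at h

lemma norm_one_sub_exp_le (w : ℂ) : ‖1 - Complex.exp w‖ ≤ ‖w‖ * max 1 (Real.exp w.re) := by
  have h := (convex_segment (0 : ℂ) w).norm_image_sub_le_of_norm_hasDerivWithin_le
    (f := Complex.exp) (f' := Complex.exp) (C := max 1 (Real.exp w.re)) (x := 0) (y := w)
    (fun x _ => (Complex.hasDerivAt_exp x).hasDerivWithinAt) (fun x hx => by
      obtain ⟨a, b, ha, hb, hab, rfl⟩ := hx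
      rw [Complex.norm_exp]
      simp only [smul_zero, zero_add, Complex.real_smul, Complex.mul_re, Complex.ofReal_re,
        Complex.ofReal_im, zero_mul, sub_zero]
      rcases le_total 0 w.re with h | h
      · exact le_max_of_le_right (Real.exp_le_exp.2 (by nlinarith))
      · exact le_max_of_le_left (Real.exp_le_one_iff.2 (by nlinarith)))
    (left_mem_segment _ _ _) (right_mem_segment _ _ _)
  rw [Complex.exp_zero, sub_zero, norm_sub_rev] at h
  linarith

lemma Slab.asymptotic {l W : ℝ} {d s : ℝ → ℝ} (h : Slab l W d s) (τ : ℝ) (μ : ℂ)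
    (hτ : Complex.exp (τ * Complex.I * W) = 1) :
    ‖(τ * Complex.I + μ) * slabA l W d s (τ * Complex.I + μ) -
      (-(τ * Complex.I) * depthInt l s (τ * Complex.I) +
        Complex.exp (μ * W) * (τ * Complex.I * depthInt l d (-(τ * Complex.I))))‖ ≤
    2 * ‖μ‖ * max 1 ‖Complex.exp (μ * W)‖ * l := by
  set r := ‖Complex.exp (μ * W)‖ with hr
  have hre : r = Real.exp (μ.re * W) := by rw [hr, Complex.norm_exp]; simp
  have hr0 : 0 < r := by rw [hre]; exact Real.exp_pos _
  set z : ℂ := τ * Complex.I with hz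
  have hzc : ∀ c : ℝ, ‖Complex.exp (z * c)‖ = 1 ∧ ‖Complex.exp (-z * c)‖ = 1 := fun c => by
    constructor <;> · rw [Complex.norm_exp, hz]; simp
  have h1 := h.top.norm_mul_depthInt_sub_le h.W_pos (z + μ) z
    (Ψ := fun c => ‖μ‖ * max 1 r / r * c) (Ψ' := fun _ => ‖μ‖ * max 1 r / r)
    (fun c => ((hasDerivAt_id c).const_mul _).congr_deriv (by simp)) continuous_const (by simp)
    (fun c hc => by
      have e : Complex.exp (-z * c) - Complex.exp (-(z + μ) * c) =
          Complex.exp (-z * c) * (1 - Complex.exp (-μ * c)) := by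
        rw [mul_sub, mul_one, ← Complex.exp_add]; congr 2; ring
      rw [e, norm_mul, (hzc c).2, one_mul]
      refine (norm_one_sub_exp_le _).trans ?_
      have e1 : ‖-μ * (c : ℂ)‖ = ‖μ‖ * c := by
        rw [norm_mul, norm_neg, Complex.norm_real, Real.norm_eq_abs, abs_of_nonneg hc.1]
      have e2 : (-μ * (c : ℂ)).re = -(μ.re * c) := by simp
      have e3 : max 1 (Real.exp (-(μ.re * c))) ≤ max 1 r / r := by
        rw [le_div_iff₀ hr0, max_mul_of_nonneg _ _ hr0.le, one_mul, hre, ← Real.exp_add]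
        refine max_le (le_max_right _ _) ?_
        rcases le_total 0 μ.re with h0 | h0
        · exact le_max_of_le_right (Real.exp_le_exp.2 (by nlinarith [hc.1]))
        · exact le_max_of_le_left (Real.exp_le_one_iff.2 (by nlinarith [hc.2]))
      rw [e1, e2]
      calc ‖μ‖ * c * max 1 (Real.exp (-(μ.re * c))) ≤ ‖μ‖ * c * (max 1 r / r) :=
            mul_le_mul_of_nonneg_left e3 (mul_nonneg (norm_nonneg _) hc.1)
        _ = _ := by ring)
  have h2 := h.bot.norm_mul_depthInt_sub_le h.W_pos (-(z + μ)) (-z)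
    (Ψ := fun c => ‖μ‖ * max 1 r * c) (Ψ' := fun _ => ‖μ‖ * max 1 r)
    (fun c => ((hasDerivAt_id c).const_mul _).congr_deriv (by simp)) continuous_const (by simp)
    (fun c hc => by
      have e : Complex.exp (- -z * c) - Complex.exp (- -(z + μ) * c) =
          Complex.exp (z * c) * (1 - Complex.exp (μ * c)) := by
        rw [mul_sub, mul_one, ← Complex.exp_add]; congr 2 <;> ring
      rw [e, norm_mul, (hzc c).1, one_mul]
      refine (norm_one_sub_exp_le _).trans ?_
      have e1 : ‖μ * (c : ℂ)‖ = ‖μ‖ * c := by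
        rw [norm_mul, Complex.norm_real, Real.norm_eq_abs, abs_of_nonneg hc.1]
      have e2 : (μ * (c : ℂ)).re = μ.re * c := by simp
      have e3 : max 1 (Real.exp (μ.re * c)) ≤ max 1 r := by
        refine max_le (le_max_left _ _) ?_
        rw [hre]
        rcases le_total 0 μ.re with h0 | h0
        · exact le_max_of_le_right (Real.exp_le_exp.2 (by nlinarith [hc.2]))
        · exact le_max_of_le_left (Real.exp_le_one_iff.2 (by nlinarith [hc.1]))
      rw [e1, e2]
      calc ‖μ‖ * c * max 1 (Real.exp (μ.re * c)) ≤ ‖μ‖ * c * max 1 r :=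
            mul_le_mul_of_nonneg_left e3 (mul_nonneg (norm_nonneg _) hc.1)
        _ = _ := by ring)
  rw [intervalIntegral.integral_const, smul_eq_mul, sub_zero] at h1 h2
  simp only [neg_neg] at h2
  have ez : Complex.exp ((z + μ) * W) = Complex.exp (μ * W) := by
    rw [add_mul, Complex.exp_add, hτ, one_mul]
  have e : (z + μ) * slabA l W d s (z + μ) - (-z * depthInt l s z +
      Complex.exp (μ * W) * (z * depthInt l d (-z))) =
      Complex.exp (μ * W) * ((z + μ) * depthInt l d (-(z + μ)) - z * depthInt l d (-z)) +
      (-(z + μ) * depthInt l s (z + μ) - -z * depthInt l s z) := by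
    rw [slabA, ez]; ring
  rw [e]
  refine (norm_add_le _ _).trans ?_
  rw [norm_mul, ← hr]
  have h3 := mul_le_mul_of_nonneg_left h1 hr0.le
  have e4 : r * (l * (‖μ‖ * max 1 r / r)) = ‖μ‖ * max 1 r * l := by field_simp
  rw [e4] at h3
  linarith

end Planar

end

section
open MeasureTheory Set Filter Topology

namespace Planar

/-- The amplitude `κ |∫₀ˡ exp (-iκ D)|` of the wave attached to `D`. -/
noncomputable def amp (l : ℝ) (D : ℝ → ℝ) (κ : ℝ) : ℝ :=
  ‖(κ * Complex.I) * depthInt l D (-(κ * Complex.I))‖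

lemma amp_nonneg (l : ℝ) (D : ℝ → ℝ) (κ : ℝ) : 0 ≤ amp l D κ := norm_nonneg _

lemma amp_eq_pos (l : ℝ) (D : ℝ → ℝ) (κ : ℝ) :
    ‖-(κ * Complex.I) * depthInt l D (κ * Complex.I)‖ = amp l D κ := by
  have e : (κ * Complex.I : ℂ) = starRingEnd ℂ (-(κ * Complex.I)) := by simp
  conv_lhs => rw [e, depthInt_conj]
  rw [amp, norm_mul, norm_mul, norm_neg, Complex.norm_conj, Complex.norm_conj, norm_neg]

section
variable {l W : ℝ} {d s d' s' : ℝ → ℝ}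

lemma Slab.amp_sq_sum_sub_le (h : Slab l W d s) (h' : Slab l W d' s') {τ : ℝ}
    (hτ : Complex.exp (τ * Complex.I * W) = 1)
    (hn : ∀ t : ℝ, ‖slabA l W d s (t * Complex.I)‖ = ‖slabA l W d' s' (t * Complex.I)‖) :
    |(amp l s τ ^ 2 + amp l d τ ^ 2) - (amp l s' τ ^ 2 + amp l d' τ ^ 2)| ≤
      2 * Real.pi * l / W * (amp l s τ + amp l d τ + amp l s' τ + amp l d' τ) := by
  have hW := h.W_pos
  have hl := h.l_pos
  have key : ∀ {d s : ℝ → ℝ}, Slab l W d s → ∃ u v : ℂ, ‖u‖ = amp l s τ ∧ ‖v‖ = amp l d τ ∧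
      ‖u + v‖ = ‖(τ * Complex.I : ℂ)‖ * ‖slabA l W d s (τ * Complex.I)‖ ∧
      |‖u - v‖ - ‖((τ + Real.pi / W : ℝ) * Complex.I : ℂ)‖ *
        ‖slabA l W d s ((τ + Real.pi / W : ℝ) * Complex.I)‖| ≤ 2 * Real.pi * l / W := by
    intro d s h
    refine ⟨-(τ * Complex.I) * depthInt l s (τ * Complex.I),
      τ * Complex.I * depthInt l d (-(τ * Complex.I)), amp_eq_pos l s τ, rfl, ?_, ?_⟩
    · have h0 := h.asymptotic τ 0 hτ
      simp only [norm_zero, mul_zero, zero_mul, add_zero, Complex.exp_zero, one_mul] at h0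
      rw [← norm_mul, sub_eq_zero.1 (norm_le_zero_iff.1 h0)]
    · have h0 := h.asymptotic τ ((Real.pi / W : ℝ) * Complex.I) hτ
      have e : Complex.exp (((Real.pi / W : ℝ) * Complex.I) * W) = -1 := by
        rw [← Complex.exp_pi_mul_I]; congr 1
        have : (W : ℂ) ≠ 0 := by exact_mod_cast hW.ne'
        push_cast; field_simp
      have e2 : (τ * Complex.I + (Real.pi / W : ℝ) * Complex.I : ℂ) =
          (τ + Real.pi / W : ℝ) * Complex.I := by push_cast; ring
      have e3 : ‖((Real.pi / W : ℝ) * Complex.I : ℂ)‖ = Real.pi / W := by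
        rw [norm_mul, Complex.norm_I, mul_one, Complex.norm_real, Real.norm_eq_abs,
          abs_of_pos (div_pos Real.pi_pos hW)]
      rw [e, e2, e3] at h0
      simp only [norm_neg, norm_one, max_self, mul_one, neg_one_mul, ← sub_eq_add_neg] at h0
      rw [← norm_mul, abs_sub_comm]
      refine (abs_norm_sub_norm_le _ _).trans (h0.trans (le_of_eq ?_))
      ring
  obtain ⟨u, v, hu, hv, huv, huv'⟩ := key h
  obtain ⟨x, y, hx, hy, hxy, hxy'⟩ := key h'
  rw [hn] at huv huv'
  rw [← hu, ← hv, ← hx, ← hy]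
  have p1 := parallelogram_law_with_norm ℝ u v
  have p2 := parallelogram_law_with_norm ℝ x y
  have n1 := norm_sub_le u v
  have n2 := norm_sub_le x y
  set e := 2 * Real.pi * l / W
  have he : 0 ≤ e := by have := Real.pi_pos; positivity
  have n3 : |‖u - v‖ - ‖x - y‖| ≤ 2 * e := by
    rw [abs_le] at *; constructor <;> linarith [huv'.1, huv'.2, hxy'.1, hxy'.2]
  have e1 : ‖u‖ ^ 2 + ‖v‖ ^ 2 - (‖x‖ ^ 2 + ‖y‖ ^ 2) =
      (‖u - v‖ - ‖x - y‖) * (‖u - v‖ + ‖x - y‖) / 2 := by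
    rw [huv] at p1; rw [hxy] at p2; linarith
  rw [e1, abs_div, abs_mul, abs_of_nonneg (by positivity : 0 ≤ ‖u - v‖ + ‖x - y‖), abs_two,
    div_le_iff₀ two_pos]
  calc _ ≤ 2 * e * (‖u‖ + ‖v‖ + ‖x‖ + ‖y‖) :=
        mul_le_mul n3 (by linarith) (by positivity) (by positivity)
    _ = _ := by ring

/-- If `a ≈ r a'` and `c ≈ r c'` and the sums of squares agree approximately, then so do the
individual squares. -/
lemma abs_sq_sub_le_of_ratio {a a' c c' r E e : ℝ} (ha : 0 ≤ a) (ha' : 0 ≤ a') (hc : 0 ≤ c)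
    (hc' : 0 ≤ c') (hr0 : 0 ≤ r) (hr : r ≤ 1) (he : e ≤ E) (h1 : |a - r * a'| ≤ E)
    (h2 : |c - r * c'| ≤ E)
    (hS : |(a ^ 2 + a' ^ 2) - (c ^ 2 + c' ^ 2)| ≤ e * (a + a' + c + c')) :
    |a' ^ 2 - c' ^ 2| ≤ 3 * E * (a + a' + c + c') ∧ |a ^ 2 - c ^ 2| ≤ 3 * E * (a + a' + c + c') := by
  have hE : 0 ≤ E := (abs_nonneg _).trans h1
  have hS' : |(a ^ 2 + a' ^ 2) - (c ^ 2 + c' ^ 2)| ≤ E * (a + a' + c + c') :=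
    hS.trans (mul_le_mul_of_nonneg_right he (by positivity))
  have sq : ∀ {a a' : ℝ}, 0 ≤ a → 0 ≤ a' → |a - r * a'| ≤ E →
      |a ^ 2 - r ^ 2 * a' ^ 2| ≤ E * (a + a') := by
    intro a a' ha ha' h1
    have e1 : a ^ 2 - r ^ 2 * a' ^ 2 = (a - r * a') * (a + r * a') := by ring
    have h0 : 0 ≤ r * a' := mul_nonneg hr0 ha'
    rw [e1, abs_mul, abs_of_nonneg (add_nonneg ha h0)]
    exact mul_le_mul h1 (by nlinarith) (add_nonneg ha h0) hE
  have k1 := abs_le.1 (sq ha ha' h1)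
  have k2 := abs_le.1 (sq hc hc' h2)
  have k3 := abs_le.1 hS'
  have k4 : |(1 + r ^ 2) * (a' ^ 2 - c' ^ 2)| ≤ 2 * E * (a + a' + c + c') := by
    rw [abs_le]; constructor <;> nlinarith
  have k5 : |a' ^ 2 - c' ^ 2| ≤ 2 * E * (a + a' + c + c') := by
    refine le_trans ?_ k4
    rw [abs_mul, abs_of_nonneg (by positivity : 0 ≤ 1 + r ^ 2)]
    nlinarith [abs_nonneg (a' ^ 2 - c' ^ 2), sq_nonneg r]
  have hN : 0 ≤ E * (a + a' + c + c') := by positivity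
  refine ⟨by linarith, ?_⟩
  have k6 := abs_le.1 k5
  rw [abs_le]; constructor <;> linarith

lemma Slab.amp_sq_sub_le (h : Slab l W d s) (h' : Slab l W d' s') {τ : ℝ}
    (hτ : Complex.exp (τ * Complex.I * W) = 1)
    (hn : ∀ t : ℝ, ‖slabA l W d s (t * Complex.I)‖ = ‖slabA l W d' s' (t * Complex.I)‖)
    {p : ℂ} (hp : p.im ∈ Ioo τ (τ + 2 * Real.pi / W)) (hA : slabA l W d s p = 0)
    (hA' : slabA l W d' s' p = 0) :
    |amp l d τ ^ 2 - amp l d' τ ^ 2| ≤ 6 * l * (|p.re| + 2 * Real.pi / W) *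
      (amp l s τ + amp l d τ + amp l s' τ + amp l d' τ) ∧
    |amp l s τ ^ 2 - amp l s' τ ^ 2| ≤ 6 * l * (|p.re| + 2 * Real.pi / W) *
      (amp l s τ + amp l d τ + amp l s' τ + amp l d' τ) := by
  have hW := h.W_pos
  have hl := h.l_pos
  set μ : ℂ := p - τ * Complex.I with hμ
  have hμn : ‖μ‖ ≤ |p.re| + 2 * Real.pi / W := by
    refine (Complex.norm_le_abs_re_add_abs_im μ).trans ?_
    have e1 : μ.re = p.re := by simp [hμ]
    have e2 : μ.im = p.im - τ := by simp [hμ]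
    rw [e1, e2, abs_of_pos (by linarith [hp.1] : 0 < p.im - τ)]
    linarith [hp.2]
  set E := 2 * l * (|p.re| + 2 * Real.pi / W) with hE
  have hE0 : 0 < E := by have := Real.pi_pos; positivity
  set r := ‖Complex.exp (μ * W)‖ with hr
  have hr0 : 0 < r := by rw [hr, Complex.norm_exp]; exact Real.exp_pos _
  have key : ∀ {d s : ℝ → ℝ}, Slab l W d s → slabA l W d s p = 0 →
      |amp l s τ - r * amp l d τ| ≤ E * max 1 r := by
    intro d s h hA
    have h0 := h.asymptotic τ μ hτ
    have e1 : (τ * Complex.I + μ) = p := by rw [hμ]; ring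
    rw [e1, hA, mul_zero, zero_sub, norm_neg, ← hr] at h0
    have e2 := abs_norm_sub_norm_le (-(τ * Complex.I) * depthInt l s (τ * Complex.I))
      (-(Complex.exp (μ * W) * (τ * Complex.I * depthInt l d (-(τ * Complex.I)))))
    rw [sub_neg_eq_add, norm_neg, norm_mul (Complex.exp (μ * W)), ← hr, amp_eq_pos] at e2
    refine (e2.trans h0).trans ?_
    have : 2 * ‖μ‖ * l ≤ E := by rw [hE]; nlinarith
    calc 2 * ‖μ‖ * max 1 r * l = 2 * ‖μ‖ * l * max 1 r := by ring
      _ ≤ _ := mul_le_mul_of_nonneg_right this (by positivity)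
  have k1 := key h hA
  have k2 := key h' hA'
  have hS := h.amp_sq_sum_sub_le h' hτ hn
  have he : 2 * Real.pi * l / W ≤ E := by
    have e1 : E = 2 * l * |p.re| + 2 * (2 * Real.pi * l / W) := by rw [hE]; ring
    have : 0 ≤ 2 * Real.pi * l / W := by have := Real.pi_pos; positivity
    have : 0 ≤ 2 * l * |p.re| := by positivity
    linarith
  have e6 : 6 * l * (|p.re| + 2 * Real.pi / W) = 3 * E := by rw [hE]; ring
  rw [e6]
  have a1 := amp_nonneg l d τ
  have a2 := amp_nonneg l s τ
  have a3 := amp_nonneg l d' τ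
  have a4 := amp_nonneg l s' τ
  rcases le_total r 1 with hr1 | hr1
  · rw [max_eq_left hr1, mul_one] at k1 k2
    exact abs_sq_sub_le_of_ratio a2 a1 a4 a3 hr0.le hr1 he k1 k2 hS
  · rw [max_eq_right hr1] at k1 k2
    have inv : ∀ {a a' : ℝ}, |a - r * a'| ≤ E * r → |a' - r⁻¹ * a| ≤ E := by
      intro a a' h0
      have : a' - r⁻¹ * a = -(r⁻¹ * (a - r * a')) := by field_simp; ring
      rw [this, abs_neg, abs_mul, abs_of_pos (inv_pos.2 hr0), inv_mul_le_iff₀ hr0]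
      linarith
    have := abs_sq_sub_le_of_ratio a1 a2 a3 a4 (inv_nonneg.2 hr0.le) (inv_le_one_of_one_le₀ hr1) he
      (inv k1) (inv k2) (by
        rw [add_comm (amp l d τ ^ 2), add_comm (amp l d' τ ^ 2)]
        refine hS.trans (le_of_eq ?_); ring)
    have e7 : amp l d τ + amp l s τ + amp l d' τ + amp l s' τ =
      amp l s τ + amp l d τ + amp l s' τ + amp l d' τ := by ring
    rw [e7] at this
    exact ⟨this.2, this.1⟩

end

end Planar

end

section
open MeasureTheory Set Filter Topology

namespace Planar

lemma variance_ge {l : ℝ} (hl : 0 ≤ l) {w : ℝ → ℝ} (hw : Continuous w)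
    (h0 : ∀ x ∈ Icc 0 l, 0 ≤ w x) (h1 : ∀ x ∈ Icc 0 l, w x ≤ 1) (M : ℝ)
    (hZ : 0 < ∫ x in (0 : ℝ)..l, w x) :
    (∫ x in (0 : ℝ)..l, w x) ^ 3 / 80 ≤ ∫ x in (0 : ℝ)..l, (x - M) ^ 2 * w x := by
  set Z := ∫ x in (0 : ℝ)..l, w x with hZdef
  set t := Z / 4 with ht
  have ht0 : 0 < t := by positivity
  have hpos : ∀ x : ℝ, 0 < (x - M) ^ 2 + t ^ 2 := fun x => by positivity
  have c1 : Continuous fun x : ℝ => t ^ 2 * w x := by fun_prop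
  have c2 : Continuous fun x : ℝ => t ^ 4 / ((x - M) ^ 2 + t ^ 2) :=
    Continuous.div (by fun_prop) (by fun_prop) fun x => (hpos x).ne'
  have c3 : Continuous fun x : ℝ => (x - M) ^ 2 * w x := by fun_prop
  have h_int : ∫ x in (0 : ℝ)..l, t ^ 4 / ((x - M) ^ 2 + t ^ 2) =
      t ^ 3 * Real.arctan ((l - M) / t) - t ^ 3 * Real.arctan ((0 - M) / t) := by
    refine intervalIntegral.integral_eq_sub_of_hasDerivAt
      (f := fun x => t ^ 3 * Real.arctan ((x - M) / t)) (fun x _ => ?_) (c2.intervalIntegrable _ _)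
    have hd := ((((hasDerivAt_id x).sub_const M).div_const t).arctan).const_mul (t ^ 3)
    refine hd.congr_deriv ?_
    have := hpos x
    simp only [id_eq]
    have e : 1 + ((x - M) / t) ^ 2 = ((x - M) ^ 2 + t ^ 2) / t ^ 2 := by field_simp; ring
    rw [e]; field_simp
  have harc : ∫ x in (0 : ℝ)..l, t ^ 4 / ((x - M) ^ 2 + t ^ 2) ≤ Real.pi * t ^ 3 := by
    rw [h_int]
    have a1 := Real.arctan_lt_pi_div_two ((l - M) / t)
    have a2 := Real.neg_pi_div_two_lt_arctan ((0 - M) / t)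
    have : 0 < t ^ 3 := by positivity
    nlinarith
  have hmono : ∫ x in (0 : ℝ)..l, (t ^ 2 * w x - t ^ 4 / ((x - M) ^ 2 + t ^ 2)) ≤
      ∫ x in (0 : ℝ)..l, (x - M) ^ 2 * w x := by
    refine intervalIntegral.integral_mono_on hl ((c1.sub c2).intervalIntegrable _ _)
      (c3.intervalIntegrable _ _) fun x hx => ?_
    have h2 := h0 x hx
    have h3 := h1 x hx
    have h4 := hpos x
    have h5 : (t ^ 2 - (x - M) ^ 2) * w x ≤ t ^ 4 / ((x - M) ^ 2 + t ^ 2) := by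
      rw [le_div_iff₀ h4]
      have : (t ^ 2 - (x - M) ^ 2) * w x * ((x - M) ^ 2 + t ^ 2) =
        t ^ 4 * w x - (x - M) ^ 4 * w x := by ring
      rw [this]
      have : 0 ≤ (x - M) ^ 4 * w x := by positivity
      have : 0 ≤ t ^ 4 := by positivity
      nlinarith
    linarith
  rw [intervalIntegral.integral_sub (c1.intervalIntegrable _ _) (c2.intervalIntegrable _ _),
    intervalIntegral.integral_const_mul, ← hZdef] at hmono
  refine le_trans ?_ hmono
  have hpi := Real.pi_lt_d2
  have : t ^ 2 * Z - Real.pi * t ^ 3 = Z ^ 3 * ((4 - Real.pi) / 64) := by rw [ht]; ring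
  have hZ3 : 0 < Z ^ 3 := by positivity
  nlinarith

/-- Real weighted exponential integrals along a family of tilts. -/
noncomputable def tiltInt (l κ : ℝ) (f w : ℝ → ℝ) (q : ℝ) : ℝ :=
  ∫ x in (0 : ℝ)..l, w x * Real.exp (κ * (f x - q * x))

lemma hasDerivAt_tiltInt (l κ : ℝ) {f w : ℝ → ℝ} (hf : Continuous f) (hw : Continuous w) (q : ℝ) :
    HasDerivAt (tiltInt l κ f w) (-κ * tiltInt l κ f (fun x => w x * x) q) q := by
  have key : ∀ (w : ℝ → ℝ) (q : ℝ), expInt l w f (-(κ * q), κ) = (tiltInt l κ f w q : ℂ) := by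
    intro w q
    rw [expInt, tiltInt, ← intervalIntegral.integral_ofReal]
    refine intervalIntegral.integral_congr fun x _ => ?_
    simp only [Complex.ofReal_mul, Complex.ofReal_exp]
    congr 2
    push_cast; ring
  have h1 : HasDerivAt (fun q : ℂ => ((-(κ * q), κ) : ℂ × ℂ)) ((-(κ : ℂ), 0) : ℂ × ℂ) (q : ℂ) :=
    (((hasDerivAt_id (q : ℂ)).const_mul (κ : ℂ)).neg.prodMk (hasDerivAt_const _ _)).congr_deriv
      (by simp)
  have h2 := (hasFDerivAt_expInt l hw hf (-(κ * q), κ)).comp_hasDerivAt (q : ℂ) h1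
  have h3 := h2.real_of_complex
  refine (h3.congr_of_eventuallyEq (Eventually.of_forall fun q => ?_)).congr_deriv ?_
  · simp only [Function.comp, key, Complex.ofReal_re]
  · simp [key]
    ring

lemma continuous_dep_uncurry {l : ℝ} (hl : 0 ≤ l) {f : ℝ → ℝ} (hf : Continuous f) :
    Continuous (Function.uncurry fun q x => dep l f q x) := by
  have := continuous_tiltMax hl hf
  unfold Function.uncurry dep
  fun_prop

lemma continuous_depthMass {l : ℝ} (hl : 0 ≤ l) {f : ℝ → ℝ} (hf : Continuous f) (κ : ℝ) :
    Continuous fun q => depthMass l (dep l f q) κ := by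
  have := continuous_dep_uncurry hl hf
  unfold depthMass
  refine intervalIntegral.continuous_parametric_intervalIntegral_of_continuous' ?_ 0 l
  simp only [Function.uncurry_def] at this ⊢
  fun_prop

lemma depthMass_pos {l : ℝ} (hl : 0 < l) {D : ℝ → ℝ} (hD : Continuous D) (κ : ℝ) :
    0 < depthMass l D κ :=
  intervalIntegral.intervalIntegral_pos_of_pos
    (Continuous.intervalIntegrable (by fun_prop) _ _) (fun _ => Real.exp_pos _) hl

lemma depthMass_antitone {l : ℝ} (hl : 0 ≤ l) {D : ℝ → ℝ} (hD : Continuous D)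
    (h0 : ∀ x ∈ Icc 0 l, 0 ≤ D x) : Antitone (depthMass l D) := fun a b hab =>
  intervalIntegral.integral_mono_on hl (Continuous.intervalIntegrable (by fun_prop) _ _)
    (Continuous.intervalIntegrable (by fun_prop) _ _) fun x hx =>
      Real.exp_le_exp.2 (by nlinarith [h0 x hx])

lemma integral_depthMass_sq_le {l : ℝ} (hl : 0 < l) {f : ℝ → ℝ} (hf : Continuous f) {κ : ℝ}
    (hκ : 0 < κ) {a b : ℝ} (hab : a ≤ b) :
    ∫ q in a..b, κ * depthMass l (dep l f q) κ ^ 2 ≤ 80 * l := by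
  have cd := fun q => continuous_dep l hf q
  have hP : ∀ q, 0 < tiltInt l κ f (fun _ => 1) q := fun q =>
    intervalIntegral.intervalIntegral_pos_of_pos
      (Continuous.intervalIntegrable (by fun_prop) _ _) (fun _ => by positivity) hl
  set M : ℝ → ℝ := fun q => tiltInt l κ f (fun x => 1 * x) q / tiltInt l κ f (fun _ => 1) q with hM
  have hMd : ∀ q, HasDerivAt M (-κ * (tiltInt l κ f (fun x => 1 * x * x) q /
      tiltInt l κ f (fun _ => 1) q - M q ^ 2)) q := by
    intro q
    refine ((hasDerivAt_tiltInt l κ hf (by fun_prop) q).div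
      (hasDerivAt_tiltInt l κ hf continuous_const q) (hP q).ne').congr_deriv ?_
    have := (hP q).ne'
    simp only [hM]
    field_simp
    ring
  have hM0 : ∀ q, 0 ≤ M q := fun q => div_nonneg (intervalIntegral.integral_nonneg hl.le
    fun x hx => by have := hx.1; positivity) (hP q).le
  have hMl : ∀ q, M q ≤ l := fun q => by
    rw [hM]; simp only
    rw [div_le_iff₀ (hP q), tiltInt, tiltInt, ← intervalIntegral.integral_const_mul]
    refine intervalIntegral.integral_mono_on hl.le (Continuous.intervalIntegrable (by fun_prop) _ _)
      (Continuous.intervalIntegrable (by fun_prop) _ _) fun x hx => ?_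
    have := hx.2
    have := Real.exp_pos (κ * (f x - q * x))
    nlinarith
  have hvar : ∀ q, κ * depthMass l (dep l f q) κ ^ 2 / 80 ≤
      κ * (tiltInt l κ f (fun x => 1 * x * x) q / tiltInt l κ f (fun _ => 1) q - M q ^ 2) := by
    intro q
    have hZ := depthMass_pos hl (cd q) κ
    have hv := variance_ge hl.le (w := fun x => Real.exp (-κ * dep l f q x)) (by fun_prop)
      (fun x _ => (Real.exp_pos _).le)
      (fun x hx => Real.exp_le_one_iff.2 (by nlinarith [dep_nonneg hf q hx])) (M q) hZ
    set C := Real.exp (-κ * tiltMax l f q) with hC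
    have hCpos : 0 < C := Real.exp_pos _
    have hw : ∀ w : ℝ → ℝ, ∫ x in (0 : ℝ)..l, w x * Real.exp (-κ * dep l f q x) =
        C * tiltInt l κ f w q := by
      intro w
      rw [tiltInt, ← intervalIntegral.integral_const_mul]
      refine intervalIntegral.integral_congr fun x _ => ?_
      rw [mul_left_comm, hC, ← Real.exp_add]
      congr 2; simp only [dep]; ring
    have hZe : depthMass l (dep l f q) κ = C * tiltInt l κ f (fun _ => 1) q := by
      rw [← hw, depthMass]; simp
    have hsplit : ∫ x in (0 : ℝ)..l, (x - M q) ^ 2 * Real.exp (-κ * dep l f q x) =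
        C * (tiltInt l κ f (fun x => 1 * x * x) q - 2 * M q * tiltInt l κ f (fun x => 1 * x) q +
          M q ^ 2 * tiltInt l κ f (fun _ => 1) q) := by
      have ci : ∀ w : ℝ → ℝ, Continuous w →
          IntervalIntegrable (fun x => w x * Real.exp (κ * (f x - q * x))) volume 0 l :=
        fun w hw => Continuous.intervalIntegrable (by fun_prop) _ _
      rw [hw]
      congr 1
      simp only [tiltInt]
      rw [← intervalIntegral.integral_const_mul, ← intervalIntegral.integral_const_mul,
        ← intervalIntegral.integral_sub (ci _ (by fun_prop)) ((ci _ (by fun_prop)).const_mul _),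
        ← intervalIntegral.integral_add ((ci _ (by fun_prop)).sub ((ci _ (by fun_prop)).const_mul _))
          ((ci _ (by fun_prop)).const_mul _)]
      refine intervalIntegral.integral_congr fun x _ => ?_
      ring
    have hMP : tiltInt l κ f (fun x => 1 * x) q = M q * tiltInt l κ f (fun _ => 1) q := by
      rw [hM]; field_simp [(hP q).ne']
    rw [hsplit] at hv
    change depthMass l (dep l f q) κ ^ 3 / 80 ≤ _ at hv
    rw [hMP] at hv
    set P := tiltInt l κ f (fun _ => 1) q with hPdef
    set Q := tiltInt l κ f (fun x => 1 * x * x) q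
    have hPp : 0 < P := hP q
    have e1 : C * (Q - 2 * M q * (M q * P) + M q ^ 2 * P) =
        depthMass l (dep l f q) κ * (Q / P - M q ^ 2) := by
      rw [hZe]; field_simp; ring
    rw [e1] at hv
    have h4 : depthMass l (dep l f q) κ ^ 2 / 80 ≤ Q / P - M q ^ 2 := by
      refine le_of_mul_le_mul_left ?_ hZ
      calc _ = depthMass l (dep l f q) κ ^ 3 / 80 := by ring
        _ ≤ _ := hv
    calc _ = κ * (depthMass l (dep l f q) κ ^ 2 / 80) := by ring
      _ ≤ _ := mul_le_mul_of_nonneg_left h4 hκ.le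
  have hcZ := continuous_depthMass hl.le hf κ
  have hfin := intervalIntegral.integral_le_sub_of_hasDeriv_right_of_le (g := fun q => -M q) hab
    (fun q _ => (hMd q).neg.continuousAt.continuousWithinAt)
    (fun q _ => (hMd q).neg.hasDerivWithinAt)
    (φ := fun q => κ * depthMass l (dep l f q) κ ^ 2 / 80)
    (Continuous.integrableOn_Icc (by fun_prop))
    (fun q _ => (hvar q).trans (le_of_eq (by ring)))
  rw [intervalIntegral.integral_div] at hfin
  have := hM0 b
  have := hMl a
  have h80 : (∫ q in a..b, κ * depthMass l (dep l f q) κ ^ 2) / 80 ≤ l := by linarith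
  linarith

end Planar

end

section
open MeasureTheory Set Filter Topology
open scoped SchwartzMap FourierTransform

namespace Planar

lemma ConcaveOn_ae_differentiableAt {l : ℝ} {f : ℝ → ℝ} (hf : ConcaveOn ℝ (Icc 0 l) f) :
    ∀ᵐ x : ℝ, x ∈ Ioo 0 l → DifferentiableAt ℝ f x := by
  have hL := hf.locallyLipschitzOn_interior
  rw [interior_Icc] at hL
  rw [ae_iff]
  refine measure_null_of_locally_null _ fun x hx => ?_
  simp only [Classical.not_imp, mem_ofPred_eq] at hx
  obtain ⟨K, t, ht, hK⟩ := hL hx.1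
  have ht' : t ∈ 𝓝 x := by
    rwa [nhdsWithin_eq_nhds.2 (isOpen_Ioo.mem_nhds hx.1)] at ht
  refine ⟨interior t ∩ {x | ¬ (x ∈ Ioo 0 l → DifferentiableAt ℝ f x)}, ?_, ?_⟩
  · refine inter_mem (mem_nhdsWithin_of_mem_nhds (interior_mem_nhds.2 ht')) self_mem_nhdsWithin
  · have h1 := hK.ae_differentiableWithinAt_of_mem_real
    rw [ae_iff] at h1
    refine measure_mono_null (fun y hy => ?_) h1
    obtain ⟨hy1, hy2⟩ := hy
    simp only [Classical.not_imp, mem_ofPred_eq] at hy2 ⊢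
    exact ⟨interior_subset hy1, fun h => hy2.2 (h.differentiableAt (mem_interior_iff_mem_nhds.1 hy1))⟩

lemma integral_swap_of_le_schwartz (Φ : 𝓢(ℝ, ℂ)) (l : ℝ) {G : ℝ → ℝ → ℂ} {C : ℝ}
    (hG : Continuous (Function.uncurry G)) (hC : ∀ x q, ‖G x q‖ ≤ C * ‖Φ q‖) :
    ∫ q, ∫ x in (0 : ℝ)..l, G x q = ∫ x in (0 : ℝ)..l, ∫ q, G x q := by
  refine (intervalIntegral_integral_swap ?_).symm
  have h1 : Integrable (fun _ : ℝ => C) (volume.restrict (uIoc 0 l)) := by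
    refine integrableOn_const ?_ ?_ <;> simp [uIoc]
  have h2 := h1.mul_prod (Φ.integrable (μ := volume)).norm
  exact h2.mono' hG.aestronglyMeasurable (Eventually.of_forall fun z => hC z.1 z.2)

section
variable {l : ℝ} {f : ℝ → ℝ}

lemma amp_sq_div (l : ℝ) (f : ℝ → ℝ) {κ : ℝ} (hκ : 0 < κ) (q : ℝ) :
    ((amp l (dep l f q) κ ^ 2 / κ : ℝ) : ℂ) =
      κ * ((∫ x in (0 : ℝ)..l, Complex.exp (κ * Complex.I * (f x - q * x))) *
        ∫ y in (0 : ℝ)..l, Complex.exp (-(κ * Complex.I) * (f y - q * y))) := by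
  set U := ∫ x in (0 : ℝ)..l, Complex.exp (κ * Complex.I * (f x - q * x)) with hU
  have e1 : ∫ y in (0 : ℝ)..l, Complex.exp (-(κ * Complex.I) * (f y - q * y)) =
      starRingEnd ℂ U := by
    rw [hU, intervalIntegral.intervalIntegral_eq_integral_uIoc,
      intervalIntegral.intervalIntegral_eq_integral_uIoc]
    simp only [Complex.real_smul, map_mul, Complex.conj_ofReal]
    rw [← integral_conj]
    simp only [← Complex.exp_conj, map_mul, Complex.conj_ofReal, map_sub, Complex.conj_I]
    congr 2
    funext x; congr 1; ring
  have e2 : depthInt l (dep l f q) (-(κ * Complex.I)) =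
      Complex.exp (-(κ * tiltMax l f q : ℝ) * Complex.I) * U := by
    rw [hU, depthInt, ← intervalIntegral.integral_const_mul]
    refine intervalIntegral.integral_congr fun x _ => ?_
    rw [← Complex.exp_add]; congr 1
    simp only [dep]; push_cast; ring
  have e3 : amp l (dep l f q) κ = κ * ‖U‖ := by
    rw [amp, e2, norm_mul, norm_mul, norm_mul, Complex.norm_I, mul_one, Complex.norm_real,
      Real.norm_eq_abs, abs_of_pos hκ, ← Complex.ofReal_neg, Complex.norm_exp_ofReal_mul_I, one_mul]
  rw [e1, Complex.mul_conj, e3, Complex.normSq_eq_norm_sq]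
  have : (κ : ℂ) ≠ 0 := by exact_mod_cast hκ.ne'
  push_cast; field_simp

lemma integral_amp_sq_eq (hl : 0 ≤ l) (hf : Continuous f) (Φ : 𝓢(ℝ, ℂ)) {κ : ℝ} (hκ : 0 < κ) :
    ∫ q, Φ q * ((amp l (dep l f q) κ ^ 2 / κ : ℝ) : ℂ) =
      ∫ x in (0 : ℝ)..l, Complex.exp (κ * Complex.I * f x) * (κ * ∫ y in (0 : ℝ)..l,
        Complex.exp (-(κ * Complex.I) * f y) * 𝓕 (Φ : ℝ → ℂ) (κ * (x - y) / (2 * Real.pi))) := by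
  set V : ℝ → ℂ := fun q => ∫ y in (0 : ℝ)..l, Complex.exp (-(κ * Complex.I) * (f y - q * y)) with hV
  have hVc : Continuous V := by
    refine intervalIntegral.continuous_parametric_intervalIntegral_of_continuous' ?_ 0 l
    simp only [Function.uncurry_def]; fun_prop
  have hVn : ∀ q, ‖V q‖ ≤ l := fun q => by
    have := intervalIntegral.norm_integral_le_of_norm_le_const (a := 0) (b := l)
      (f := fun y : ℝ => Complex.exp (-(κ * Complex.I) * (f y - q * y))) (C := 1) (fun x _ => by
        rw [Complex.norm_exp]; simp)
    rwa [sub_zero, abs_of_nonneg hl, one_mul] at this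
  have hΦc := Φ.continuous
  simp only [amp_sq_div l f hκ]
  have s1 : ∀ q, Φ q * (κ * ((∫ x in (0 : ℝ)..l, Complex.exp (κ * Complex.I * (f x - q * x))) *
      ∫ y in (0 : ℝ)..l, Complex.exp (-(κ * Complex.I) * (f y - q * y)))) =
      ∫ x in (0 : ℝ)..l, (κ * Φ q * V q) * Complex.exp (κ * Complex.I * (f x - q * x)) := fun q => by
    rw [intervalIntegral.integral_const_mul]; simp only [hV]; ring
  simp only [s1]
  rw [integral_swap_of_le_schwartz Φ l (C := κ * l) (by simp only [Function.uncurry_def]; fun_prop)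
    (fun x q => by
      rw [norm_mul, norm_mul, norm_mul, Complex.norm_real, Real.norm_eq_abs, abs_of_pos hκ,
        Complex.norm_exp]
      have e0 : (κ * Complex.I * (f x - q * x) : ℂ).re = 0 := by simp
      rw [e0, Real.exp_zero, mul_one]
      have := hVn q
      have h0 := norm_nonneg (Φ q)
      calc κ * ‖Φ q‖ * ‖V q‖ ≤ κ * ‖Φ q‖ * l := mul_le_mul_of_nonneg_left this (by positivity)
        _ = _ := by ring)]
  refine intervalIntegral.integral_congr fun x _ => ?_
  have s2 : ∀ q : ℝ, κ * Φ q * V q * Complex.exp (κ * Complex.I * (f x - q * x)) =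
      ∫ y in (0 : ℝ)..l, (κ * Φ q * Complex.exp (κ * Complex.I * (f x - q * x))) *
        Complex.exp (-(κ * Complex.I) * (f y - q * y)) := fun q => by
    rw [intervalIntegral.integral_const_mul]; simp only [hV]; ring
  simp only [s2]
  rw [integral_swap_of_le_schwartz Φ l (C := κ) (by simp only [Function.uncurry_def]; fun_prop)
    (fun y q => by
      rw [norm_mul, norm_mul, norm_mul, Complex.norm_real, Real.norm_eq_abs, abs_of_pos hκ,
        Complex.norm_exp, Complex.norm_exp]
      have e0 : (κ * Complex.I * (f x - q * x) : ℂ).re = 0 := by simp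
      have e1 : (-(κ * Complex.I) * (f y - q * y) : ℂ).re = 0 := by simp
      rw [e0, e1, Real.exp_zero, mul_one, mul_one])]
  rw [← mul_assoc, ← intervalIntegral.integral_const_mul]
  refine intervalIntegral.integral_congr fun y _ => ?_
  rw [Real.fourier_real_eq_integral_exp_smul, ← mul_assoc, ← integral_const_mul]
  congr 1
  funext q
  rw [smul_eq_mul]
  have e : Complex.exp (κ * Complex.I * (f x - q * x)) *
        Complex.exp (-(κ * Complex.I) * (f y - q * y)) =
      Complex.exp (κ * Complex.I * f x) * Complex.exp (-(κ * Complex.I) * f y) *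
        Complex.exp (((-2 * Real.pi * q * (κ * (x - y) / (2 * Real.pi)) : ℝ) : ℂ) * Complex.I) := by
    rw [← Complex.exp_add, ← Complex.exp_add, ← Complex.exp_add]
    congr 1
    have : (Real.pi : ℂ) ≠ 0 := by exact_mod_cast Real.pi_ne_zero
    push_cast; field_simp; ring
  rw [mul_assoc, mul_assoc, e]; ring

lemma rescale_integral (hl : 0 ≤ l) (h : ℝ → ℂ) {κ : ℝ} (hκ : 0 < κ) (Ψ : ℝ → ℂ) (x : ℝ) :
    κ * ∫ y in (0 : ℝ)..l, h y * Ψ (κ * (x - y) / (2 * Real.pi)) =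
      2 * Real.pi * ∫ v, (Ioc 0 l).indicator h (x - 2 * Real.pi / κ * v) * Ψ v := by
  have hpi := Real.pi_pos
  rw [intervalIntegral.integral_of_le hl, ← integral_indicator measurableSet_Ioc,
    ← integral_sub_left_eq_self _ _ x]
  have h1 := Measure.integral_comp_mul_left (fun y => (Ioc 0 l).indicator
    (fun y => h y * Ψ (κ * (x - y) / (2 * Real.pi))) (x - y)) (2 * Real.pi / κ)
  have e : ∀ v, (Ioc 0 l).indicator (fun y => h y * Ψ (κ * (x - y) / (2 * Real.pi)))
      (x - 2 * Real.pi / κ * v) = (Ioc 0 l).indicator h (x - 2 * Real.pi / κ * v) * Ψ v := by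
    intro v
    by_cases hv : x - 2 * Real.pi / κ * v ∈ Ioc 0 l
    · rw [indicator_of_mem hv, indicator_of_mem hv]
      congr 2; field_simp; ring
    · rw [indicator_of_notMem hv, indicator_of_notMem hv, zero_mul]
  simp only [e] at h1
  rw [h1, abs_of_pos (by positivity), Complex.real_smul]
  have : (κ : ℂ) ≠ 0 := by exact_mod_cast hκ.ne'
  have : (Real.pi : ℂ) ≠ 0 := by exact_mod_cast Real.pi_ne_zero
  push_cast; field_simp

lemma tendsto_inner (hf : Continuous f) (Φ : 𝓢(ℝ, ℂ)) {x : ℝ} (hx : x ∈ Ioo 0 l)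
    (hd : DifferentiableAt ℝ f x) :
    Tendsto (fun κ : ℝ => Complex.exp (κ * Complex.I * f x) * (2 * Real.pi * ∫ v,
      (Ioc 0 l).indicator (fun y => Complex.exp (-(κ * Complex.I) * f y))
        (x - 2 * Real.pi / κ * v) * 𝓕 (Φ : ℝ → ℂ) v)) atTop (𝓝 (2 * Real.pi * Φ (deriv f x))) := by
  have hinv : Φ (deriv f x) = ∫ v : ℝ, Complex.exp (2 * Real.pi * v * deriv f x * Complex.I) *
      𝓕 (Φ : ℝ → ℂ) v := by
    have h0 : 𝓕⁻ (𝓕 (Φ : ℝ → ℂ)) (deriv f x) = Φ (deriv f x) :=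
      Φ.integrable.fourierInv_fourier_eq (𝓕 Φ).integrable Φ.continuous.continuousAt
    rw [← h0, Real.fourierInv_eq']
    congr 1; funext v
    rw [smul_eq_mul]
    congr 2
    simp; ring
  rw [hinv]
  have hc : Continuous (𝓕 (Φ : ℝ → ℂ)) := (𝓕 Φ).continuous
  have hsm : ∀ v : ℝ, Tendsto (fun κ : ℝ => x - 2 * Real.pi / κ * v) atTop (𝓝 x) := fun v => by
    have : Tendsto (fun κ : ℝ => x - 2 * Real.pi / κ * v) atTop (𝓝 (x - 0 * v)) :=
      (tendsto_const_nhds.div_atTop tendsto_id).mul_const v |>.const_sub x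
    simpa using this
  have key : Tendsto (fun κ : ℝ => ∫ v, Complex.exp (κ * Complex.I * f x) *
      ((Ioc 0 l).indicator (fun y => Complex.exp (-(κ * Complex.I) * f y))
        (x - 2 * Real.pi / κ * v) * 𝓕 (Φ : ℝ → ℂ) v)) atTop
      (𝓝 (∫ v : ℝ, Complex.exp (2 * Real.pi * v * deriv f x * Complex.I) * 𝓕 (Φ : ℝ → ℂ) v)) := by
    refine tendsto_integral_filter_of_dominated_convergence (fun v => ‖𝓕 (Φ : ℝ → ℂ) v‖)
      (Eventually.of_forall fun κ => ?_) (Eventually.of_forall fun κ =>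
        Eventually.of_forall fun v => ?_) (𝓕 Φ).integrable.norm (Eventually.of_forall fun v => ?_)
    · refine (Measurable.mul measurable_const (Measurable.mul ?_ hc.measurable)).aestronglyMeasurable
      refine (Measurable.indicator (Continuous.measurable (by fun_prop)) measurableSet_Ioc).comp
        (Continuous.measurable (by fun_prop))
    · rw [norm_mul, norm_mul, Complex.norm_exp]
      have e0 : (κ * Complex.I * f x : ℂ).re = 0 := by simp
      rw [e0, Real.exp_zero, one_mul]
      refine mul_le_of_le_one_left (norm_nonneg _) ?_
      refine (norm_indicator_le_norm_self _ _).trans ?_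
      rw [Complex.norm_exp]; simp
    · have hev : ∀ᶠ κ : ℝ in atTop, x - 2 * Real.pi / κ * v ∈ Ioc 0 l :=
        (hsm v).eventually (Filter.mem_of_superset (Ioo_mem_nhds hx.1 hx.2) Ioo_subset_Ioc_self)
      have hder : HasDerivAt (fun t : ℝ => f (x - 2 * Real.pi * v * t))
          (-(2 * Real.pi * v * deriv f x)) 0 := by
        have h1 : HasDerivAt (fun t : ℝ => x - 2 * Real.pi * v * t) (-(2 * Real.pi * v)) 0 :=
          (((hasDerivAt_id (0 : ℝ)).const_mul (2 * Real.pi * v)).const_sub x).congr_deriv (by simp)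
        have h2 : HasDerivAt f (deriv f x) (x - 2 * Real.pi * v * 0) := by
          rw [mul_zero, sub_zero]; exact hd.hasDerivAt
        exact (h2.comp 0 h1).congr_deriv (by ring)
      have hsl := hder.tendsto_slope_zero.comp
        ((tendsto_inv_atTop_nhdsGT_zero (𝕜 := ℝ)).mono_right
          (nhdsWithin_mono _ fun y (hy : 0 < y) => ne_of_gt hy))
      have hphase : Tendsto (fun κ : ℝ => κ * f x - κ * f (x - 2 * Real.pi / κ * v)) atTop
          (𝓝 (2 * Real.pi * v * deriv f x)) := by
        have := hsl.neg
        rw [neg_neg] at this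
        refine this.congr fun κ => ?_
        simp only [Function.comp, inv_inv, zero_add, smul_eq_mul, mul_zero, sub_zero]
        have : 2 * Real.pi * v * κ⁻¹ = 2 * Real.pi / κ * v := by ring
        rw [this]; ring
      have hexp : Tendsto (fun κ : ℝ => Complex.exp (((κ * f x - κ * f (x - 2 * Real.pi / κ * v) : ℝ) : ℂ) *
          Complex.I) * 𝓕 (Φ : ℝ → ℂ) v) atTop
          (𝓝 (Complex.exp ((2 * Real.pi * v * deriv f x : ℝ) * Complex.I) * 𝓕 (Φ : ℝ → ℂ) v)) := by
        refine Tendsto.mul_const _ ?_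
        exact (Complex.continuous_exp.tendsto _).comp
          (((Complex.continuous_ofReal.tendsto _).comp hphase).mul_const _)
      push_cast at hexp
      refine hexp.congr' ?_
      filter_upwards [hev] with κ hκ
      rw [indicator_of_mem hκ, ← mul_assoc, ← Complex.exp_add]
      congr 2; ring
  have := key.const_mul (2 * Real.pi : ℂ)
  refine this.congr fun κ => ?_
  rw [integral_const_mul]; ring

theorem tendsto_integral_amp_sq (hl : 0 ≤ l) (hf : Continuous f) (hconc : ConcaveOn ℝ (Icc 0 l) f)
    (Φ : 𝓢(ℝ, ℂ)) :
    Tendsto (fun κ : ℝ => ∫ q, Φ q * ((amp l (dep l f q) κ ^ 2 / κ : ℝ) : ℂ)) atTop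
      (𝓝 (∫ x in (0 : ℝ)..l, 2 * Real.pi * Φ (deriv f x))) := by
  have hc : Continuous (𝓕 (Φ : ℝ → ℂ)) := (𝓕 Φ).continuous
  have hi : Integrable (𝓕 (Φ : ℝ → ℂ)) := (𝓕 Φ).integrable
  have key : Tendsto (fun κ : ℝ => ∫ x in (0 : ℝ)..l, Complex.exp (κ * Complex.I * f x) *
      (κ * ∫ y in (0 : ℝ)..l,
        Complex.exp (-(κ * Complex.I) * f y) * 𝓕 (Φ : ℝ → ℂ) (κ * (x - y) / (2 * Real.pi)))) atTop
      (𝓝 (∫ x in (0 : ℝ)..l, 2 * Real.pi * Φ (deriv f x))) := by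
    refine intervalIntegral.tendsto_integral_filter_of_dominated_convergence
      (fun _ => 2 * Real.pi * ∫ v, ‖𝓕 (Φ : ℝ → ℂ) v‖) (Eventually.of_forall fun κ => ?_) ?_
      intervalIntegrable_const ?_
    · refine Continuous.aestronglyMeasurable ?_
      refine Continuous.mul (by fun_prop) (continuous_const.mul ?_)
      refine intervalIntegral.continuous_parametric_intervalIntegral_of_continuous' ?_ 0 l
      simp only [Function.uncurry_def]; fun_prop
    · filter_upwards [eventually_gt_atTop 0] with κ hκ
      refine Eventually.of_forall fun x _ => ?_
      rw [rescale_integral hl _ hκ, norm_mul, norm_mul, Complex.norm_exp]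
      have e0 : (κ * Complex.I * f x : ℂ).re = 0 := by simp
      have e1 : ‖(2 * Real.pi : ℂ)‖ = 2 * Real.pi := by
        rw [norm_mul, Complex.norm_real, Real.norm_eq_abs, abs_of_pos Real.pi_pos]; simp
      rw [e0, Real.exp_zero, one_mul, e1]
      refine mul_le_mul_of_nonneg_left ?_ (by positivity)
      refine norm_integral_le_of_norm_le hi.norm (Eventually.of_forall fun v => ?_)
      rw [norm_mul]
      refine mul_le_of_le_one_left (norm_nonneg _) ?_
      refine (norm_indicator_le_norm_self _ _).trans ?_
      rw [Complex.norm_exp]; simp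
    · have h1 := ConcaveOn_ae_differentiableAt hconc
      have h2 : ∀ᵐ x : ℝ, x ≠ l := by simp [ae_iff, measure_singleton]
      filter_upwards [h1, h2] with x hx hxl hm
      rw [uIoc_of_le hl] at hm
      have hxI : x ∈ Ioo 0 l := ⟨hm.1, lt_of_le_of_ne hm.2 hxl⟩
      refine (tendsto_inner hf Φ hxI (hx hxI)).congr' ?_
      filter_upwards [eventually_gt_atTop 0] with κ hκ
      rw [rescale_integral hl _ hκ]
  refine key.congr' ?_
  filter_upwards [eventually_gt_atTop 0] with κ hκ
  rw [integral_amp_sq_eq hl hf Φ hκ]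

end

end Planar

end

section
open MeasureTheory Set Filter Topology
open scoped ContDiff

namespace Planar

/-- Families of amplitudes `a κ q` with masses `Z κ q`, whose energy densities `a κ q ^ 2 / κ`
converge to the functional `T`. -/
structure Wave (l : ℝ) (a Z : ℝ → ℝ → ℝ) (T : (ℝ → ℝ) → ℝ) : Prop where
  a_cont : Continuous (Function.uncurry a)
  Z_cont : ∀ κ, Continuous (Z κ)
  a_nonneg : ∀ κ q, 0 ≤ a κ q
  Z_nonneg : ∀ κ q, 0 ≤ Z κ q
  anti : ∀ {κ κ'} q, κ ≤ κ' → Z κ' q ≤ Z κ q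
  a_zero : ∀ q, a 0 q = 0
  lip : ∀ {κ κ' ρ} q, |κ - κ'| ≤ ρ → |a κ q - a κ' q| ≤ 3 * ρ * Z ρ q
  energy : ∀ {κ A B}, 0 < κ → A ≤ B → ∫ q in A..B, κ * Z κ q ^ 2 ≤ 80 * l
  lim : ∀ {R φ}, ContDiff ℝ ∞ φ → Function.support φ ⊆ Ioc (-R) R →
    Tendsto (fun κ => ∫ q in (-R)..R, φ q * (a κ q ^ 2 / κ)) atTop (𝓝 (T φ))

section
variable {l : ℝ} {a Z : ℝ → ℝ → ℝ} {T : (ℝ → ℝ) → ℝ}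

lemma Wave.le (h : Wave l a Z T) {κ : ℝ} (hκ : 0 ≤ κ) (q : ℝ) : a κ q ≤ 3 * κ * Z κ q := by
  have := h.lip (κ := κ) (κ' := 0) (ρ := κ) q (by rw [sub_zero, abs_of_nonneg hκ])
  rwa [h.a_zero, sub_zero, abs_of_nonneg (h.a_nonneg κ q)] at this

lemma Wave.abs_sub_le (h : Wave l a Z T) {κ κ' k K θ : ℝ} (hk : 0 < k) (hκ : k ≤ κ)
    (hκ' : k ≤ κ') (hK : κ ≤ K) (hK' : κ' ≤ K) (hθ : 0 < θ) (hθ1 : θ ≤ 1)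
    (hd : |κ - κ'| ≤ θ ^ 2 * K) (q : ℝ) :
    |a κ q ^ 2 / κ - a κ' q ^ 2 / κ'| ≤
      27 * θ * (K / k) ^ 3 * (θ ^ 2 * K * Z (θ ^ 2 * K) q ^ 2 + k * Z k q ^ 2) := by
  set ρ := θ ^ 2 * K with hρ
  have hK0 : 0 < K := by linarith
  have hρ0 : 0 < ρ := by positivity
  have hκ0 : 0 < κ := by linarith
  have hκ0' : 0 < κ' := by linarith
  set r := K / k with hr
  have hr1 : 1 ≤ r := by rw [hr, one_le_div hk]; linarith
  have hKr : K = r * k := by rw [hr]; field_simp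
  set z := Z k q with hz
  set y := Z ρ q with hy
  have hz0 : 0 ≤ z := h.Z_nonneg _ _
  have hy0 : 0 ≤ y := h.Z_nonneg _ _
  have b1 : a κ q ≤ 3 * K * z := (h.le hκ0.le q).trans (by
    have := h.anti q hκ
    have h0 := h.Z_nonneg κ q
    calc 3 * κ * Z κ q ≤ 3 * K * Z κ q := by nlinarith
      _ ≤ _ := mul_le_mul_of_nonneg_left this (by positivity))
  have b2 : a κ' q ≤ 3 * K * z := (h.le hκ0'.le q).trans (by
    have := h.anti q hκ'
    have h0 := h.Z_nonneg κ' q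
    calc 3 * κ' * Z κ' q ≤ 3 * K * Z κ' q := by nlinarith
      _ ≤ _ := mul_le_mul_of_nonneg_left this (by positivity))
  have n1 := h.a_nonneg κ q
  have n2 := h.a_nonneg κ' q
  have b3 := h.lip q hd
  have e : a κ q ^ 2 / κ - a κ' q ^ 2 / κ' =
      (a κ q - a κ' q) * (a κ q + a κ' q) / κ + a κ' q ^ 2 * (κ' - κ) / (κ * κ') := by
    field_simp; ring
  have t1 : |(a κ q - a κ' q) * (a κ q + a κ' q) / κ| ≤ 18 * r * (ρ * y * z) := by
    rw [abs_div, abs_mul, abs_of_pos hκ0, abs_of_nonneg (add_nonneg n1 n2), div_le_iff₀ hκ0]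
    calc |a κ q - a κ' q| * (a κ q + a κ' q) ≤ 3 * ρ * y * (6 * K * z) :=
          mul_le_mul b3 (by linarith) (by positivity) (by positivity)
      _ = 18 * r * (ρ * y * z) * k := by rw [hKr]; ring
      _ ≤ _ := mul_le_mul_of_nonneg_left hκ (by positivity)
  have t2 : |a κ' q ^ 2 * (κ' - κ) / (κ * κ')| ≤ 9 * θ ^ 2 * r ^ 3 * (k * z ^ 2) := by
    rw [abs_div, abs_mul, abs_of_nonneg (sq_nonneg (a κ' q)),
      abs_of_pos (mul_pos hκ0 hκ0'), div_le_iff₀ (mul_pos hκ0 hκ0'), abs_sub_comm]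
    calc a κ' q ^ 2 * |κ - κ'| ≤ (3 * K * z) ^ 2 * ρ :=
          mul_le_mul (pow_le_pow_left₀ n2 b2 2) hd (abs_nonneg _) (by positivity)
      _ = 9 * θ ^ 2 * r ^ 3 * (k * z ^ 2) * (k * k) := by rw [hρ, hKr]; ring
      _ ≤ _ := mul_le_mul_of_nonneg_left (mul_le_mul hκ hκ' hk.le hκ0.le) (by positivity)
  have t3 : ρ * y * z ≤ θ * r * (ρ * y ^ 2 + k * z ^ 2) := by
    have s1 : 2 * (ρ * y * z) ≤ θ * (ρ * y ^ 2) + θ * (r * (k * z ^ 2)) := by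
      have : θ * (ρ * y ^ 2) + θ * (r * (k * z ^ 2)) - 2 * (ρ * y * z) =
        θ * K * (θ * y - z) ^ 2 := by rw [hρ, hKr]; ring
      have : 0 ≤ θ * K * (θ * y - z) ^ 2 := by positivity
      linarith
    have s2 : θ * (ρ * y ^ 2) ≤ θ * r * (ρ * y ^ 2) := by
      have : 0 ≤ θ * (ρ * y ^ 2) := by positivity
      nlinarith
    have s3 : 0 ≤ ρ * y * z := by positivity
    nlinarith
  rw [e]
  refine (abs_add_le _ _).trans ((add_le_add t1 t2).trans ?_)
  set F := ρ * y ^ 2 + k * z ^ 2 with hF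
  have hF0 : 0 ≤ F := by positivity
  have hkF : k * z ^ 2 ≤ F := by rw [hF]; have : 0 ≤ ρ * y ^ 2 := by positivity
                                 linarith
  have u1 : 18 * r * (ρ * y * z) ≤ 18 * θ * r ^ 3 * F := by
    calc 18 * r * (ρ * y * z) ≤ 18 * r * (θ * r * F) :=
          mul_le_mul_of_nonneg_left t3 (by positivity)
      _ = 18 * θ * F * r ^ 2 := by ring
      _ ≤ 18 * θ * F * r ^ 3 :=
          mul_le_mul_of_nonneg_left (pow_le_pow_right₀ hr1 (by norm_num)) (by positivity)
      _ = _ := by ring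
  have u2 : 9 * θ ^ 2 * r ^ 3 * (k * z ^ 2) ≤ 9 * θ * r ^ 3 * F := by
    calc 9 * θ ^ 2 * r ^ 3 * (k * z ^ 2) ≤ 9 * θ ^ 2 * r ^ 3 * F :=
          mul_le_mul_of_nonneg_left hkF (by positivity)
      _ = 9 * θ * r ^ 3 * F * θ := by ring
      _ ≤ 9 * θ * r ^ 3 * F * 1 := mul_le_mul_of_nonneg_left hθ1 (by positivity)
      _ = _ := by ring
  linarith

end

/-- A smooth partition of the interval `(-R, R]` into pieces of length at most `4 δ`. -/
lemma exists_smooth_partition (R : ℝ) {δ : ℝ} (hδ : 0 < δ) :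
    ∃ (N : ℕ) (χ : ℕ → ℝ → ℝ) (c : ℕ → ℝ), (∀ j, ContDiff ℝ ∞ (χ j)) ∧ (∀ j q, 0 ≤ χ j q) ∧
      (∀ j q, χ j q ≠ 0 → |q - c j| ≤ 2 * δ) ∧
      ∀ q ∈ Icc (-R) R, ∑ j ∈ Finset.range N, χ j q = 1 := by
  set c : ℕ → ℝ := fun j => -R - δ + j * δ with hc
  set s : ℕ → ℝ → ℝ := fun j q => Real.smoothTransition ((q - c j) / δ) with hs
  obtain ⟨N, hN⟩ := exists_nat_ge ((2 * R + δ) / δ)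
  rw [div_le_iff₀ hδ] at hN
  have hstep : ∀ j, c (j + 1) = c j + δ := fun j => by simp only [hc]; push_cast; ring
  refine ⟨N, fun j q => s j q - s (j + 1) q, c, fun j => ?_, fun j q => ?_, fun j q hq => ?_,
    fun q hq => ?_⟩
  · have : ∀ j, ContDiff ℝ ∞ (s j) := fun j =>
      Real.smoothTransition.contDiff.comp (by fun_prop)
    exact (this j).sub (this (j + 1))
  · refine sub_nonneg.2 (Real.smoothTransition.monotone ?_)
    rw [hstep]
    gcongr
    linarith
  · by_contra hlt
    apply hq
    simp only [hs, hstep]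
    rw [not_le, lt_abs] at hlt
    rcases hlt with hlt | hlt
    · rw [Real.smoothTransition.one_of_one_le (by rw [le_div_iff₀ hδ]; linarith),
        Real.smoothTransition.one_of_one_le (by rw [le_div_iff₀ hδ]; linarith), sub_self]
    · rw [Real.smoothTransition.zero_of_nonpos (div_nonpos_of_nonpos_of_nonneg (by linarith) hδ.le),
        Real.smoothTransition.zero_of_nonpos (div_nonpos_of_nonpos_of_nonneg (by linarith) hδ.le),
        sub_self]
  · rw [Finset.sum_range_sub']
    have h1 : s 0 q = 1 := Real.smoothTransition.one_of_one_le (by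
      rw [le_div_iff₀ hδ]; simp only [hc]; push_cast; linarith [hq.1])
    have h2 : s N q = 0 := Real.smoothTransition.zero_of_nonpos
      (div_nonpos_of_nonpos_of_nonneg (by simp only [hc]; linarith [hq.2]) hδ.le)
    rw [h1, h2, sub_zero]

end Planar

end

section
open MeasureTheory Set Filter Topology
open scoped ContDiff

namespace Planar

section
variable {l : ℝ} {a Z : ℝ → ℝ → ℝ} {T : (ℝ → ℝ) → ℝ}

lemma Wave.continuous_energy (h : Wave l a Z T) {κ : ℝ → ℝ} (hκ : Continuous κ)
    (hpos : ∀ q, 0 < κ q) : Continuous fun q => a (κ q) q ^ 2 / κ q :=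
  ((h.a_cont.comp (hκ.prodMk continuous_id)).pow 2).div hκ fun q => (hpos q).ne'

lemma Wave.sum_eq (h : Wave l a Z T) {R : ℝ} (hR : 0 < R) {φ : ℝ → ℝ} (hφ : ContDiff ℝ ∞ φ)
    (hs : Function.support φ ⊆ Ioc (-R) R) {N : ℕ} {χ : ℕ → ℝ → ℝ}
    (hχ : ∀ j, ContDiff ℝ ∞ (χ j)) (h1 : ∀ q ∈ Icc (-R) R, ∑ j ∈ Finset.range N, χ j q = 1) :
    ∑ j ∈ Finset.range N, T (fun q => φ q * χ j q) = T φ := by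
  have hsj : ∀ j, (Function.support fun q => φ q * χ j q) ⊆ Ioc (-R) R := fun j =>
    (Function.support_mul_subset_left _ _).trans hs
  have l1 := tendsto_finsetSum (Finset.range N) fun j _ =>
    h.lim (R := R) (hφ.mul (hχ j)) (hsj j)
  refine tendsto_nhds_unique l1 ((h.lim hφ hs).congr' ?_)
  filter_upwards [eventually_gt_atTop 0] with κ hκ
  have hc : Continuous fun q => a κ q ^ 2 / κ :=
    h.continuous_energy (κ := fun _ => κ) continuous_const fun _ => hκ
  rw [← intervalIntegral.integral_finsetSum]
  · refine intervalIntegral.integral_congr fun q hq => ?_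
    rw [uIcc_of_le (by linarith)] at hq
    rw [← Finset.sum_mul, ← Finset.mul_sum, h1 q hq, mul_one]
  · intro j _
    have : Continuous fun q => φ q * χ j q * (a κ q ^ 2 / κ) :=
      (hφ.continuous.mul (hχ j).continuous).mul hc
    exact this.intervalIntegrable _ _

/-- The energy limit persists when the frequency varies continuously with the direction. -/
theorem Wave.tendsto_var (h : Wave l a Z T) {R : ℝ} (hR : 0 < R) {c : ℝ → ℝ} (hc : Continuous c)
    (hpos : ∀ q, 0 < c q) {φ : ℝ → ℝ} (hφ : ContDiff ℝ ∞ φ)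
    (hs : Function.support φ ⊆ Ioc (-R) R) :
    Tendsto (fun t => ∫ q in (-R)..R, φ q * (a (c q * t) q ^ 2 / (c q * t))) atTop
      (𝓝 (T φ)) := by
  have hne : (Icc (-R - 2) (R + 2)).Nonempty := nonempty_Icc.2 (by linarith)
  obtain ⟨q0, -, hmin⟩ := isCompact_Icc.exists_isMinOn hne hc.continuousOn
  obtain ⟨q1, -, hmax⟩ := isCompact_Icc.exists_isMaxOn hne hc.continuousOn
  set cm := c q0
  set cp := c q1
  have hcm : 0 < cm := hpos _
  have hcp : 0 < cp := hpos _
  have hlo : ∀ q ∈ Icc (-R - 2) (R + 2), cm ≤ c q := fun q hq => hmin hq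
  have hhi : ∀ q ∈ Icc (-R - 2) (R + 2), c q ≤ cp := fun q hq => hmax hq
  obtain ⟨M, hM⟩ := isCompact_Icc.exists_bound_of_continuousOn (s := Icc (-R) R)
    hφ.continuous.continuousOn
  have hM0 : 0 ≤ M := (norm_nonneg _).trans (hM 0 ⟨by linarith, by linarith⟩)
  have hl0 : 0 ≤ 80 * l := by
    refine le_trans ?_ (h.energy one_pos (show -R ≤ R by linarith))
    refine intervalIntegral.integral_nonneg (by linarith) fun q _ => by positivity
  set C := M * (27 * (cp / cm) ^ 3 * (160 * l)) with hC
  have hC0 : 0 ≤ C := by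
    have : 0 ≤ 160 * l := by linarith
    positivity
  rw [Metric.tendsto_atTop]
  intro ε hε
  set θ := min 1 (ε / (2 * (C + 1))) with hθ
  have hθ0 : 0 < θ := lt_min one_pos (by positivity)
  have hθ1 : θ ≤ 1 := min_le_left _ _
  have hθC : C * θ < ε := by
    have : θ ≤ ε / (2 * (C + 1)) := min_le_right _ _
    rw [le_div_iff₀ (by positivity)] at this
    nlinarith
  have huc := isCompact_Icc.uniformContinuousOn_of_continuous
    (hc.continuousOn (s := Icc (-R - 2) (R + 2)))
  obtain ⟨δ0, hδ0, hδu⟩ := Metric.uniformContinuousOn_iff.1 huc (θ ^ 2 * cp) (by positivity)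
  set δ := min 1 (δ0 / 4) with hδ
  have hδp : 0 < δ := lt_min one_pos (by positivity)
  have hδ1 : δ ≤ 1 := min_le_left _ _
  have hδ2 : 2 * δ < δ0 := by linarith [min_le_right 1 (δ0 / 4)]
  obtain ⟨N, χ, s, hχ, hχ0, hχs, hχ1⟩ := exists_smooth_partition R hδp
  have hsj : ∀ j, (Function.support fun q => φ q * χ j q) ⊆ Ioc (-R) R := fun j =>
    (Function.support_mul_subset_left _ _).trans hs
  have hlim : Tendsto (fun t : ℝ => ∑ j ∈ Finset.range N, ∫ q in (-R)..R,
      φ q * χ j q * (a (c (s j) * t) q ^ 2 / (c (s j) * t))) atTop (𝓝 (T φ)) := by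
    rw [← h.sum_eq hR hφ hs hχ hχ1]
    exact tendsto_finsetSum _ fun j _ => (h.lim (hφ.mul (hχ j)) (hsj j)).comp
      (tendsto_id.const_mul_atTop (hpos (s j)))
  obtain ⟨t0, ht0⟩ := Metric.tendsto_atTop.1 hlim (ε - C * θ) (by linarith)
  refine ⟨max t0 1, fun t ht => ?_⟩
  have ht0' := ht0 t ((le_max_left _ _).trans ht)
  have htp : 0 < t := one_pos.trans_le ((le_max_right _ _).trans ht)
  have hRR : -R ≤ R := by linarith
  have cA : Continuous fun q => a (c q * t) q ^ 2 / (c q * t) :=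
    h.continuous_energy (κ := fun q => c q * t) (hc.mul continuous_const)
      fun q => mul_pos (hpos q) htp
  have cB : ∀ j, Continuous fun q => a (c (s j) * t) q ^ 2 / (c (s j) * t) := fun j =>
    h.continuous_energy (κ := fun _ => c (s j) * t) continuous_const
      fun q => mul_pos (hpos _) htp
  set G : ℝ → ℝ := fun q => 27 * θ * (cp / cm) ^ 3 *
    (θ ^ 2 * (cp * t) * Z (θ ^ 2 * (cp * t)) q ^ 2 + cm * t * Z (cm * t) q ^ 2) with hG
  have cG1 : Continuous fun q => θ ^ 2 * (cp * t) * Z (θ ^ 2 * (cp * t)) q ^ 2 :=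
    continuous_const.mul ((h.Z_cont _).pow 2)
  have cG2 : Continuous fun q => cm * t * Z (cm * t) q ^ 2 :=
    continuous_const.mul ((h.Z_cont _).pow 2)
  have cG : Continuous G := continuous_const.mul (cG1.add cG2)
  have hGi : ∫ q in (-R)..R, M * G q ≤ C * θ := by
    rw [intervalIntegral.integral_const_mul, hG, intervalIntegral.integral_const_mul,
      intervalIntegral.integral_add (cG1.intervalIntegrable _ _) (cG2.intervalIntegrable _ _)]
    have e1 := h.energy (κ := θ ^ 2 * (cp * t)) (by positivity) hRR
    have e2 := h.energy (κ := cm * t) (by positivity) hRR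
    calc _ ≤ M * (27 * θ * (cp / cm) ^ 3 * (80 * l + 80 * l)) := by gcongr
      _ = _ := by rw [hC]; ring
  have hdiff : |(∫ q in (-R)..R, φ q * (a (c q * t) q ^ 2 / (c q * t))) -
      ∑ j ∈ Finset.range N, ∫ q in (-R)..R,
        φ q * χ j q * (a (c (s j) * t) q ^ 2 / (c (s j) * t))| ≤ C * θ := by
    refine le_trans ?_ hGi
    have cP : ∀ j, Continuous fun q => φ q * χ j q * (a (c (s j) * t) q ^ 2 / (c (s j) * t)) :=
      fun j => (hφ.continuous.mul (hχ j).continuous).mul (cB j)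
    have cQ : Continuous fun q => φ q * (a (c q * t) q ^ 2 / (c q * t)) := hφ.continuous.mul cA
    have cS : Continuous fun q => ∑ j ∈ Finset.range N,
      φ q * χ j q * (a (c (s j) * t) q ^ 2 / (c (s j) * t)) :=
      continuous_finsetSum _ fun j _ => cP j
    rw [← intervalIntegral.integral_finsetSum fun j _ => (cP j).intervalIntegrable _ _,
      ← intervalIntegral.integral_sub (cQ.intervalIntegrable _ _) (cS.intervalIntegrable _ _),
      ← Real.norm_eq_abs]
    refine intervalIntegral.norm_integral_le_of_norm_le hRR (ae_of_all _ fun q hq => ?_)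
      ((continuous_const.mul cG).intervalIntegrable _ _)
    have hq' : q ∈ Icc (-R) R := Ioc_subset_Icc_self hq
    have e : φ q * (a (c q * t) q ^ 2 / (c q * t)) - ∑ j ∈ Finset.range N,
        φ q * χ j q * (a (c (s j) * t) q ^ 2 / (c (s j) * t)) =
        φ q * ∑ j ∈ Finset.range N, χ j q * (a (c q * t) q ^ 2 / (c q * t) -
          a (c (s j) * t) q ^ 2 / (c (s j) * t)) := by
      simp only [mul_sub, Finset.sum_sub_distrib]
      rw [← Finset.sum_mul, hχ1 q hq', one_mul, Finset.mul_sum]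
      simp only [mul_assoc]
    rw [e, norm_mul]
    refine mul_le_mul (hM q hq') ?_ (norm_nonneg _) hM0
    refine (norm_sum_le _ _).trans ?_
    calc _ ≤ ∑ j ∈ Finset.range N, χ j q * G q := Finset.sum_le_sum fun j _ => ?_
      _ = G q := by rw [← Finset.sum_mul, hχ1 q hq', one_mul]
    rw [norm_mul, Real.norm_of_nonneg (hχ0 j q)]
    by_cases h0 : χ j q = 0
    · simp [h0]
    refine mul_le_mul_of_nonneg_left ?_ (hχ0 j q)
    have hjs := hχs j q h0
    have m1 : q ∈ Icc (-R - 2) (R + 2) := ⟨by linarith [hq'.1], by linarith [hq'.2]⟩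
    have m2 : s j ∈ Icc (-R - 2) (R + 2) := by
      have := abs_le.1 hjs
      exact ⟨by linarith [hq'.1], by linarith [hq'.2]⟩
    have hd : |c q * t - c (s j) * t| ≤ θ ^ 2 * (cp * t) := by
      rw [← sub_mul, abs_mul, abs_of_pos htp, ← mul_assoc]
      refine mul_le_mul_of_nonneg_right ?_ htp.le
      exact (hδu q m1 (s j) m2 (by rw [Real.dist_eq]; linarith)).le
    have := h.abs_sub_le (k := cm * t) (K := cp * t) (mul_pos hcm htp)
      (mul_le_mul_of_nonneg_right (hlo q m1) htp.le)
      (mul_le_mul_of_nonneg_right (hlo _ m2) htp.le)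
      (mul_le_mul_of_nonneg_right (hhi q m1) htp.le)
      (mul_le_mul_of_nonneg_right (hhi _ m2) htp.le) hθ0 hθ1 hd q
    rw [mul_div_mul_right _ _ htp.ne'] at this
    rw [Real.norm_eq_abs]
    exact this
  rw [Real.dist_eq] at ht0' ⊢
  have := _root_.abs_sub_le (∫ q in (-R)..R, φ q * (a (c q * t) q ^ 2 / (c q * t)))
    (∑ j ∈ Finset.range N, ∫ q in (-R)..R,
        φ q * χ j q * (a (c (s j) * t) q ^ 2 / (c (s j) * t))) (T φ)
  linarith

end

end Planar

end

section
open MeasureTheory Set Filter Topology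
open scoped ContDiff

namespace Planar

section
variable {l : ℝ}

lemma Wave.integral_mass_le {a Z : ℝ → ℝ → ℝ} {T : (ℝ → ℝ) → ℝ} (h : Wave l a Z T) {R k : ℝ}
    (hR : 0 < R) (hk : 0 < k) : ∫ q in (-R)..R, Z k q ≤ (R + 40 * l) / √k := by
  have hs : 0 < √k := Real.sqrt_pos.2 hk
  have hsq : √k ^ 2 = k := Real.sq_sqrt hk.le
  have hRR : -R ≤ R := by linarith
  have cZ := h.Z_cont k
  have cQ : Continuous fun q => k * Z k q ^ 2 := continuous_const.mul (cZ.pow 2)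
  have c1 : Continuous fun q => (1 + k * Z k q ^ 2) / (2 * √k) :=
    (continuous_const.add cQ).div_const _
  have h1 : ∫ q in (-R)..R, Z k q ≤ ∫ q in (-R)..R, (1 + k * Z k q ^ 2) / (2 * √k) := by
    refine intervalIntegral.integral_mono_on hRR (cZ.intervalIntegrable _ _)
      (c1.intervalIntegrable _ _) fun q _ => ?_
    rw [le_div_iff₀ (by positivity)]
    nlinarith [sq_nonneg (√k * Z k q - 1)]
  refine h1.trans ?_
  rw [intervalIntegral.integral_div, intervalIntegral.integral_add (by simp)
    (cQ.intervalIntegrable _ _), div_le_div_iff₀ (by positivity) hs]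
  have := h.energy hk hRR
  rw [intervalIntegral.integral_const, smul_eq_mul]
  nlinarith

/-- If a signed sum of squared amplitudes is small compared with the amplitudes themselves along
a sequence of frequencies, then the corresponding combination of limits vanishes. -/
theorem Wave.transfer {ι : Type*} [Fintype ι] {a Z : ι → ℝ → ℝ → ℝ} {T : ι → (ℝ → ℝ) → ℝ}
    (h : ∀ i, Wave l (a i) (Z i) (T i)) (σ : ι → ℝ) {R : ℝ} (hR : 0 < R) {c : ℝ → ℝ}
    (hc : Continuous c) (hpos : ∀ q, 0 < c q) {φ : ℝ → ℝ} (hφ : ContDiff ℝ ∞ φ)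
    (hs : Function.support φ ⊆ Ioc (-R) R) {E : ℕ → ℝ} (hE0 : ∀ m, 0 ≤ E m)
    (hE : Tendsto (fun m : ℕ => E m / √m) atTop (𝓝 0))
    (hfr : ∃ᶠ m : ℕ in atTop, ∀ q ∈ Icc (-R) R,
      |∑ i, σ i * a i (c q * m) q ^ 2| ≤ E m * ∑ i, a i (c q * m) q) :
    ∑ i, σ i * T i φ = 0 := by
  have hRR : -R ≤ R := by linarith
  have hne : (Icc (-R) R).Nonempty := nonempty_Icc.2 hRR
  obtain ⟨q0, -, hmin⟩ := isCompact_Icc.exists_isMinOn hne hc.continuousOn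
  set cm := c q0
  have hcm : 0 < cm := hpos _
  have hlo : ∀ q ∈ Icc (-R) R, cm ≤ c q := fun q hq => hmin hq
  obtain ⟨M, hM⟩ := isCompact_Icc.exists_bound_of_continuousOn (s := Icc (-R) R)
    hφ.continuous.continuousOn
  have hM0 : 0 ≤ M := (norm_nonneg _).trans (hM 0 ⟨by linarith, by linarith⟩)
  set S : ℕ → ℝ := fun m => ∑ i, σ i *
    ∫ q in (-R)..R, φ q * (a i (c q * m) q ^ 2 / (c q * m)) with hS
  have hlim : Tendsto S atTop (𝓝 (∑ i, σ i * T i φ)) :=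
    tendsto_finsetSum _ fun i _ => (((h i).tendsto_var hR hc hpos hφ hs).comp
      tendsto_natCast_atTop_atTop).const_mul _
  set D : ℝ := M * (Fintype.card ι * (3 * (R + 40 * l))) / √cm with hD
  have hbd : ∀ m : ℕ, 1 ≤ m → (∀ q ∈ Icc (-R) R,
      |∑ i, σ i * a i (c q * m) q ^ 2| ≤ E m * ∑ i, a i (c q * m) q) →
      |S m| ≤ D * (E m / √m) := by
    intro m hm hq
    have hm0 : (0 : ℝ) < m := by exact_mod_cast hm
    have hk : 0 < cm * m := mul_pos hcm hm0
    have cA : ∀ i, Continuous fun q => a i (c q * m) q ^ 2 / (c q * m) := fun i =>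
      (h i).continuous_energy (κ := fun q => c q * m) (hc.mul continuous_const)
        fun q => mul_pos (hpos q) hm0
    have cP : ∀ i, Continuous fun q => σ i * (φ q * (a i (c q * m) q ^ 2 / (c q * m))) :=
      fun i => continuous_const.mul (hφ.continuous.mul (cA i))
    have cZ : Continuous fun q => M * (E m * ∑ i, 3 * Z i (cm * m) q) :=
      continuous_const.mul (continuous_const.mul (continuous_finsetSum _ fun i _ =>
        continuous_const.mul ((h i).Z_cont _)))
    have e : S m = ∫ q in (-R)..R, ∑ i, σ i * (φ q * (a i (c q * m) q ^ 2 / (c q * m))) := by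
      rw [intervalIntegral.integral_finsetSum fun i _ => (cP i).intervalIntegrable _ _]
      simp only [hS, intervalIntegral.integral_const_mul]
    have h1 : |S m| ≤ ∫ q in (-R)..R, M * (E m * ∑ i, 3 * Z i (cm * m) q) := by
      rw [e, ← Real.norm_eq_abs]
      refine intervalIntegral.norm_integral_le_of_norm_le hRR (ae_of_all _ fun q hq' => ?_)
        (cZ.intervalIntegrable _ _)
      have hqI : q ∈ Icc (-R) R := Ioc_subset_Icc_self hq'
      have hκ : 0 < c q * m := mul_pos (hpos q) hm0
      have e2 : ∑ i, σ i * (φ q * (a i (c q * m) q ^ 2 / (c q * m))) =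
          φ q * ((∑ i, σ i * a i (c q * m) q ^ 2) / (c q * m)) := by
        rw [Finset.sum_div, Finset.mul_sum]
        exact Finset.sum_congr rfl fun i _ => by ring
      rw [e2, norm_mul]
      refine mul_le_mul (hM q hqI) ?_ (norm_nonneg _) hM0
      rw [Real.norm_eq_abs, abs_div, abs_of_pos hκ, div_le_iff₀ hκ]
      refine (hq q hqI).trans ?_
      rw [mul_assoc]
      refine mul_le_mul_of_nonneg_left ?_ (hE0 m)
      rw [Finset.sum_mul]
      refine Finset.sum_le_sum fun i _ => ((h i).le hκ.le q).trans ?_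
      have := (h i).anti q (mul_le_mul_of_nonneg_right (hlo q hqI) hm0.le)
      calc 3 * (c q * m) * Z i (c q * m) q ≤ 3 * (c q * m) * Z i (cm * m) q := by gcongr
        _ = _ := by ring
    refine h1.trans ?_
    have cZi : ∀ i, Continuous fun q => 3 * Z i (cm * m) q := fun i =>
      continuous_const.mul ((h i).Z_cont _)
    rw [intervalIntegral.integral_const_mul, intervalIntegral.integral_const_mul,
      intervalIntegral.integral_finsetSum fun i _ => (cZi i).intervalIntegrable _ _]
    simp only [intervalIntegral.integral_const_mul]
    calc M * (E m * ∑ i, 3 * ∫ q in (-R)..R, Z i (cm * m) q)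
        ≤ M * (E m * ∑ _i : ι, 3 * ((R + 40 * l) / √(cm * m))) := by
          have := hE0 m
          gcongr with i
          exact (h i).integral_mass_le hR hk
      _ = D * (E m / √m) := by
          rw [Finset.sum_const, Finset.card_univ, nsmul_eq_mul, Real.sqrt_mul hcm.le, hD]
          field_simp
  by_contra hne0
  have hpos' : 0 < |∑ i, σ i * T i φ| / 2 := by positivity
  have ev1 : ∀ᶠ m in atTop, |∑ i, σ i * T i φ| / 2 < |S m| :=
    hlim.abs.eventually_const_lt (by linarith)
  have ev2 : ∀ᶠ m : ℕ in atTop, D * (E m / √m) < |∑ i, σ i * T i φ| / 2 := by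
    have := hE.const_mul D
    rw [mul_zero] at this
    exact this.eventually_lt_const hpos'
  obtain ⟨m, hm, h1, h2, h3⟩ := (hfr.and_eventually
    (ev1.and (ev2.and (eventually_ge_atTop 1)))).exists
  linarith [hbd m h3 hm]

end

/-- The integral of a test function against the slope distribution of a graph. -/
noncomputable def slopeInt (l : ℝ) (f : ℝ → ℝ) (φ : ℝ → ℝ) : ℝ :=
  ∫ x in (0 : ℝ)..l, 2 * Real.pi * φ (deriv f x)

section
variable {l : ℝ} {f : ℝ → ℝ}

lemma exists_depth_dep (hl : 0 ≤ l) (hf : Continuous f) (hconc : ConcaveOn ℝ (Icc 0 l) f) (q : ℝ) :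
    ∃ B, 0 < B ∧ Depth l B (dep l f q) := by
  have hc := continuous_dep l hf q
  obtain ⟨B, hB⟩ := isCompact_Icc.exists_bound_of_continuousOn (s := Icc 0 l) hc.continuousOn
  refine ⟨max B 1, by positivity, hc, convexOn_dep hconc q, fun x hx => dep_nonneg hf q hx,
    fun x hx => ?_, dep_zero hl hf q⟩
  exact (le_abs_self _).trans ((hB x hx).trans (le_max_left _ _))

lemma continuous_amp_dep (hl : 0 ≤ l) (hf : Continuous f) :
    Continuous (Function.uncurry fun κ q => amp l (dep l f q) κ) := by
  have := continuous_dep_uncurry hl hf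
  unfold amp depthInt Function.uncurry
  have h2 : Continuous fun p : ℝ × ℝ => ∫ x in (0 : ℝ)..l,
      Complex.exp (-(p.1 * Complex.I) * dep l f p.2 x) := by
    refine intervalIntegral.continuous_parametric_intervalIntegral_of_continuous' ?_ 0 l
    have h3 : Continuous fun p : (ℝ × ℝ) × ℝ => dep l f p.1.2 p.2 :=
      this.comp (by fun_prop : Continuous fun p : (ℝ × ℝ) × ℝ => (p.1.2, p.2))
    unfold Function.uncurry
    fun_prop
  fun_prop

lemma tendsto_interval_amp_sq (hl : 0 ≤ l) (hf : Continuous f) (hconc : ConcaveOn ℝ (Icc 0 l) f)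
    {R : ℝ} {φ : ℝ → ℝ} (hφ : ContDiff ℝ ∞ φ) (hs : Function.support φ ⊆ Ioc (-R) R) :
    Tendsto (fun κ => ∫ q in (-R)..R, φ q * (amp l (dep l f q) κ ^ 2 / κ)) atTop
      (𝓝 (slopeInt l f φ)) := by
  have hcs : HasCompactSupport fun q => (φ q : ℂ) :=
    HasCompactSupport.of_support_subset_isCompact (isCompact_Icc (a := -R) (b := R))
      (fun q hq => Ioc_subset_Icc_self (hs (by
        rw [Function.mem_support] at hq ⊢
        exact_mod_cast hq)))
  have hsm : ContDiff ℝ ∞ fun q => (φ q : ℂ) := Complex.ofRealCLM.contDiff.comp hφ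
  have key := tendsto_integral_amp_sq hl hf hconc (hcs.toSchwartzMap hsm)
  have k2 := (Complex.continuous_re.tendsto _).comp key
  convert k2 using 1
  · funext κ
    have : ∀ q, (hcs.toSchwartzMap hsm) q * ((amp l (dep l f q) κ ^ 2 / κ : ℝ) : ℂ) =
        ((φ q * (amp l (dep l f q) κ ^ 2 / κ) : ℝ) : ℂ) := fun q => by
      push_cast; rfl
    simp only [Function.comp, this]
    rw [integral_complex_ofReal, Complex.ofReal_re]
    refine intervalIntegral.integral_eq_integral_of_support_subset ?_
    exact (Function.support_mul_subset_left _ _).trans hs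
  · congr 1
    have : ∀ x, (2 * Real.pi * (hcs.toSchwartzMap hsm) (deriv f x) : ℂ) =
        ((2 * Real.pi * φ (deriv f x) : ℝ) : ℂ) := fun x => by
      push_cast; rfl
    simp only [this]
    rw [intervalIntegral.integral_ofReal, Complex.ofReal_re, slopeInt]

lemma wave_top (hl : 0 < l) (hf : Continuous f) (hconc : ConcaveOn ℝ (Icc 0 l) f) :
    Wave l (fun κ q => amp l (dep l f q) κ) (fun κ q => depthMass l (dep l f q) κ)
      (slopeInt l f) where
  a_cont := continuous_amp_dep hl.le hf
  Z_cont κ := continuous_depthMass hl.le hf κ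
  a_nonneg _ _ := amp_nonneg _ _ _
  Z_nonneg κ q := (depthMass_pos hl (continuous_dep l hf q) κ).le
  anti q h := depthMass_antitone hl.le (continuous_dep l hf q) (fun _ hx => dep_nonneg hf q hx) h
  a_zero q := by simp [amp]
  lip {κ κ' ρ} q h := by
    obtain ⟨B, hB, hD⟩ := exists_depth_dep hl.le hf hconc q
    exact (abs_norm_sub_norm_le _ _).trans (hD.wave_sub_le hB κ κ' h)
  energy hκ hab := integral_depthMass_sq_le hl hf hκ hab
  lim hφ hs := tendsto_interval_amp_sq hl.le hf hconc hφ hs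

lemma wave_bot {b : ℝ → ℝ} (hl : 0 < l) (hb : Continuous b) (hconv : ConvexOn ℝ (Icc 0 l) b) :
    Wave l (fun κ q => amp l (dep l (fun x => -b x) (-q)) κ)
      (fun κ q => depthMass l (dep l (fun x => -b x) (-q)) κ) (slopeInt l b) := by
  have h := wave_top hl hb.neg hconv.neg
  exact
  { a_cont := h.a_cont.comp (by fun_prop : Continuous fun p : ℝ × ℝ => (p.1, -p.2))
    Z_cont := fun κ => (h.Z_cont κ).comp continuous_neg
    a_nonneg := fun κ q => h.a_nonneg κ (-q)
    Z_nonneg := fun κ q => h.Z_nonneg κ (-q)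
    anti := fun q hk => h.anti (-q) hk
    a_zero := fun q => h.a_zero (-q)
    lip := fun q hk => h.lip (-q) hk
    energy := fun {κ A B} hκ hab => by
      have := h.energy (A := -B) (B := -A) hκ (by linarith)
      rwa [← intervalIntegral.integral_comp_neg] at this
    lim := fun {R φ} hφ hs => by
      obtain ⟨R', hR'⟩ : ∃ R', R' = R + 1 := ⟨_, rfl⟩
      have hs' : (Function.support fun q => φ (-q)) ⊆ Ioc (-R') R' := fun q hq => by
        have := hs (show -q ∈ Function.support φ from hq)
        exact ⟨by linarith [this.2], by linarith [this.1]⟩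
      have hs2 : Function.support φ ⊆ Ioc (-R') R' := fun q hq => by
        have := hs hq
        exact ⟨by linarith [this.1], by linarith [this.2]⟩
      have key := h.lim (R := R') (φ := fun q => φ (-q)) (hφ.comp contDiff_neg) hs'
      have e : slopeInt l (fun x => -b x) (fun q => φ (-q)) = slopeInt l b φ := by
        simp [slopeInt]
      change Tendsto _ _ (𝓝 (slopeInt l (fun x => -b x) (fun q => φ (-q)))) at key
      rw [e] at key
      refine key.congr fun κ => ?_
      have e1 := intervalIntegral.integral_comp_neg (a := -R') (b := R') fun q =>
        φ q * (amp l (dep l (fun x => -b x) (-q)) κ ^ 2 / κ)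
      simp only [neg_neg] at e1
      refine e1.trans ?_
      rw [intervalIntegral.integral_eq_integral_of_support_subset
          ((Function.support_mul_subset_left _ _).trans hs2),
        intervalIntegral.integral_eq_integral_of_support_subset
          ((Function.support_mul_subset_left _ _).trans hs)] }

end

end Planar

end

section
open MeasureTheory Set Filter Topology
open scoped ContDiff

namespace Planar

lemma tendsto_sqrt_sqrt_div (D : ℝ) (hD : 0 ≤ D) :
    Tendsto (fun m : ℕ => √√(D * m) / √m) atTop (𝓝 0) := by
  have h1 : Tendsto (fun m : ℕ => √√(D / m)) atTop (𝓝 0) := by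
    have := ((Real.continuous_sqrt.comp Real.continuous_sqrt).tendsto 0).comp
      (tendsto_const_div_atTop_nhds_zero_nat D)
    simpa only [Function.comp_def, Real.sqrt_zero] using this
  refine h1.congr' ?_
  filter_upwards [eventually_gt_atTop 0] with m hm
  have hm' : (0 : ℝ) < m := by exact_mod_cast hm
  have e : D / m = D * m / (m : ℝ) ^ 2 := by field_simp
  rw [e, Real.sqrt_div (by positivity), Real.sqrt_sq hm'.le, Real.sqrt_div (by positivity)]

section
variable {l : ℝ} {f b g c : ℝ → ℝ}

lemma GraphBody.exists_width_lower (h : GraphBody l f b) (R : ℝ) :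
    ∃ w, 0 < w ∧ ∀ q ∈ Icc (-R) R, w ≤ width l f b q := by
  rcases (Icc (-R) R).eq_empty_or_nonempty with he | hne
  · exact ⟨1, one_pos, by simp [he]⟩
  obtain ⟨q0, -, hmin⟩ := isCompact_Icc.exists_isMinOn hne h.continuous_width.continuousOn
  exact ⟨_, h.width_pos q0, fun q hq => hmin hq⟩

lemma cexp_period (m : ℕ) {W : ℝ} (hW : 0 < W) :
    Complex.exp ((2 * Real.pi / W * m : ℝ) * Complex.I * W) = 1 := by
  rw [Complex.exp_eq_one_iff]
  refine ⟨m, ?_⟩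
  have : (W : ℂ) ≠ 0 := by exact_mod_cast hW.ne'
  push_cast
  field_simp

/-- The sum of the two slope distributions is determined by the covariogram. -/
theorem Homometric.slopeInt_add (h : Homometric l f b g c) {R : ℝ} (hR : 0 < R) {φ : ℝ → ℝ}
    (hφ : ContDiff ℝ ∞ φ) (hs : Function.support φ ⊆ Ioc (-R) R) :
    slopeInt l f φ + slopeInt l b φ = slopeInt l g φ + slopeInt l c φ := by
  have hl := h.left.l_pos
  obtain ⟨w, hw, hwq⟩ := h.left.exists_width_lower R
  have cW : Continuous fun q => 2 * Real.pi / width l f b q :=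
    continuous_const.div h.left.continuous_width fun q => (h.left.width_pos q).ne'
  have key := Wave.transfer (ι := Fin 4)
    (a := ![fun κ q => amp l (dep l f q) κ, fun κ q => amp l (dep l (fun x => -b x) (-q)) κ,
      fun κ q => amp l (dep l g q) κ, fun κ q => amp l (dep l (fun x => -c x) (-q)) κ])
    (Z := ![fun κ q => depthMass l (dep l f q) κ,
      fun κ q => depthMass l (dep l (fun x => -b x) (-q)) κ,
      fun κ q => depthMass l (dep l g q) κ, fun κ q => depthMass l (dep l (fun x => -c x) (-q)) κ])
    (T := ![slopeInt l f, slopeInt l b, slopeInt l g, slopeInt l c])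
    (by
      intro i
      fin_cases i
      · exact wave_top hl h.left.f_cont h.left.f_conc
      · exact wave_bot hl h.left.b_cont h.left.b_conv
      · exact wave_top hl h.right.f_cont h.right.f_conc
      · exact wave_bot hl h.right.b_cont h.right.b_conv)
    ![1, 1, -1, -1] hR cW (fun q => div_pos (by positivity) (h.left.width_pos q)) hφ hs
    (E := fun _ => 2 * Real.pi * l / w) (fun _ => by positivity)
    (by
      simpa using (tendsto_natCast_atTop_atTop.comp tendsto_id |>
        fun ht => Tendsto.const_div_atTop (Real.tendsto_sqrt_atTop.comp ht)
          (2 * Real.pi * l / w)))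
    (Eventually.frequently (Eventually.of_forall fun m q hq => by
      have hW := h.left.width_pos q
      have hslab := h.right.slab q
      rw [← h.width_eq q] at hslab
      have := (h.left.slab q).amp_sq_sum_sub_le hslab (cexp_period m hW) (fun t => by
        have := h.norm_tiltA_eq q t
        simp only [tiltA] at this
        rwa [← h.width_eq q] at this)
      simp only [Fin.sum_univ_four, Matrix.cons_val]
      refine le_trans (le_of_eq ?_) (this.trans ?_)
      · congr 1; ring
      · have n1 := amp_nonneg l (dep l f q) (2 * Real.pi / width l f b q * m)
        have n2 := amp_nonneg l (dep l (fun x => -b x) (-q)) (2 * Real.pi / width l f b q * m)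
        have n3 := amp_nonneg l (dep l g q) (2 * Real.pi / width l f b q * m)
        have n4 := amp_nonneg l (dep l (fun x => -c x) (-q)) (2 * Real.pi / width l f b q * m)
        refine mul_le_mul ?_ (by linarith) (by positivity) (by positivity)
        exact div_le_div_of_nonneg_left (by positivity) hw (hwq q hq)))
  simp only [Fin.sum_univ_four, Matrix.cons_val] at key
  linarith

/-- If the bodies share zeros in infinitely many strips, their top slope distributions agree. -/
theorem Homometric.slopeInt_eq_of_commonZeros (h : Homometric l f b g c)
    (hz : CommonZeros l f b g c) {R : ℝ} (hR : 0 < R) {φ : ℝ → ℝ}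
    (hφ : ContDiff ℝ ∞ φ) (hs : Function.support φ ⊆ Ioc (-R) R) :
    slopeInt l f φ = slopeInt l g φ ∧ slopeInt l b φ = slopeInt l c φ := by
  have hl := h.left.l_pos
  obtain ⟨w, hw, hwq⟩ := h.left.exists_width_lower R
  have cW : Continuous fun q => 2 * Real.pi / width l f b q :=
    continuous_const.div h.left.continuous_width fun q => (h.left.width_pos q).ne'
  have hγ : 0 < gapConst l (fun x => f x - b x) :=
    gapConst_pos hl (h.left.f_cont.sub h.left.b_cont) fun x hx => sub_pos.2 (h.left.lt x hx)
  set γ := gapConst l (fun x => f x - b x)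
  set D := 1 + 2 * (48 * l / (γ * w ^ 3) * (2 * Real.pi / w)) with hD
  have hD0 : 0 ≤ D := by positivity
  set E : ℕ → ℝ := fun m => 6 * l * (√√(D * m) + 2 * Real.pi / w) with hE
  have key := Wave.transfer (ι := Fin 4)
    (a := ![fun κ q => amp l (dep l f q) κ, fun κ q => amp l (dep l (fun x => -b x) (-q)) κ,
      fun κ q => amp l (dep l g q) κ, fun κ q => amp l (dep l (fun x => -c x) (-q)) κ])
    (Z := ![fun κ q => depthMass l (dep l f q) κ,
      fun κ q => depthMass l (dep l (fun x => -b x) (-q)) κ,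
      fun κ q => depthMass l (dep l g q) κ, fun κ q => depthMass l (dep l (fun x => -c x) (-q)) κ])
    (T := ![slopeInt l f, slopeInt l b, slopeInt l g, slopeInt l c])
    (by
      intro i
      fin_cases i
      · exact wave_top hl h.left.f_cont h.left.f_conc
      · exact wave_bot hl h.left.b_cont h.left.b_conv
      · exact wave_top hl h.right.f_cont h.right.f_conc
      · exact wave_bot hl h.right.b_cont h.right.b_conv)
    ![1, 0, -1, 0] hR cW (fun q => div_pos (by positivity) (h.left.width_pos q)) hφ hs
    (E := E) (fun _ => by positivity)
    (by
      have t1 := (tendsto_sqrt_sqrt_div D hD0).const_mul (6 * l)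
      have t2 : Tendsto (fun m : ℕ => 6 * l * (2 * Real.pi / w) / √(m : ℝ)) atTop (𝓝 0) :=
        Tendsto.const_div_atTop (Real.tendsto_sqrt_atTop.comp tendsto_natCast_atTop_atTop) _
      have := t1.add t2
      simp only [mul_zero, add_zero] at this
      refine this.congr fun m => ?_
      simp only [hE]
      ring)
    ((hz.and_eventually (eventually_ge_atTop 1)).mono fun m hm q hq => by
      obtain ⟨hm, hm1⟩ := hm
      have hm1' : (1 : ℝ) ≤ m := by exact_mod_cast hm1
      obtain ⟨p, hp, hA, hA'⟩ := hm q
      have hW := h.left.width_pos q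
      have hwW := hwq q hq
      have hslab := h.right.slab q
      rw [← h.width_eq q] at hslab
      simp only [tiltA] at hA hA'
      rw [← h.width_eq q] at hA'
      have hre := (h.left.slab q).zero_re_pow_le hA
      have egap : (fun x => width l f b q - dep l f q x - dep l (fun x => -b x) (-q) x) =
          fun x => f x - b x := by
        funext x
        rw [width_eq_add q x]; ring
      rw [egap] at hre
      have hpi := Real.pi_pos
      have him0 : 0 ≤ p.im := by
        have : 0 ≤ m * (2 * Real.pi) / width l f b q := by positivity
        linarith [hp.1]
      have him : |p.im| ≤ 2 * m * (2 * Real.pi / w) := by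
        rw [abs_of_nonneg him0]
        calc p.im ≤ (m + 1) * (2 * Real.pi) / width l f b q := hp.2.le
          _ = (m + 1) * (2 * Real.pi / width l f b q) := by ring
          _ ≤ 2 * m * (2 * Real.pi / w) := by gcongr; linarith
      have hre2 : |p.re| ≤ √√(D * m) := by
        refine Real.le_sqrt_of_sq_le (Real.le_sqrt_of_sq_le ?_)
        rw [← pow_mul]
        refine hre.trans ?_
        calc 1 + 48 * l / (γ * width l f b q ^ 3) * |p.im|
            ≤ 1 * m + 48 * l / (γ * w ^ 3) * (2 * m * (2 * Real.pi / w)) := by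
              gcongr; linarith
          _ = D * m := by rw [hD]; ring
      have := ((h.left.slab q).amp_sq_sub_le hslab (cexp_period m hW) (fun t => by
        have := h.norm_tiltA_eq q t
        simp only [tiltA] at this
        rwa [← h.width_eq q] at this) (p := p) (by
          refine ⟨lt_of_eq_of_lt ?_ hp.1, hp.2.trans_eq ?_⟩ <;> ring) hA hA').1
      simp only [Fin.sum_univ_four, Matrix.cons_val]
      refine le_trans (le_of_eq ?_) (this.trans ?_)
      · congr 1; ring
      · have n1 := amp_nonneg l (dep l f q) (2 * Real.pi / width l f b q * m)
        have n2 := amp_nonneg l (dep l (fun x => -b x) (-q)) (2 * Real.pi / width l f b q * m)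
        have n3 := amp_nonneg l (dep l g q) (2 * Real.pi / width l f b q * m)
        have n4 := amp_nonneg l (dep l (fun x => -c x) (-q)) (2 * Real.pi / width l f b q * m)
        refine mul_le_mul ?_ (by linarith) (by positivity) (by positivity)
        simp only [hE]
        gcongr)
  simp only [Fin.sum_univ_four, Matrix.cons_val] at key
  have := h.slopeInt_add hR hφ hs
  constructor <;> linarith

end

end Planar

end

section
open MeasureTheory Set Filter Topology

namespace Planar

lemma integral_nonneg_of_odd {θ : ℝ → ℝ} (hθ : Continuous θ) {P : ℝ}
    (hodd : ∀ c, θ (P - c) = -θ c) (h0 : ∀ c ∈ Icc 0 (P / 2), 0 ≤ θ c) {c : ℝ} (hc : c ∈ Icc 0 P) :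
    0 ≤ ∫ t in (0 : ℝ)..c, θ t := by
  have key : ∀ c ∈ Icc 0 (P / 2), 0 ≤ ∫ t in (0 : ℝ)..c, θ t := fun c hc =>
    intervalIntegral.integral_nonneg hc.1 fun t ht => h0 t ⟨ht.1, ht.2.trans hc.2⟩
  by_cases h : c ≤ P / 2
  · exact key c ⟨hc.1, h⟩
  · push Not at h
    have h1 := key (P - c) ⟨by linarith [hc.2], by linarith⟩
    have h2 : ∫ t in (P - c)..c, θ t = 0 := by
      have := intervalIntegral.integral_comp_sub_left (a := P - c) (b := c) θ P
      simp only [hodd, sub_sub_cancel, intervalIntegral.integral_neg] at this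
      linarith
    rw [← intervalIntegral.integral_add_adjacent_intervals (hθ.intervalIntegrable 0 (P - c))
      (hθ.intervalIntegrable _ _), h2]
    linarith

section
variable {L : ℝ} {D : ℝ → ℝ}

lemma integral_comp_nonneg_of_odd (hL : 0 ≤ L) {P : ℝ} (hP : 0 < P) (hD : Continuous D)
    (hconv : ConvexOn ℝ (Icc 0 L) D) (h0 : D 0 = 0) (hnn : ∀ x ∈ Icc 0 L, 0 ≤ D x)
    (hDP : D L ≤ P) {θ : ℝ → ℝ} (hθ : Continuous θ) (hodd : ∀ c, θ (P - c) = -θ c)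
    (hθ0 : ∀ c ∈ Icc 0 (P / 2), 0 ≤ θ c) : 0 ≤ ∫ x in (0 : ℝ)..L, θ (D x) := by
  have hm := convexOn_monotoneOn hconv h0 hnn
  refine integral_comp_nonneg_one_sided (X := fun c => ∫ t in (0 : ℝ)..c, θ t) hL hP hD hconv h0 hnn
    (fun x hx => (hm hx (right_mem_Icc.2 hL) hx.2).trans hDP)
    (fun c => intervalIntegral.integral_hasDerivAt_right (hθ.intervalIntegrable _ _)
      (hθ.stronglyMeasurableAtFilter _ _) hθ.continuousAt) hθ (by simp)
    fun c hc => integral_nonneg_of_odd hθ hodd hθ0 hc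

lemma tendsto_clamp_sign (s : ℝ) :
    Tendsto (fun n : ℕ => max (-1) (min 1 (n * s))) atTop (𝓝 (Real.sign s)) := by
  rcases lt_trichotomy s 0 with h | h | h
  · rw [Real.sign_of_neg h]
    refine tendsto_const_nhds.congr' ?_
    filter_upwards [(tendsto_natCast_atTop_atTop.atTop_mul_const_of_neg h).eventually_le_atBot (-1)]
      with n hn
    rw [min_eq_right (by linarith), max_eq_left hn]
  · simp [h]
  · rw [Real.sign_of_pos h]
    refine tendsto_const_nhds.congr' ?_
    filter_upwards [(tendsto_natCast_atTop_atTop.atTop_mul_const h).eventually_ge_atTop 1]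
      with n hn
    rw [min_eq_left hn, max_eq_right (by norm_num)]

lemma integral_sign_sin_eq_zero (hL : 0 ≤ L) (hD : Continuous D)
    (hconv : ConvexOn ℝ (Icc 0 L) D) (h0 : D 0 = 0) (hnn : ∀ x ∈ Icc 0 L, 0 ≤ D x)
    (hDP : D L ≤ 2 * Real.pi) (hsin : ∫ x in (0 : ℝ)..L, Real.sin (D x) = 0) :
    ∫ x in (0 : ℝ)..L, Real.sign (Real.sin (D x)) = 0 := by
  set θ : ℕ → ℝ → ℝ := fun n c => max (-1) (min 1 (n * Real.sin c)) with hθ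
  have hθc : ∀ n, Continuous (θ n) := fun n => by fun_prop
  have hpi := Real.pi_pos
  have hs : ∀ c ∈ Icc 0 (2 * Real.pi / 2), 0 ≤ Real.sin c := fun c hc =>
    Real.sin_nonneg_of_nonneg_of_le_pi hc.1 (by linarith [hc.2])
  have hodd : ∀ n c, θ n (2 * Real.pi - c) = -θ n c := fun n c => by
    simp only [hθ, Real.sin_two_pi_sub, mul_neg]
    simp only [max_def, min_def]
    split_ifs <;> linarith
  have hz : ∀ n, ∫ x in (0 : ℝ)..L, θ n (D x) = 0 := fun n => by
    have h1 := integral_comp_nonneg_of_odd hL (by positivity) hD hconv h0 hnn hDP (hθc n) (hodd n)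
      fun c hc => by
        have := hs c hc
        exact le_max_of_le_right (le_min zero_le_one (by positivity))
    have h2 := integral_comp_nonneg_of_odd (θ := fun c => n * Real.sin c - θ n c) hL (by positivity)
      hD hconv h0 hnn hDP ((continuous_const.mul Real.continuous_sin).sub (hθc n)) (fun c => by
        simp only [hodd, Real.sin_two_pi_sub]; ring) fun c hc => by
        have : 0 ≤ n * Real.sin c := by
          have := hs c hc
          positivity
        exact sub_nonneg.2 (max_le (by linarith) (min_le_right _ _))
    have c1 : Continuous fun x => n * Real.sin (D x) := by fun_prop
    have c2 : Continuous fun x => θ n (D x) := (hθc n).comp hD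
    rw [intervalIntegral.integral_sub (c1.intervalIntegrable _ _) (c2.intervalIntegrable _ _),
      intervalIntegral.integral_const_mul, hsin] at h2
    linarith
  have ht : Tendsto (fun n => ∫ x in (0 : ℝ)..L, θ n (D x)) atTop
      (𝓝 (∫ x in (0 : ℝ)..L, Real.sign (Real.sin (D x)))) := by
    refine intervalIntegral.tendsto_integral_filter_of_dominated_convergence (fun _ => 1)
      (Eventually.of_forall fun n => ((hθc n).comp hD).aestronglyMeasurable)
      (Eventually.of_forall fun n => ae_of_all _ fun x _ => ?_) (by simp)
      (ae_of_all _ fun x _ => tendsto_clamp_sign _)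
    rw [Real.norm_eq_abs, abs_le]
    exact ⟨le_max_left _ _, max_le (by norm_num) (min_le_left _ _)⟩
  simp only [hz] at ht
  exact (tendsto_nhds_unique ht tendsto_const_nhds)

lemma integral_eq_sub_of_eqOn_Ioo {g : ℝ → ℝ} {a b v : ℝ} (hab : a ≤ b)
    (h : ∀ x ∈ Ioo a b, g x = v) : ∫ x in a..b, g x = (b - a) * v ∧
      IntervalIntegrable g volume a b := by
  have hae : ∀ᵐ x ∂volume, x ∈ uIoc a b → g x = v := by
    filter_upwards [compl_mem_ae_iff.2 (measure_singleton b)] with x hx hxm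
    rw [uIoc_of_le hab] at hxm
    exact h x ⟨hxm.1, hxm.2.lt_of_ne hx⟩
  refine ⟨?_, ?_⟩
  · rw [intervalIntegral.integral_congr_ae hae, intervalIntegral.integral_const, smul_eq_mul]
  · refine (intervalIntegrable_const (c := v)).congr_ae ?_
    rw [Filter.EventuallyEq, ae_restrict_iff' measurableSet_uIoc]
    filter_upwards [hae] with x hx hm using (hx hm).symm

/-- A convex profile staying within one period on which `sin` integrates to zero is affine. -/
lemma affine_of_integral_sin_eq_zero (hL : 0 < L) (hD : Continuous D)
    (hconv : ConvexOn ℝ (Icc 0 L) D) (h0 : D 0 = 0) (hpos : ∀ x ∈ Ioc 0 L, 0 < D x)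
    (hDP : D L ≤ 2 * Real.pi) (hsin : ∫ x in (0 : ℝ)..L, Real.sin (D x) = 0) :
    ∀ x ∈ Icc 0 L, D x = 2 * Real.pi / L * x := by
  have hpi := Real.pi_pos
  have hnn : ∀ x ∈ Icc 0 L, 0 ≤ D x := fun x hx => by
    rcases hx.1.eq_or_lt with h | h
    · rw [← h, h0]
    · exact (hpos x ⟨h, hx.2⟩).le
  have hsign := integral_sign_sin_eq_zero hL.le hD hconv h0 hnn hDP hsin
  have hm0 : (0 : ℝ) ∈ Icc 0 L := ⟨le_rfl, hL.le⟩
  have hmL : L ∈ Icc 0 L := ⟨hL.le, le_rfl⟩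
  have hchord : ∀ x y, 0 ≤ x → x ≤ y → 0 < y → y ≤ L → D x ≤ x / y * D y := by
    intro x y hx hxy hy hyL
    have h1 : x / y ≤ 1 := by rw [div_le_one hy]; exact hxy
    have := hconv.2 hm0 (show y ∈ Icc 0 L from ⟨hy.le, hyL⟩) (sub_nonneg.2 h1)
      (show 0 ≤ x / y by positivity) (by ring)
    simp only [smul_eq_mul, mul_zero, zero_add, h0] at this
    rwa [div_mul_cancel₀ _ hy.ne'] at this
  have hstrict : ∀ x y, 0 ≤ x → x < y → y ≤ L → D x < D y := by
    intro x y hx hxy hyL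
    have hy : 0 < y := by linarith
    have h1 : x / y < 1 := by rw [div_lt_one hy]; exact hxy
    have := hpos y ⟨hy, hyL⟩
    nlinarith [hchord x y hx hxy.le hy hyL]
  obtain ⟨y, hy, hyπ⟩ : ∃ y ∈ Ioo 0 L, D y = Real.pi := by
    by_contra hno
    have hle : D L ≤ Real.pi := by
      by_contra hlt
      push Not at hlt
      obtain ⟨y, hy, he⟩ := intermediate_value_Ioo hL.le hD.continuousOn
        (show Real.pi ∈ Ioo (D 0) (D L) from ⟨by rwa [h0], hlt⟩)
      exact hno ⟨y, hy, he⟩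
    have := (integral_eq_sub_of_eqOn_Ioo (g := fun x => Real.sign (Real.sin (D x))) (v := 1) hL.le
      fun x hx => Real.sign_of_pos (Real.sin_pos_of_pos_of_lt_pi (hpos x ⟨hx.1, hx.2.le⟩)
        ((hstrict x L hx.1.le hx.2 le_rfl).trans_le hle))).1
    linarith
  have i1 := integral_eq_sub_of_eqOn_Ioo (g := fun x => Real.sign (Real.sin (D x))) (v := 1)
    hy.1.le fun x hx => Real.sign_of_pos (Real.sin_pos_of_pos_of_lt_pi
      (hpos x ⟨hx.1, hx.2.le.trans hy.2.le⟩) (by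
        rw [← hyπ]; exact hstrict x y hx.1.le hx.2 hy.2.le))
  have i2 := integral_eq_sub_of_eqOn_Ioo (g := fun x => Real.sign (Real.sin (D x))) (v := -1)
    hy.2.le fun x hx => Real.sign_of_neg (by
      have h1 := hstrict y x hy.1.le hx.1 hx.2.le
      have h2 := hstrict x L (hy.1.le.trans hx.1.le) hx.2 le_rfl
      have := Real.sin_pos_of_pos_of_lt_pi (x := 2 * Real.pi - D x) (by linarith) (by linarith)
      rw [Real.sin_two_pi_sub] at this
      linarith)
  have hLy : L = 2 * y := by
    have := intervalIntegral.integral_add_adjacent_intervals i1.2 i2.2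
    rw [i1.1, i2.1, hsign] at this
    linarith
  have hDL : D L = 2 * Real.pi := by
    have := hchord y L hy.1.le hy.2.le hL le_rfl
    rw [hyπ, hLy] at this
    have e : y / (2 * y) = 1 / 2 := by have := hy.1; field_simp
    rw [e, ← hLy] at this
    linarith
  have hup : ∀ x ∈ Icc 0 L, D x ≤ 2 * Real.pi / L * x := fun x hx => by
    have := hchord x L hx.1 hx.2 hL le_rfl
    rw [hDL] at this
    calc _ ≤ _ := this
      _ = _ := by ring
  intro x hx
  refine le_antisymm (hup x hx) ?_
  have hx' : L - x ∈ Icc 0 L := ⟨by linarith [hx.2], by linarith [hx.1]⟩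
  have h1 := hup _ hx'
  have h2 := hconv.2 hx hx' (show (0 : ℝ) ≤ 1 / 2 by norm_num) (show (0 : ℝ) ≤ 1 / 2 by norm_num)
    (by norm_num)
  simp only [smul_eq_mul] at h2
  have e : 1 / 2 * x + 1 / 2 * (L - x) = y := by rw [hLy]; ring
  rw [e, hyπ] at h2
  have e3 : 2 * Real.pi / L * (L - x) = 2 * Real.pi - 2 * Real.pi / L * x := by
    field_simp
  linarith

end

end Planar

end

section
open MeasureTheory Set Filter Topology

namespace Planar

/-- The exponential integrals of `D` at integer frequencies, and the distribution of its slope, are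
those of a broken line with nodes at the levels `2πℤ`. -/
def Stepwise (L : ℝ) (D : ℝ → ℝ) : Prop :=
  ∃ N : List (ℝ × (ℝ → ℝ)), (∀ p ∈ N, Continuous p.2) ∧
    (∀ ξ : ℝ, ξ ≠ 0 → ∀ k : ℤ, ∫ x in (0 : ℝ)..L, Complex.exp (ξ * x - k * Complex.I * D x) =
      (N.map fun p => (p.2 ξ : ℂ) * (ξ / (ξ - k * Complex.I * p.1))).sum) ∧
    ∀ φ : ℝ → ℝ, IntervalIntegrable (fun x => φ (deriv D x)) volume 0 L ∧
      ∫ x in (0 : ℝ)..L, φ (deriv D x) = (N.map fun p => φ p.1 * p.2 0).sum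

section
variable {L : ℝ} {D : ℝ → ℝ}

lemma sub_mul_I_ne_zero {ξ : ℝ} (hξ : ξ ≠ 0) (k : ℤ) (v : ℝ) :
    (ξ - k * Complex.I * v : ℂ) ≠ 0 := by
  intro h
  have := congrArg Complex.re h
  simp at this
  exact hξ this

lemma stepwise_affine (hL : 0 ≤ L) {v : ℝ} (hD : ∀ x ∈ Icc 0 L, D x = v * x) {n : ℤ}
    (hv : v * L = n * (2 * Real.pi)) : Stepwise L D := by
  refine ⟨[(v, fun ξ => ∫ x in (0 : ℝ)..L, Real.exp (ξ * x))], ?_, ?_, ?_⟩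
  · simp only [List.mem_singleton, forall_eq]
    refine intervalIntegral.continuous_parametric_intervalIntegral_of_continuous' ?_ 0 L
    unfold Function.uncurry
    fun_prop
  · intro ξ hξ k
    have hξ' : (ξ : ℂ) ≠ 0 := by exact_mod_cast hξ
    have hμ := sub_mul_I_ne_zero hξ k v
    have e1 : ∫ x in (0 : ℝ)..L, Complex.exp (ξ * x - k * Complex.I * D x) =
        ∫ x in (0 : ℝ)..L, Complex.exp ((ξ - k * Complex.I * v) * x) := by
      refine intervalIntegral.integral_congr fun x hx => ?_
      rw [uIcc_of_le hL] at hx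
      simp only [hD x hx]
      push_cast
      ring_nf
    have e2 : ((∫ x in (0 : ℝ)..L, Real.exp (ξ * x) : ℝ) : ℂ) =
        ∫ x in (0 : ℝ)..L, Complex.exp (ξ * x) := by
      rw [← intervalIntegral.integral_ofReal]
      simp
    have e3 : Complex.exp ((ξ - k * Complex.I * v) * L) = Complex.exp (ξ * L) := by
      rw [Complex.exp_eq_exp_iff_exists_int]
      refine ⟨-(k * n), ?_⟩
      have : (v * L : ℂ) = n * (2 * Real.pi) := by exact_mod_cast hv
      push_cast
      linear_combination -k * Complex.I * this
    simp only [List.map_cons, List.map_nil, List.sum_cons, List.sum_nil, add_zero]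
    rw [e1, e2, integral_exp_mul_complex hμ, integral_exp_mul_complex hξ', e3]
    simp only [Complex.ofReal_zero, mul_zero]
    field_simp
  · intro φ
    have h : ∀ x ∈ Ioo 0 L, φ (deriv D x) = φ v := fun x hx => by
      have : D =ᶠ[𝓝 x] fun x => v * x := by
        filter_upwards [Icc_mem_nhds hx.1 hx.2] with y hy using hD y hy
      rw [this.deriv_eq]
      simp
    obtain ⟨h1, h2⟩ := integral_eq_sub_of_eqOn_Ioo hL h
    refine ⟨h2, ?_⟩
    rw [h1]
    simp [mul_comm]

lemma Stepwise.append {y : ℝ} (hD : Continuous D) {n : ℤ}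
    (h1 : Stepwise y D) (h2 : Stepwise (L - y) fun x => D (y + x) - n * (2 * Real.pi)) :
    Stepwise L D := by
  obtain ⟨N1, c1, e1, d1⟩ := h1
  obtain ⟨N2, c2, e2, d2⟩ := h2
  refine ⟨N1 ++ N2.map fun p => (p.1, fun ξ => Real.exp (ξ * y) * p.2 ξ), ?_, ?_, ?_⟩
  · intro p hp
    rcases List.mem_append.1 hp with hp | hp
    · exact c1 p hp
    · obtain ⟨r, hr, rfl⟩ := List.mem_map.1 hp
      have := c2 r hr
      fun_prop
  · intro ξ hξ k
    have hc : Continuous fun x : ℝ => Complex.exp (ξ * x - k * Complex.I * D x) := by fun_prop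
    rw [← intervalIntegral.integral_add_adjacent_intervals (hc.intervalIntegrable 0 y)
      (hc.intervalIntegrable y L), e1 ξ hξ k, List.map_append, List.sum_append, List.map_map]
    congr 1
    have s := intervalIntegral.integral_comp_add_left (a := 0) (b := L - y)
      (fun x : ℝ => Complex.exp (ξ * x - k * Complex.I * D x)) y
    rw [add_zero, add_sub_cancel] at s
    rw [← s]
    have e : ∀ x : ℝ, Complex.exp (ξ * (y + x : ℝ) - k * Complex.I * D (y + x)) =
        Complex.exp (ξ * y) * Complex.exp (ξ * x - k * Complex.I *
          ((D (y + x) - n * (2 * Real.pi) : ℝ) : ℂ)) := fun x => by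
      rw [← Complex.exp_add, Complex.exp_eq_exp_iff_exists_int]
      refine ⟨-(k * n), ?_⟩
      push_cast
      ring
    simp only [e]
    rw [intervalIntegral.integral_const_mul, e2 ξ hξ k, ← List.sum_map_mul_left]
    congr 1
    refine List.map_congr_left fun p _ => ?_
    simp only [Function.comp]
    push_cast
    ring
  · intro φ
    obtain ⟨i1, s1⟩ := d1 φ
    obtain ⟨i2, s2⟩ := d2 φ
    have hd : ∀ x, deriv (fun x => D (y + x) - n * (2 * Real.pi)) x = deriv D (y + x) := fun x => by
      rw [deriv_sub_const, deriv_comp_const_add]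
    simp only [hd] at i2 s2
    have i2' : IntervalIntegrable (fun x => φ (deriv D x)) volume y L := by
      have := i2.comp_sub_right y
      simpa using this
    refine ⟨i1.trans i2', ?_⟩
    rw [← intervalIntegral.integral_add_adjacent_intervals i1 i2', s1, List.map_append,
      List.sum_append, List.map_map]
    congr 1
    have s := intervalIntegral.integral_comp_add_left (a := 0) (b := L - y)
      (fun x : ℝ => φ (deriv D x)) y
    rw [add_zero, add_sub_cancel] at s
    rw [← s, s2]
    congr 1
    refine List.map_congr_left fun p _ => ?_
    simp

lemma Stepwise.reflect (h : Stepwise L fun x => D (L - x)) : Stepwise L D := by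
  obtain ⟨N, c, e, d⟩ := h
  refine ⟨N.map fun p => (-p.1, fun ξ => Real.exp (ξ * L) * p.2 (-ξ)), ?_, ?_, ?_⟩
  · intro p hp
    obtain ⟨r, hr, rfl⟩ := List.mem_map.1 hp
    have := c r hr
    fun_prop
  · intro ξ hξ k
    have s := intervalIntegral.integral_comp_sub_left (a := 0) (b := L)
      (fun x : ℝ => Complex.exp (ξ * x - k * Complex.I * D x)) L
    rw [sub_zero, sub_self] at s
    rw [← s]
    have e' : ∀ x : ℝ, Complex.exp (ξ * (L - x : ℝ) - k * Complex.I * D (L - x)) =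
        Complex.exp (ξ * L) * Complex.exp ((-ξ : ℝ) * x - k * Complex.I * D (L - x)) := fun x => by
      rw [← Complex.exp_add]
      push_cast
      ring_nf
    simp only [e']
    rw [intervalIntegral.integral_const_mul, e (-ξ) (neg_ne_zero.2 hξ) k, ← List.sum_map_mul_left,
      List.map_map]
    congr 1
    refine List.map_congr_left fun p _ => ?_
    have h1 := sub_mul_I_ne_zero hξ k (-p.1)
    have h2 := sub_mul_I_ne_zero (neg_ne_zero.2 hξ) k p.1
    simp only [Function.comp]
    push_cast at h1 h2 ⊢
    have e3 : (-ξ / (-ξ - k * Complex.I * p.1) : ℂ) = ξ / (ξ - k * Complex.I * -p.1) := by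
      rw [div_eq_div_iff h2 h1]
      ring
    rw [e3]
    ring
  · intro φ
    obtain ⟨i1, s1⟩ := d fun v => φ (-v)
    have hd : ∀ x, deriv (fun x => D (L - x)) x = -deriv D (L - x) := fun x => by
      rw [deriv_comp_const_sub]
    simp only [hd, neg_neg] at i1 s1
    have s := intervalIntegral.integral_comp_sub_left (a := 0) (b := L)
      (fun x : ℝ => φ (deriv D x)) L
    rw [sub_zero, sub_self] at s
    refine ⟨?_, ?_⟩
    · have := (i1.comp_sub_left L).symm
      simpa using this
    · rw [← s, s1, List.map_map]
      congr 1
      refine List.map_congr_left fun p _ => ?_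
      simp

lemma convexOn_shift (hconv : ConvexOn ℝ (Icc 0 L) D) {y : ℝ} (hy : 0 ≤ y) (c : ℝ) :
    ConvexOn ℝ (Icc 0 (L - y)) fun x => D (y + x) - c := by
  have := ConvexOn_comp_affine hconv 1 y (convex_Icc 0 (L - y))
    fun x hx => ⟨by linarith [hx.1], by linarith [hx.2]⟩
  refine (this.add_const (-c)).congr fun x _ => ?_
  simp [add_comm, sub_eq_add_neg]

lemma integral_sin_nonneg (hL : 0 ≤ L) (hD : Continuous D) (hconv : ConvexOn ℝ (Icc 0 L) D)
    (h0 : D 0 = 0) (hnn : ∀ x ∈ Icc 0 L, 0 ≤ D x) : 0 ≤ ∫ x in (0 : ℝ)..L, Real.sin (D x) := by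
  have hm := convexOn_monotoneOn hconv h0 hnn
  refine integral_comp_nonneg_one_sided (X := fun c => 1 - Real.cos c) (B := D L + 1) hL ?_ hD hconv
    h0 hnn (fun x hx => ?_) (fun c => ?_) Real.continuous_sin (by simp)
    fun c _ => by linarith [Real.cos_le_one c]
  · linarith [hnn L ⟨hL, le_rfl⟩]
  · linarith [hm hx ⟨hL, le_rfl⟩ hx.2]
  · exact ((Real.hasDerivAt_cos c).const_sub 1).congr_deriv (by simp)

lemma integral_sin_split (hD : Continuous D) (hconv : ConvexOn ℝ (Icc 0 L) D) (h0 : D 0 = 0)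
    (hnn : ∀ x ∈ Icc 0 L, 0 ≤ D x) (hsin : ∫ x in (0 : ℝ)..L, Real.sin (D x) = 0) {y : ℝ}
    (hy : y ∈ Icc 0 L) {n : ℤ} (hDy : D y = n * (2 * Real.pi)) :
    ∫ x in (0 : ℝ)..y, Real.sin (D x) = 0 ∧
      ∫ x in (0 : ℝ)..(L - y), Real.sin (D (y + x) - n * (2 * Real.pi)) = 0 := by
  have hm := convexOn_monotoneOn hconv h0 hnn
  have h1 := integral_sin_nonneg hy.1 hD (hconv.subset (Icc_subset_Icc_right hy.2) (convex_Icc _ _))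
    h0 fun x hx => hnn x ⟨hx.1, hx.2.trans hy.2⟩
  have h2 := integral_sin_nonneg (D := fun x => D (y + x) - n * (2 * Real.pi)) (L := L - y)
    (by linarith [hy.2]) (by fun_prop) (convexOn_shift hconv hy.1 _) (by simp [hDy])
    fun x hx => by
      have hx' : y + x ∈ Icc 0 L := ⟨by linarith [hy.1, hx.1], by linarith [hx.2]⟩
      have := hm hy hx' (by linarith [hx.1])
      linarith
  have hc : Continuous fun x => Real.sin (D x) := by fun_prop
  have h3 := intervalIntegral.integral_add_adjacent_intervals (μ := volume) (hc.intervalIntegrable 0 y)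
    (hc.intervalIntegrable y L)
  have s := intervalIntegral.integral_comp_add_left (a := 0) (b := L - y)
    (fun x : ℝ => Real.sin (D x)) y
  rw [add_zero, add_sub_cancel] at s
  simp only [Real.sin_sub_int_mul_two_pi] at h2 ⊢
  constructor <;> linarith

lemma stepwise_of_pos (n : ℕ) : ∀ (L : ℝ) (D : ℝ → ℝ), 0 ≤ L → Continuous D →
    ConvexOn ℝ (Icc 0 L) D → D 0 = 0 → (∀ x ∈ Ioc 0 L, 0 < D x) →
    D L ≤ n * (2 * Real.pi) → ∫ x in (0 : ℝ)..L, Real.sin (D x) = 0 → Stepwise L D := by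
  have hpi := Real.pi_pos
  have hzero : ∀ (L : ℝ) (D : ℝ → ℝ), L = 0 → D 0 = 0 → Stepwise L D := by
    rintro L D rfl h0
    refine stepwise_affine (v := 0) (n := 0) le_rfl (fun x hx => ?_) (by simp)
    rw [le_antisymm hx.2 hx.1, h0, zero_mul]
  induction n with
  | zero =>
    intro L D hL hD hconv h0 hpos hn hsin
    rcases hL.eq_or_lt with h | h
    · exact hzero L D h.symm h0
    · have := hpos L ⟨h, le_rfl⟩
      simp at hn
      linarith
  | succ n ih =>
    intro L D hL hD hconv h0 hpos hn hsin
    rcases hL.eq_or_lt with h | hL0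
    · exact hzero L D h.symm h0
    have hnn : ∀ x ∈ Icc 0 L, 0 ≤ D x := fun x hx => by
      rcases hx.1.eq_or_lt with h | h
      · rw [← h, h0]
      · exact (hpos x ⟨h, hx.2⟩).le
    have hm := convexOn_monotoneOn hconv h0 hnn
    obtain ⟨y, hy, hy0, hDy⟩ : ∃ y ∈ Icc 0 L, 0 < y ∧ (D y = 2 * Real.pi ∨
        D y ≤ 2 * Real.pi ∧ y = L) := by
      by_cases hle : D L ≤ 2 * Real.pi
      · exact ⟨L, ⟨hL, le_rfl⟩, hL0, Or.inr ⟨hle, rfl⟩⟩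
      · push Not at hle
        obtain ⟨y, hy, he⟩ := intermediate_value_Ioo hL hD.continuousOn
          (show 2 * Real.pi ∈ Ioo (D 0) (D L) from ⟨by rw [h0]; positivity, hle⟩)
        exact ⟨y, Ioo_subset_Icc_self hy, hy.1, Or.inl he⟩
    have hcy := hconv.subset (Icc_subset_Icc_right hy.2) (convex_Icc 0 y)
    have hposy : ∀ x ∈ Ioc 0 y, 0 < D x := fun x hx => hpos x ⟨hx.1, hx.2.trans hy.2⟩
    rcases hDy with hDy | ⟨hDy, rfl⟩
    · obtain ⟨s1, s2⟩ := integral_sin_split hD hconv h0 hnn hsin hy (n := 1) (by simp [hDy])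
      have a1 := affine_of_integral_sin_eq_zero hy0 hD hcy h0 hposy hDy.le s1
      refine Stepwise.append hD (n := 1) (stepwise_affine hy.1 a1 (n := 1) (by simp; field_simp)) ?_
      refine ih _ _ (by linarith [hy.2]) (by fun_prop) (convexOn_shift hconv hy.1 _) (by simp [hDy])
        (fun x hx => ?_) ?_ s2
      · have hyx : 0 < y + x := by linarith [hx.1]
        have hmem : y + x ∈ Icc 0 L := ⟨hyx.le, by linarith [hx.2]⟩
        have h1 : y / (y + x) < 1 := by rw [div_lt_one hyx]; linarith [hx.1]
        have h2 := hconv.2 ⟨le_rfl, hL⟩ hmem (sub_nonneg.2 h1.le)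
          (show 0 ≤ y / (y + x) by positivity) (by ring)
        simp only [smul_eq_mul, mul_zero, zero_add, h0] at h2
        rw [div_mul_cancel₀ _ hyx.ne', hDy] at h2
        have h3 := hpos _ ⟨hyx, hmem.2⟩
        push_cast
        nlinarith
      · push_cast at hn ⊢
        rw [add_sub_cancel]
        linarith
    · have a1 := affine_of_integral_sin_eq_zero hy0 hD hcy h0 hposy hDy hsin
      exact stepwise_affine hy.1 a1 (n := 1) (by simp; field_simp)

lemma stepwise_one_sided (hL : 0 ≤ L) (hD : Continuous D) (hconv : ConvexOn ℝ (Icc 0 L) D)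
    (h0 : D 0 = 0) (hnn : ∀ x ∈ Icc 0 L, 0 ≤ D x)
    (hsin : ∫ x in (0 : ℝ)..L, Real.sin (D x) = 0) : Stepwise L D := by
  have hm := convexOn_monotoneOn hconv h0 hnn
  have hK : IsCompact (Icc 0 L ∩ D ⁻¹' {0}) :=
    isCompact_Icc.inter_right (isClosed_singleton.preimage hD)
  obtain ⟨y, ⟨hy, hDy⟩, hmax⟩ := hK.exists_isGreatest ⟨0, ⟨le_rfl, hL⟩, h0⟩
  simp only [mem_preimage, mem_singleton_iff] at hDy
  obtain ⟨-, s2⟩ := integral_sin_split hD hconv h0 hnn hsin hy (n := 0) (by simp [hDy])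
  refine Stepwise.append hD (y := y) (n := 0) (stepwise_affine (v := 0) (n := 0) hy.1
    (fun x hx => ?_) (by simp)) ?_
  · have hx' : x ∈ Icc 0 L := ⟨hx.1, hx.2.trans hy.2⟩
    have := hm hx' hy hx.2
    rw [zero_mul]
    linarith [hnn x hx']
  · obtain ⟨n, hn⟩ := exists_nat_ge (D L / (2 * Real.pi))
    rw [div_le_iff₀ (by positivity)] at hn
    refine stepwise_of_pos n _ _ (by linarith [hy.2]) (by fun_prop) (convexOn_shift hconv hy.1 _)
      (by simp [hDy]) (fun x hx => ?_) (by simpa using hn) s2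
    have hmem : y + x ∈ Icc 0 L := ⟨by linarith [hy.1, hx.1], by linarith [hx.2]⟩
    simp only [Int.cast_zero, zero_mul, sub_zero]
    refine (hnn _ hmem).lt_of_ne fun he => ?_
    have := hmax ⟨hmem, he.symm⟩
    linarith [hx.1]

theorem Depth.stepwise {B : ℝ} (hD : Depth L B D)
    (hsin : ∫ x in (0 : ℝ)..L, Real.sin (D x) = 0) : Stepwise L D := by
  obtain ⟨x0, hx0, hz⟩ := hD.zero
  have hc := hD.cont
  have c1 : ConvexOn ℝ (Icc 0 x0) fun x => D (x0 - x) :=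
    (ConvexOn_comp_affine hD.conv (-1) x0 (convex_Icc 0 x0)
      fun x hx => ⟨by linarith [hx.2], by linarith [hx.1, hx0.2]⟩).congr
      fun x _ => by simp only; ring_nf
  have n1 : ∀ x ∈ Icc 0 x0, 0 ≤ D (x0 - x) := fun x hx =>
    hD.nonneg _ ⟨by linarith [hx.2], by linarith [hx.1, hx0.2]⟩
  have c2 := convexOn_shift hD.conv hx0.1 ((0 : ℤ) * (2 * Real.pi))
  have n2 : ∀ x ∈ Icc 0 (L - x0), 0 ≤ D (x0 + x) - (0 : ℤ) * (2 * Real.pi) := fun x hx => by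
    simpa using hD.nonneg _ ⟨by linarith [hx.1, hx0.1], by linarith [hx.2]⟩
  have p1 := integral_sin_nonneg hx0.1 (by fun_prop) c1 (by simp [hz]) n1
  have p2 := integral_sin_nonneg (by linarith [hx0.2]) (by fun_prop) c2 (by simp [hz]) n2
  have hsc : Continuous fun x => Real.sin (D x) := by fun_prop
  have h3 := intervalIntegral.integral_add_adjacent_intervals (μ := volume)
    (hsc.intervalIntegrable 0 x0) (hsc.intervalIntegrable x0 L)
  have s1 := intervalIntegral.integral_comp_sub_left (a := 0) (b := x0)
    (fun x : ℝ => Real.sin (D x)) x0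
  have s2 := intervalIntegral.integral_comp_add_left (a := 0) (b := L - x0)
    (fun x : ℝ => Real.sin (D x)) x0
  rw [sub_zero, sub_self] at s1
  rw [add_zero, add_sub_cancel] at s2
  have e2 : ∫ x in (0 : ℝ)..(L - x0), Real.sin (D (x0 + x) - (0 : ℤ) * (2 * Real.pi)) =
      ∫ x in (0 : ℝ)..(L - x0), Real.sin (D (x0 + x)) := by simp
  refine Stepwise.append hc (y := x0) (n := 0) (Stepwise.reflect ?_) ?_
  · exact stepwise_one_sided hx0.1 (by fun_prop) c1 (by simp [hz]) n1 (by linarith)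
  · exact stepwise_one_sided (by linarith [hx0.2]) (by fun_prop) c2 (by simp [hz]) n2 (by linarith)

end

end Planar

end

section
open MeasureTheory Set Filter Topology

namespace Planar

/-- The sum of simple poles attached to a list of slopes and weights. -/
noncomputable def poleSum (N : List (ℝ × (ℝ → ℝ))) (ξ : ℝ) (k : ℤ) : ℂ :=
  (N.map fun p => (p.2 ξ : ℂ) * (ξ / (ξ - k * Complex.I * p.1))).sum

/-- The numerator of `poleSum` over the common denominator `∏ w ∈ S, (X - w)`. -/
noncomputable def polePoly (S : Finset ℝ) (N : List (ℝ × (ℝ → ℝ))) (ξ : ℝ) : Polynomial ℂ :=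
  (N.map fun p => Polynomial.C (p.2 ξ : ℂ) *
    ∏ w ∈ S.erase p.1, (Polynomial.X - Polynomial.C (w : ℂ))).sum

section
variable {S : Finset ℝ} {N M : List (ℝ × (ℝ → ℝ))}

lemma poleSum_eq (hN : ∀ p ∈ N, p.1 ∈ S) {ξ : ℝ} (hξ : ξ ≠ 0) {k : ℤ} (hk : k ≠ 0) {s : ℂ}
    (hs : s * (k * Complex.I) = ξ) :
    poleSum N ξ k * ∏ w ∈ S, (s - w) = s * (polePoly S N ξ).eval s := by
  have hk' : (k * Complex.I : ℂ) ≠ 0 := by simp [hk]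
  induction N with
  | nil => simp [poleSum, polePoly]
  | cons p N ih =>
    have ih := ih fun r hr => hN r (List.mem_cons_of_mem _ hr)
    have hp := hN p List.mem_cons_self
    simp only [poleSum, polePoly, List.map_cons, List.sum_cons, Polynomial.eval_add,
      Polynomial.eval_mul, Polynomial.eval_C, Polynomial.eval_prod, Polynomial.eval_sub,
      Polynomial.eval_X] at ih ⊢
    rw [add_mul, ih, mul_add, ← Finset.mul_prod_erase S _ hp]
    congr 1
    have h1 : (ξ - k * Complex.I * p.1 : ℂ) = k * Complex.I * (s - p.1) := by rw [← hs]; ring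
    have h2 := sub_mul_I_ne_zero hξ k p.1
    rw [h1] at h2
    have h3 : s - (p.1 : ℂ) ≠ 0 := right_ne_zero_of_mul h2
    rw [h1, ← hs]
    field_simp

lemma polePoly_mul_eq (hN : ∀ p ∈ N, p.1 ∈ S) (hM : ∀ p ∈ M, p.1 ∈ S)
    (h : ∀ ξ : ℝ, ξ ≠ 0 → ∀ k : ℤ,
      poleSum N ξ k * poleSum N (-ξ) (-k) = poleSum M ξ k * poleSum M (-ξ) (-k))
    {ξ : ℝ} (hξ : ξ ≠ 0) :
    polePoly S N ξ * polePoly S N (-ξ) = polePoly S M ξ * polePoly S M (-ξ) := by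
  have hξ' : (ξ : ℂ) ≠ 0 := by exact_mod_cast hξ
  let σ : ℕ → ℂ := fun n => ξ / (((n : ℤ) + 1 : ℤ) * Complex.I)
  have hne : ∀ n : ℕ, ((((n : ℤ) + 1 : ℤ) : ℂ) * Complex.I) ≠ 0 := fun n => by
    have : ((n : ℤ) + 1 : ℤ) ≠ 0 := by positivity
    exact mul_ne_zero (by exact_mod_cast this) Complex.I_ne_zero
  have hinj : Function.Injective σ := fun n m hnm => by
    simp only [σ] at hnm
    rw [div_eq_div_iff (hne n) (hne m)] at hnm
    have := mul_right_cancel₀ Complex.I_ne_zero (mul_left_cancel₀ hξ' hnm)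
    have : ((m : ℤ) + 1) = (n : ℤ) + 1 := by exact_mod_cast this
    omega
  refine Polynomial.eq_of_infinite_eval_eq _ _
    ((infinite_range_of_injective hinj).mono ?_)
  rintro _ ⟨n, rfl⟩
  have hk : ((n : ℤ) + 1 : ℤ) ≠ 0 := by positivity
  have hs : σ n * ((((n : ℤ) + 1 : ℤ) : ℂ) * Complex.I) = ξ := div_mul_cancel₀ _ (hne n)
  have hs' : σ n * (((-((n : ℤ) + 1) : ℤ) : ℂ) * Complex.I) = (-ξ : ℝ) := by
    rw [Int.cast_neg, Complex.ofReal_neg, ← hs]; ring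
  have hσ : σ n ≠ 0 := div_ne_zero hξ' (hne n)
  have a1 := poleSum_eq hN hξ hk hs
  have a2 := poleSum_eq hN (neg_ne_zero.2 hξ) (neg_ne_zero.2 hk) hs'
  have a3 := poleSum_eq hM hξ hk hs
  have a4 := poleSum_eq hM (neg_ne_zero.2 hξ) (neg_ne_zero.2 hk) hs'
  have hh := h ξ hξ ((n : ℤ) + 1)
  show Polynomial.eval _ _ = Polynomial.eval _ _
  rw [Polynomial.eval_mul, Polynomial.eval_mul]
  refine mul_left_cancel₀ (pow_ne_zero 2 hσ) ?_
  calc _ = (σ n * (polePoly S N ξ).eval (σ n)) * (σ n * (polePoly S N (-ξ)).eval (σ n)) := by ring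
    _ = (σ n * (polePoly S M ξ).eval (σ n)) * (σ n * (polePoly S M (-ξ)).eval (σ n)) := by
      rw [← a1, ← a2, ← a3, ← a4]
      linear_combination (∏ w ∈ S, (σ n - w)) ^ 2 * hh
    _ = _ := by ring

lemma continuous_polePoly_eval (hN : ∀ p ∈ N, Continuous p.2) (s : ℂ) :
    Continuous fun ξ => (polePoly S N ξ).eval s := by
  induction N with
  | nil => simpa [polePoly] using continuous_const
  | cons p N ih =>
    have ih := ih fun r hr => hN r (List.mem_cons_of_mem _ hr)
    have hp := hN p List.mem_cons_self
    simp only [polePoly, List.map_cons, List.sum_cons, Polynomial.eval_add,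
      Polynomial.eval_mul, Polynomial.eval_C] at ih ⊢
    fun_prop

lemma polePoly_functional (hN : ∀ p ∈ N, p.1 ∈ S) (ξ : ℝ) (ψ : ℝ → ℝ) :
    ∑ u ∈ S, (ψ u : ℂ) / (∏ w ∈ S.erase u, ((u : ℂ) - w)) * (polePoly S N ξ).eval (u : ℂ) =
      ((N.map fun p => ψ p.1 * p.2 ξ).sum : ℝ) := by
  induction N with
  | nil => simp [polePoly]
  | cons p N ih =>
    have ih := ih fun r hr => hN r (List.mem_cons_of_mem _ hr)
    have hp := hN p List.mem_cons_self
    simp only [polePoly, List.map_cons, List.sum_cons, Polynomial.eval_add, mul_add,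
      Finset.sum_add_distrib, Complex.ofReal_add] at ih ⊢
    rw [ih]
    congr 1
    rw [Finset.sum_eq_single p.1 (fun u hu hup => ?_) (fun h => absurd hp h)]
    · have : ∏ w ∈ S.erase p.1, ((p.1 : ℂ) - w) ≠ 0 := Finset.prod_ne_zero_iff.2 fun w hw => by
        have := Finset.ne_of_mem_erase hw
        rw [sub_ne_zero]
        exact_mod_cast this.symm
      simp only [Polynomial.eval_mul, Polynomial.eval_C, Polynomial.eval_prod, Polynomial.eval_sub,
        Polynomial.eval_X, Complex.ofReal_mul]
      field_simp
    · have : (∏ w ∈ S.erase p.1, (Polynomial.X - Polynomial.C (w : ℂ))).eval (u : ℂ) = 0 := by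
        rw [Polynomial.eval_prod]
        exact Finset.prod_eq_zero (Finset.mem_erase.2 ⟨hup, hu⟩) (by simp)
      rw [Polynomial.eval_mul, this, mul_zero, mul_zero]

lemma weights_eq_or_eq_neg (cN : ∀ p ∈ N, Continuous p.2) (cM : ∀ p ∈ M, Continuous p.2)
    (h : ∀ ξ : ℝ, ξ ≠ 0 → ∀ k : ℤ,
      poleSum N ξ k * poleSum N (-ξ) (-k) = poleSum M ξ k * poleSum M (-ξ) (-k)) :
    (∀ ψ : ℝ → ℝ, (N.map fun p => ψ p.1 * p.2 0).sum = (M.map fun p => ψ p.1 * p.2 0).sum) ∨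
    ∀ ψ : ℝ → ℝ, (N.map fun p => ψ p.1 * p.2 0).sum = -(M.map fun p => ψ p.1 * p.2 0).sum := by
  let S : Finset ℝ := ((N ++ M).map Prod.fst).toFinset
  have hN : ∀ p ∈ N, p.1 ∈ S := fun p hp =>
    List.mem_toFinset.2 (List.mem_map_of_mem (List.mem_append_left _ hp))
  have hM : ∀ p ∈ M, p.1 ∈ S := fun p hp =>
    List.mem_toFinset.2 (List.mem_map_of_mem (List.mem_append_right _ hp))
  have hsq : polePoly S N 0 ^ 2 = polePoly S M 0 ^ 2 := by
    refine Polynomial.funext fun s => ?_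
    have c1 := continuous_polePoly_eval (S := S) cN s
    have c2 := continuous_polePoly_eval (S := S) cM s
    have := Continuous.ext_on (dense_compl_singleton (0 : ℝ))
      (c1.mul (c1.comp continuous_neg)) (c2.mul (c2.comp continuous_neg)) fun ξ hξ => by
        have := congrArg (Polynomial.eval s) (polePoly_mul_eq hN hM h hξ)
        simpa only [Polynomial.eval_mul, Pi.mul_apply, Function.comp] using this
    have := congrFun this 0
    simpa only [Pi.mul_apply, Function.comp, neg_zero, Polynomial.eval_mul, sq] using this
  rcases sq_eq_sq_iff_eq_or_eq_neg.1 hsq with e | e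
  · left
    intro ψ
    have h1 := polePoly_functional hN 0 ψ
    have h2 := polePoly_functional hM 0 ψ
    rw [e, h2] at h1
    exact_mod_cast h1.symm
  · right
    intro ψ
    have h1 := polePoly_functional hN 0 ψ
    have h2 := polePoly_functional hM 0 ψ
    rw [e] at h1
    simp only [Polynomial.eval_neg, mul_neg, Finset.sum_neg_distrib] at h1
    rw [h2] at h1
    exact_mod_cast h1.symm

end

end Planar

end

section
open MeasureTheory Set Filter Topology

namespace Planar

lemma Depth.scale {L B : ℝ} {D : ℝ → ℝ} (h : Depth L B D) {τ : ℝ} (hτ : 0 ≤ τ) :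
    Depth L (τ * B) fun x => τ * D x := by
  have hc := h.cont
  refine ⟨by fun_prop, h.conv.smul hτ, fun x hx => mul_nonneg hτ (h.nonneg x hx),
    fun x hx => mul_le_mul_of_nonneg_left (h.le x hx) hτ, ?_⟩
  obtain ⟨x, hx, h0⟩ := h.zero
  exact ⟨x, hx, by simp [h0]⟩

lemma Depth.integral_sin_mul_nonneg {L B : ℝ} {D : ℝ → ℝ} (h : Depth L B D) (hB : 0 < B) {τ : ℝ}
    (hτ : 0 < τ) : 0 ≤ ∫ x in (0 : ℝ)..L, Real.sin (τ * D x) :=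
  (h.scale hτ.le).integral_comp_nonneg (X := fun c => 1 - Real.cos c) (mul_pos hτ hB)
    (fun c => ((Real.hasDerivAt_cos c).const_sub 1).congr_deriv (by simp)) Real.continuous_sin
    (by simp) fun c _ => by linarith [Real.cos_le_one c]

lemma im_depthInt_mul_I {l : ℝ} {D : ℝ → ℝ} (hD : Continuous D) (τ : ℝ) :
    (depthInt l D (τ * Complex.I)).im = ∫ x in (0 : ℝ)..l, Real.sin (τ * D x) := by
  have e : ∀ x : ℝ, Real.sin (τ * D x) = (Complex.exp (τ * Complex.I * D x)).im := fun x => by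
    rw [show (τ * Complex.I * D x : ℂ) = (τ * D x : ℝ) * Complex.I by push_cast; ring,
      Complex.exp_ofReal_mul_I_im]
  have hi : IntervalIntegrable (fun x => Complex.exp (τ * Complex.I * D x)) volume 0 l :=
    Continuous.intervalIntegrable (by fun_prop) _ _
  simp only [e, depthInt]
  exact ((Complex.imCLM.intervalIntegral_comp_comm hi)).symm

lemma Slab.integral_sin_eq_zero {l W : ℝ} {d s : ℝ → ℝ} (h : Slab l W d s) {τ : ℝ} (hτ : 0 < τ)
    (hper : Complex.exp (τ * Complex.I * W) = 1) (hz : slabA l W d s (τ * Complex.I) = 0) :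
    ∫ x in (0 : ℝ)..l, Real.sin (τ * d x) = 0 ∧ ∫ x in (0 : ℝ)..l, Real.sin (τ * s x) = 0 := by
  have h1 := h.top.integral_sin_mul_nonneg h.W_pos hτ
  have h2 := h.bot.integral_sin_mul_nonneg h.W_pos hτ
  have hc : depthInt l d (-(τ * Complex.I)) = starRingEnd ℂ (depthInt l d (τ * Complex.I)) := by
    rw [← depthInt_conj]; simp
  rw [slabA, hper, one_mul, hc] at hz
  have := congrArg Complex.im hz
  rw [Complex.sub_im, Complex.conj_im, im_depthInt_mul_I h.top.cont,
    im_depthInt_mul_I h.bot.cont, Complex.zero_im] at this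
  constructor <;> linarith

section
variable {l : ℝ} {f b g c : ℝ → ℝ}

lemma ae_deriv_dep (hconc : ConcaveOn ℝ (Icc 0 l) f) (q τ : ℝ) :
    ∀ᵐ x : ℝ, x ∈ Ioo 0 l → deriv (fun x => τ * dep l f q x) x = τ * (q - deriv f x) := by
  filter_upwards [ConcaveOn_ae_differentiableAt hconc] with x hx hxl
  have hd := (hx hxl).hasDerivAt
  have : HasDerivAt (fun x => τ * (tiltMax l f q - (f x - q * x))) (τ * (q - deriv f x)) x := by
    refine ((((hd.sub ((hasDerivAt_id x).const_mul q)).const_sub _).const_mul τ)).congr_deriv ?_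
    ring
  exact this.deriv

lemma integral_congr_Ioo {F G : ℝ → ℝ} (hl : 0 ≤ l)
    (h : ∀ᵐ x : ℝ, x ∈ Ioo 0 l → F x = G x) :
    ∫ x in (0 : ℝ)..l, F x = ∫ x in (0 : ℝ)..l, G x := by
  refine intervalIntegral.integral_congr_ae ?_
  have h2 : ∀ᵐ x : ℝ, x ≠ l := by simp [ae_iff, measure_singleton]
  filter_upwards [h, h2] with x hx hxl hm
  rw [uIoc_of_le hl] at hm
  exact hx ⟨hm.1, hm.2.lt_of_ne hxl⟩

lemma expInt_tilt_top (q ξ : ℝ) (η : ℂ) :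
    expInt l (fun _ => 1) f (ξ - q * η, η) = Complex.exp (η * tiltMax l f q) *
      ∫ x in (0 : ℝ)..l, Complex.exp (ξ * x - η * dep l f q x) := by
  rw [expInt, ← intervalIntegral.integral_const_mul]
  refine intervalIntegral.integral_congr fun x _ => ?_
  simp only [← Complex.exp_add, Complex.ofReal_one, one_mul, dep]
  congr 1; push_cast; ring

lemma expInt_tilt_bot (q ξ : ℝ) (η : ℂ) :
    expInt l (fun _ => 1) b (ξ - q * η, η) =
      Complex.exp (-(η * tiltMax l (fun x => -b x) (-q))) *
      ∫ x in (0 : ℝ)..l, Complex.exp (ξ * x + η * dep l (fun x => -b x) (-q) x) := by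
  rw [expInt, ← intervalIntegral.integral_const_mul]
  refine intervalIntegral.integral_congr fun x _ => ?_
  simp only [← Complex.exp_add, Complex.ofReal_one, one_mul, dep]
  congr 1; push_cast; ring

lemma GraphBody.exists_poleSum (h : GraphBody l f b) {q τ : ℝ} (hτ : 0 < τ)
    (hper : Complex.exp (τ * Complex.I * width l f b q) = 1)
    (hz : tiltA l f b q (τ * Complex.I) = 0) :
    ∃ N : List (ℝ × (ℝ → ℝ)), (∀ p ∈ N, Continuous p.2) ∧
      (∀ ξ : ℝ, ξ ≠ 0 → ∀ k : ℤ,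
        bodyTr l f b (ξ - q * (k * (τ * Complex.I)), k * (τ * Complex.I)) =
          Complex.exp (k * (τ * Complex.I) * tiltMax l f q) * poleSum N ξ k) ∧
      ∀ φ : ℝ → ℝ, slopeInt l f φ - slopeInt l b φ =
        (N.map fun p => (2 * Real.pi * φ (q - p.1 / τ)) * p.2 0).sum := by
  have hl := h.l_pos
  have hsl := h.slab q
  obtain ⟨s1, s2⟩ := hsl.integral_sin_eq_zero hτ hper hz
  obtain ⟨N, cN, eN, dN⟩ := (hsl.top.scale hτ.le).stepwise s1
  obtain ⟨M, cM, eM, dM⟩ := (hsl.bot.scale hτ.le).stepwise s2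
  refine ⟨N ++ M.map fun p => (-p.1, fun ξ => -p.2 ξ), ?_, ?_, ?_⟩
  · intro p hp
    rcases List.mem_append.1 hp with hp | hp
    · exact cN p hp
    · obtain ⟨r, hr, rfl⟩ := List.mem_map.1 hp
      exact (cM r hr).neg
  · intro ξ hξ k
    have e1 := eN ξ hξ k
    have e2 := eM ξ hξ (-k)
    have hexp : Complex.exp (-(k * (τ * Complex.I) * tiltMax l (fun x => -b x) (-q))) =
        Complex.exp (k * (τ * Complex.I) * tiltMax l f q) := by
      rw [Complex.exp_eq_one_iff] at hper
      obtain ⟨n, hn⟩ := hper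
      rw [Complex.exp_eq_exp_iff_exists_int]
      refine ⟨-(k * n), ?_⟩
      rw [width] at hn
      push_cast at hn ⊢
      linear_combination -k * hn
    rw [bodyTr, expInt_tilt_top, expInt_tilt_bot, hexp, ← mul_sub]
    congr 1
    rw [poleSum, List.map_append, List.sum_append, sub_eq_add_neg]
    congr 1
    · rw [← e1]
      refine intervalIntegral.integral_congr fun x _ => ?_
      simp only
      congr 1; push_cast; ring
    · have : ∫ x in (0 : ℝ)..l,
          Complex.exp (ξ * x + k * (τ * Complex.I) * dep l (fun x => -b x) (-q) x) =
          ∫ x in (0 : ℝ)..l, Complex.exp (ξ * x - (-k : ℤ) * Complex.I *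
            (τ * dep l (fun x => -b x) (-q) x : ℝ)) := by
        refine intervalIntegral.integral_congr fun x _ => ?_
        congr 1; push_cast; ring
      rw [this, e2, List.map_map, ← neg_one_mul, ← List.sum_map_mul_left]
      congr 1
      refine List.map_congr_left fun p _ => ?_
      simp only [Function.comp]
      push_cast
      rw [show (ξ - -(k : ℂ) * Complex.I * p.1) = ξ - k * Complex.I * -p.1 by ring]
      ring
  · intro φ
    have d1 := (dN fun v => 2 * Real.pi * φ (q - v / τ)).2
    have d2 := (dM fun v => 2 * Real.pi * φ (q + v / τ)).2
    have t1 : slopeInt l f φ = ∫ x in (0 : ℝ)..l,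
        2 * Real.pi * φ (q - deriv (fun x => τ * dep l f q x) x / τ) := by
      refine integral_congr_Ioo hl.le ?_
      filter_upwards [ae_deriv_dep h.f_conc q τ] with x hx hxl
      rw [hx hxl]
      congr 2
      field_simp
      ring
    have t2 : slopeInt l b φ = ∫ x in (0 : ℝ)..l,
        2 * Real.pi * φ (q + deriv (fun x => τ * dep l (fun x => -b x) (-q) x) x / τ) := by
      refine integral_congr_Ioo hl.le ?_
      filter_upwards [ae_deriv_dep h.b_conv.neg (-q) τ] with x hx hxl
      have hn : deriv (-b) x = -deriv b x := deriv.neg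
      rw [show dep l (fun x => -b x) (-q) = dep l (-b) (-q) from rfl, hx hxl, hn]
      congr 2
      field_simp
      ring
    rw [t1, t2, d1, d2, List.map_append, List.sum_append, sub_eq_add_neg, List.map_map]
    congr 1
    rw [← neg_one_mul, ← List.sum_map_mul_left]
    congr 1
    refine List.map_congr_left fun p _ => ?_
    simp only [Function.comp, neg_div, sub_neg_eq_add]
    ring

lemma Homometric.slopeInt_sub_of_collision (h : Homometric l f b g c) {q τ : ℝ} (hτ : 0 < τ)
    (hper : Complex.exp (τ * Complex.I * width l f b q) = 1)
    (hz : tiltA l f b q (τ * Complex.I) = 0) :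
    (∀ φ, slopeInt l f φ - slopeInt l b φ = slopeInt l g φ - slopeInt l c φ) ∨
    ∀ φ, slopeInt l f φ - slopeInt l b φ = -(slopeInt l g φ - slopeInt l c φ) := by
  have hz' : tiltA l g c q (τ * Complex.I) = 0 := by
    rw [← norm_eq_zero, ← h.norm_tiltA_eq, hz, norm_zero]
  obtain ⟨N, cN, eN, dN⟩ := h.left.exists_poleSum hτ hper hz
  obtain ⟨M, cM, eM, dM⟩ := h.right.exists_poleSum hτ (by rwa [← h.width_eq]) hz'
  have key : ∀ ξ : ℝ, ξ ≠ 0 → ∀ k : ℤ,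
      poleSum N ξ k * poleSum N (-ξ) (-k) = poleSum M ξ k * poleSum M (-ξ) (-k) := by
    intro ξ hξ k
    have hξ' := neg_ne_zero.2 hξ
    have t := h.tr_eq (ξ - q * (k * (τ * Complex.I)), k * (τ * Complex.I))
    have e : (-(ξ - q * (k * (τ * Complex.I)), k * (τ * Complex.I)) : ℂ × ℂ) =
        ((-ξ : ℝ) - q * ((-k : ℤ) * (τ * Complex.I)), (-k : ℤ) * (τ * Complex.I)) := by
      ext
      · simp only [Prod.fst_neg]; push_cast; ring
      · simp only [Prod.snd_neg]; push_cast; ring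
    have hu : ∀ T : ℝ, Complex.exp (k * (τ * Complex.I) * T) *
        Complex.exp ((-k : ℤ) * (τ * Complex.I) * T) = 1 := fun T => by
      rw [← Complex.exp_add, Complex.exp_eq_one_iff]
      exact ⟨0, by push_cast; ring⟩
    rw [e, eN ξ hξ k, eM ξ hξ k, eN (-ξ) hξ' (-k), eM (-ξ) hξ' (-k)] at t
    linear_combination t - poleSum N ξ k * poleSum N (-ξ) (-k) * hu (tiltMax l f q) +
      poleSum M ξ k * poleSum M (-ξ) (-k) * hu (tiltMax l g q)
  rcases weights_eq_or_eq_neg cN cM key with w | w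
  · left
    intro φ
    rw [dN, dM]
    exact w fun v => 2 * Real.pi * φ (q - v / τ)
  · right
    intro φ
    rw [dN, dM]
    exact w fun v => 2 * Real.pi * φ (q - v / τ)

end

end Planar

end

section
open MeasureTheory Set Filter Topology
open scoped ContDiff

namespace Planar

/-- Two functions on `[0, l]` have the same slope distribution, tested on smooth functions. -/
def SlopeEq (l : ℝ) (f g : ℝ → ℝ) : Prop :=
  ∀ R : ℝ, 0 < R → ∀ φ : ℝ → ℝ, ContDiff ℝ ∞ φ → Function.support φ ⊆ Ioc (-R) R →
    slopeInt l f φ = slopeInt l g φ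

section
variable {l : ℝ} {f b g c : ℝ → ℝ}

lemma slopeInt_reflect (l : ℝ) (f φ : ℝ → ℝ) :
    slopeInt l (fun x => -f (l - x)) φ = slopeInt l f φ := by
  have hd : ∀ x, deriv (fun x => -f (l - x)) x = deriv f (l - x) := fun x => by
    have : (fun x => -f (l - x)) = -(fun x => f (l - x)) := rfl
    rw [this, deriv.neg, deriv_comp_const_sub, neg_neg]
  have s := intervalIntegral.integral_comp_sub_left (a := 0) (b := l)
    (fun x : ℝ => 2 * Real.pi * φ (deriv f x)) l
  rw [sub_zero, sub_self] at s
  simp only [slopeInt, hd]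
  exact s

theorem Homometric.slopeEq_or (h : Homometric l f b g c) :
    (SlopeEq l f g ∧ SlopeEq l b c) ∨ (SlopeEq l f c ∧ SlopeEq l b g) := by
  by_cases hnc : ∀ (q : ℝ) (m : ℤ), 1 ≤ m →
      tiltA l f b q ((m * (2 * Real.pi) / width l f b q : ℝ) * Complex.I) ≠ 0
  · rcases h.commonZeros_or hnc with hz | hz
    · exact .inl ⟨fun R hR φ hφ hs => (h.slopeInt_eq_of_commonZeros hz hR hφ hs).1,
        fun R hR φ hφ hs => (h.slopeInt_eq_of_commonZeros hz hR hφ hs).2⟩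
    · refine .inr ⟨fun R hR φ hφ hs => ?_, fun R hR φ hφ hs => ?_⟩
      · rw [(h.reflect.slopeInt_eq_of_commonZeros hz hR hφ hs).1, slopeInt_reflect]
      · rw [(h.reflect.slopeInt_eq_of_commonZeros hz hR hφ hs).2, slopeInt_reflect]
  · push Not at hnc
    obtain ⟨q, m, hm, hz⟩ := hnc
    have hW := h.left.width_pos q
    have hτ : 0 < m * (2 * Real.pi) / width l f b q := by
      have : (0 : ℝ) < m := by exact_mod_cast hm
      have := Real.pi_pos
      positivity
    have hper : Complex.exp ((m * (2 * Real.pi) / width l f b q : ℝ) * Complex.I *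
        width l f b q) = 1 := by
      rw [Complex.exp_eq_one_iff]
      refine ⟨m, ?_⟩
      have : (width l f b q : ℂ) ≠ 0 := by exact_mod_cast hW.ne'
      push_cast
      field_simp
    rcases h.slopeInt_sub_of_collision hτ hper hz with e | e
    · refine .inl ⟨fun R hR φ hφ hs => ?_, fun R hR φ hφ hs => ?_⟩ <;>
      linarith [e φ, h.slopeInt_add hR hφ hs]
    · refine .inr ⟨fun R hR φ hφ hs => ?_, fun R hR φ hφ hs => ?_⟩ <;>
      linarith [e φ, h.slopeInt_add hR hφ hs]

lemma SlopeEq.map_eq (h : SlopeEq l f g) (hl : 0 ≤ l) :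
    (volume.restrict (Ioc 0 l)).map (deriv f) = (volume.restrict (Ioc 0 l)).map (deriv g) := by
  have mf := measurable_deriv f
  have mg := measurable_deriv g
  have : IsFiniteMeasure (volume.restrict (Ioc (0 : ℝ) l)) := ⟨by simp⟩
  have hpi := Real.pi_pos
  refine Real.measure_ext_Ioo_rat fun a b => ?_
  obtain ⟨ψ, hsupp, hsm, hr⟩ := (isOpen_Ioo (a := (a : ℝ)) (b := b)).exists_contDiff_support_eq
    (n := ⊤)
  have hψ0 : ∀ y, 0 ≤ ψ y := fun y => (hr ⟨y, rfl⟩).1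
  let R : ℝ := |(a : ℝ)| + |(b : ℝ)| + 1
  have hR : 0 < R := by positivity
  have hlim : ∀ F : ℝ → ℝ, Measurable F →
      Tendsto (fun n : ℕ => ∫ x in (0 : ℝ)..l, Real.smoothTransition (n * ψ (F x))) atTop
        (𝓝 (((volume.restrict (Ioc 0 l)).map F).real (Ioo a b))) := by
    intro F hF
    have e : ((volume.restrict (Ioc 0 l)).map F).real (Ioo (a : ℝ) b) =
        ∫ x in (0 : ℝ)..l, (F ⁻¹' Ioo (a : ℝ) b).indicator 1 x := by
      rw [intervalIntegral.integral_of_le hl, integral_indicator_one (hF measurableSet_Ioo),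
        measureReal_def, measureReal_def, Measure.map_apply hF measurableSet_Ioo]
    rw [e]
    refine intervalIntegral.tendsto_integral_filter_of_dominated_convergence (fun _ => 1) ?_ ?_
      (by simp) ?_
    · refine .of_forall fun n => Measurable.aestronglyMeasurable ?_
      exact Real.smoothTransition.continuous.measurable.comp
        ((hsm.continuous.measurable.comp hF).const_mul _)
    · refine .of_forall fun n => .of_forall fun x _ => ?_
      rw [Real.norm_of_nonneg (Real.smoothTransition.nonneg _)]
      exact Real.smoothTransition.le_one _
    · refine .of_forall fun x _ => ?_
      by_cases hx : F x ∈ Ioo (a : ℝ) b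
      · rw [indicator_of_mem (by exact hx)]
        have hp : 0 < ψ (F x) := (hψ0 _).lt_of_ne' (by
          have : F x ∈ Function.support ψ := hsupp ▸ hx
          exact this)
        refine tendsto_const_nhds.congr' ?_
        have := (tendsto_natCast_atTop_atTop (R := ℝ)).atTop_mul_const hp
        filter_upwards [this.eventually_ge_atTop 1] with n hn
        exact (Real.smoothTransition.one_of_one_le hn).symm
      · rw [indicator_of_notMem (by exact hx)]
        have hp : ψ (F x) = 0 := by
          have : F x ∉ Function.support ψ := hsupp ▸ hx
          exact Function.notMem_support.1 this
        simp [hp, Real.smoothTransition.zero]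
  have key : ∀ n : ℕ, ∫ x in (0 : ℝ)..l, Real.smoothTransition (n * ψ (deriv f x)) =
      ∫ x in (0 : ℝ)..l, Real.smoothTransition (n * ψ (deriv g x)) := by
    intro n
    have := h R hR (fun y => Real.smoothTransition (n * ψ y))
      (Real.smoothTransition.contDiff.comp (contDiff_const.mul hsm)) fun y hy => by
        have hy' : y ∈ Function.support ψ := fun h0 => hy (by simp [h0, Real.smoothTransition.zero])
        rw [hsupp] at hy'
        have ha := neg_abs_le (a : ℝ)
        have hb := le_abs_self (b : ℝ)
        have ha' := abs_nonneg (a : ℝ)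
        have hb' := abs_nonneg (b : ℝ)
        exact ⟨by simp only [R]; linarith [hy'.1], by simp only [R]; linarith [hy'.2]⟩
    simp only [slopeInt, intervalIntegral.integral_const_mul] at this
    exact mul_left_cancel₀ (by positivity) this
  have h1 := hlim _ mf
  simp only [key] at h1
  have h2 := tendsto_nhds_unique h1 (hlim _ mg)
  exact (measureReal_eq_measureReal_iff).1 h2

lemma SlopeEq.ae_deriv_eq (h : SlopeEq l f g) (hl : 0 ≤ l) (hf : ConcaveOn ℝ (Icc 0 l) f)
    (hg : ConcaveOn ℝ (Icc 0 l) g) : ∀ᵐ x : ℝ, x ∈ Ioo 0 l → deriv f x = deriv g x := by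
  let m : (ℝ → ℝ) → ℚ → ℝ := fun F t => (volume.restrict (Ioc 0 l)).real {x | (t : ℝ) < deriv F x}
  have hm : ∀ t, m f t = m g t := fun t => by
    have := congrArg (fun μ => μ.real (Ioi (t : ℝ))) (h.map_eq hl)
    simp only [measureReal_def, Measure.map_apply (measurable_deriv _) measurableSet_Ioi] at this
    exact this
  have : IsFiniteMeasure (volume.restrict (Ioc (0 : ℝ) l)) := ⟨by simp⟩
  have hanti : ∀ F : ℝ → ℝ, ConcaveOn ℝ (Icc 0 l) F → ∀ x ∈ Ioo 0 l, ∀ y ∈ Ioo 0 l, x < y →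
      DifferentiableAt ℝ F x → DifferentiableAt ℝ F y → deriv F y ≤ deriv F x := by
    intro F hF x hx y hy hxy dx dy
    exact (hF.le_slope_of_hasDerivAt (Ioo_subset_Icc_self hx) (Ioo_subset_Icc_self hy) hxy
      dy.hasDerivAt).trans (hF.slope_le_of_hasDerivAt (Ioo_subset_Icc_self hx)
      (Ioo_subset_Icc_self hy) hxy dx.hasDerivAt)
  have hge : ∀ F : ℝ → ℝ, ConcaveOn ℝ (Icc 0 l) F → ∀ x ∈ Ioo 0 l, DifferentiableAt ℝ F x →
      ∀ t : ℚ, (t : ℝ) < deriv F x → x ≤ m F t := by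
    intro F hF x hx dx t ht
    have e : x = volume.real (Ioc 0 x) := by simp [hx.1.le]
    have e' : volume.real (Ioc 0 x) = (volume.restrict (Ioc 0 l)).real (Ioc 0 x) := by
      rw [measureReal_def, measureReal_def, Measure.restrict_apply measurableSet_Ioc,
        inter_eq_left.2 (Ioc_subset_Ioc_right hx.2.le)]
    rw [e, e']
    refine ENNReal.toReal_mono (measure_ne_top _ _) (measure_mono_ae ?_)
    have := ae_restrict_of_ae (s := Ioc 0 l) (ConcaveOn_ae_differentiableAt hF)
    filter_upwards [this] with y hy hy0
    rcases hy0.2.lt_or_eq with hlt | rfl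
    · have hyl : y ∈ Ioo 0 l := ⟨hy0.1, hlt.trans hx.2⟩
      exact ht.trans_le (hanti F hF y hyl x hx hlt (hy hyl) dx)
    · exact ht
  have hle : ∀ F : ℝ → ℝ, ConcaveOn ℝ (Icc 0 l) F → ∀ x ∈ Ioo 0 l, DifferentiableAt ℝ F x →
      ∀ t : ℚ, deriv F x ≤ (t : ℝ) → m F t ≤ x := by
    intro F hF x hx dx t ht
    have e : x = volume.real (Ioc 0 x) := by simp [hx.1.le]
    have e' : volume.real (Ioc 0 x) = (volume.restrict (Ioc 0 l)).real (Ioc 0 x) := by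
      rw [measureReal_def, measureReal_def, Measure.restrict_apply measurableSet_Ioc,
        inter_eq_left.2 (Ioc_subset_Ioc_right hx.2.le)]
    conv_rhs => rw [e, e']
    refine ENNReal.toReal_mono (measure_ne_top _ _) (measure_mono_ae ?_)
    have h1 := ae_restrict_of_ae (s := Ioc 0 l) (ConcaveOn_ae_differentiableAt hF)
    have h2 : ∀ᵐ y : ℝ, y ≠ l := by simp [ae_iff, measure_singleton]
    filter_upwards [h1, ae_restrict_mem measurableSet_Ioc, ae_restrict_of_ae h2] with y hy hyl hne hyt
    by_contra hcon
    have hxy : x < y := by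
      by_contra hh
      exact hcon ⟨hyl.1, not_lt.1 hh⟩
    have hyl' : y ∈ Ioo 0 l := ⟨hyl.1, hyl.2.lt_of_ne hne⟩
    have := hanti F hF x hx y hyl' hxy dx (hy hyl')
    have hyt' : (t : ℝ) < deriv F y := hyt
    linarith
  have hnull : ∀ᵐ x : ℝ, x ∉ range (m f) :=
    (countable_range (m f)).ae_notMem volume
  filter_upwards [ConcaveOn_ae_differentiableAt hf, ConcaveOn_ae_differentiableAt hg, hnull] with
    x df dg hx hxl
  rcases lt_trichotomy (deriv f x) (deriv g x) with hlt | he | hlt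
  · obtain ⟨t, h1, h2⟩ := exists_rat_btwn hlt
    refine absurd ⟨t, ?_⟩ hx
    exact le_antisymm (hle f hf x hxl (df hxl) t h1.le)
      (hm t ▸ hge g hg x hxl (dg hxl) t h2)
  · exact he
  · obtain ⟨t, h1, h2⟩ := exists_rat_btwn hlt
    refine absurd ⟨t, ?_⟩ hx
    exact le_antisymm (hm t ▸ hle g hg x hxl (dg hxl) t h1.le) (hge f hf x hxl (df hxl) t h2)

lemma eq_add_const_of_ae_deriv_eq (hl : 0 < l) (cf : Continuous f) (cg : Continuous g)
    (hf : ConcaveOn ℝ (Icc 0 l) f) (hg : ConcaveOn ℝ (Icc 0 l) g)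
    (h : ∀ᵐ x : ℝ, x ∈ Ioo 0 l → deriv f x = deriv g x) :
    ∃ C, ∀ x ∈ Icc 0 l, f x = g x + C := by
  have key : ∀ x ∈ Ioo 0 l, f x - g x = f (l / 2) - g (l / 2) := by
    intro x hx
    have hmid : l / 2 ∈ Ioo 0 l := ⟨by linarith, by linarith⟩
    have hsub : uIcc x (l / 2) ⊆ Ioo 0 l := ordConnected_Ioo.uIcc_subset hx hmid
    have hac : ∀ F : ℝ → ℝ, ConcaveOn ℝ (Icc 0 l) F →
        AbsolutelyContinuousOnInterval F x (l / 2) := fun F hF => by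
      have := hF.locallyLipschitzOn_interior
      rw [interior_Icc] at this
      obtain ⟨K, hK⟩ := (this.mono hsub).exists_lipschitzOnWith_of_compact isCompact_uIcc
      exact hK.absolutelyContinuousOnInterval
    obtain ⟨C, hC⟩ := ((hac f hf).sub (hac g hg)).const_of_ae_hasDerivAt_zero (by
      filter_upwards [h, ConcaveOn_ae_differentiableAt hf, ConcaveOn_ae_differentiableAt hg] with
        y hy df dg hyu
      have hyl := hsub hyu
      exact ((df hyl).hasDerivAt.sub (dg hyl).hasDerivAt).congr_deriv (by rw [hy hyl, sub_self]))
    have h1 := hC x left_mem_uIcc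
    have h2 := hC (l / 2) right_mem_uIcc
    simp only [Pi.sub_apply] at h1 h2
    rw [h1, h2]
  refine ⟨f (l / 2) - g (l / 2), fun x hx => ?_⟩
  have hcl : IsClosed {x | f x - g x = f (l / 2) - g (l / 2)} :=
    isClosed_eq (by fun_prop) continuous_const
  have : Icc 0 l ⊆ {x | f x - g x = f (l / 2) - g (l / 2)} := by
    rw [← closure_Ioo hl.ne]
    exact closure_minimal key hcl
  have := this hx
  simp only [mem_ofPred_eq] at this
  linarith

end

end Planar

end

section
open MeasureTheory Set Filter Topology

namespace Planar

section
variable {l : ℝ} {f b g c : ℝ → ℝ}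

lemma tiltMax_eq_add (hl : 0 ≤ l) (cf : Continuous f) (cg : Continuous g) {C : ℝ}
    (h : ∀ x ∈ Icc 0 l, f x = g x + C) (q : ℝ) : tiltMax l f q = tiltMax l g q + C := by
  obtain ⟨x, hx, ex⟩ := tiltMax_exists hl cf q
  obtain ⟨y, hy, ey⟩ := tiltMax_exists hl cg q
  have h1 := le_tiltMax cf q hy
  have h2 := le_tiltMax cg q hx
  have h3 := h x hx
  have h4 := h y hy
  linarith

lemma Homometric.eq_add_const_of_slopeEq (h : Homometric l f b g c) (h1 : SlopeEq l f g)
    (h2 : SlopeEq l b c) : ∃ C, ∀ x ∈ Icc 0 l, g x = f x + C ∧ c x = b x + C := by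
  have hl := h.left.l_pos
  obtain ⟨C, hC⟩ := eq_add_const_of_ae_deriv_eq hl h.left.f_cont h.right.f_cont h.left.f_conc
    h.right.f_conc (h1.ae_deriv_eq hl.le h.left.f_conc h.right.f_conc)
  have h2' : SlopeEq l (fun x => -b (l - x)) (fun x => -c (l - x)) := fun R hR φ hφ hs => by
    rw [slopeInt_reflect, slopeInt_reflect, h2 R hR φ hφ hs]
  obtain ⟨C', hC'⟩ := eq_add_const_of_ae_deriv_eq hl h.left.reflect.f_cont h.right.reflect.f_cont
    h.left.reflect.f_conc h.right.reflect.f_conc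
    (h2'.ae_deriv_eq hl.le h.left.reflect.f_conc h.right.reflect.f_conc)
  have hb : ∀ x ∈ Icc 0 l, -b x = -c x + C' := fun x hx => by
    have := hC' (l - x) ⟨by linarith [hx.2], by linarith [hx.1]⟩
    simpa using this
  have hw := h.width_eq 0
  rw [width, width, tiltMax_eq_add hl.le h.left.f_cont h.right.f_cont hC,
    tiltMax_eq_add (f := fun x => -b x) (g := fun x => -c x) hl.le h.left.b_cont.neg
      h.right.b_cont.neg hb] at hw
  refine ⟨-C, fun x hx => ⟨by linarith [hC x hx], by linarith [hb x hx]⟩⟩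

theorem Homometric.eq_or (h : Homometric l f b g c) :
    ∃ C, (∀ x ∈ Icc 0 l, g x = f x + C ∧ c x = b x + C) ∨
      ∀ x ∈ Icc 0 l, g x = -b (l - x) + C ∧ c x = -f (l - x) + C := by
  rcases h.slopeEq_or with ⟨h1, h2⟩ | ⟨h1, h2⟩
  · obtain ⟨C, hC⟩ := h.eq_add_const_of_slopeEq h1 h2
    exact ⟨C, .inl hC⟩
  · obtain ⟨C, hC⟩ := h.reflect.eq_add_const_of_slopeEq
      (fun R hR φ hφ hs => by rw [slopeInt_reflect, h1 R hR φ hφ hs])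
      (fun R hR φ hφ hs => by rw [slopeInt_reflect, h2 R hR φ hφ hs])
    refine ⟨-C, .inr fun x hx => ?_⟩
    obtain ⟨e1, e2⟩ := hC (l - x) ⟨by linarith [hx.2], by linarith [hx.1]⟩
    simp only [sub_sub_cancel] at e1 e2
    constructor <;> linarith

end

end Planar

end

section
open MeasureTheory Set Filter Topology

namespace Planar

section
variable {l : ℝ} {K : Set (ℝ × ℝ)}

lemma exists_upper_graph (hl : 0 < l) (hc : IsCompact K) (hK : Convex ℝ K)
    (hfst : Prod.fst '' K = Icc 0 l) :
    ∃ F : ℝ → ℝ, Continuous F ∧ ConcaveOn ℝ (Icc 0 l) F ∧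
      ∀ x ∈ Icc 0 l, (x, F x) ∈ K ∧ ∀ y, (x, y) ∈ K → y ≤ F x := by
  have hfib : ∀ x ∈ Icc 0 l, ∃ y, (x, y) ∈ K ∧ ∀ y', (x, y') ∈ K → y' ≤ y := by
    intro x hx
    rw [← hfst] at hx
    obtain ⟨p, hp, rfl⟩ := hx
    have hcl : IsClosed {r : ℝ × ℝ | r.1 = p.1} := isClosed_eq continuous_fst continuous_const
    obtain ⟨r, ⟨hr, hrp⟩, hmax⟩ := (hc.inter_right hcl).exists_isMaxOn ⟨p, hp, rfl⟩
      continuous_snd.continuousOn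
    refine ⟨r.2, ?_, fun y' hy' => hmax ⟨hy', rfl⟩⟩
    have : r = (p.1, r.2) := Prod.ext hrp rfl
    exact this ▸ hr
  choose! F hF hmax using hfib
  have hconc : ConcaveOn ℝ (Icc 0 l) F := by
    refine ⟨convex_Icc _ _, fun x hx y hy a b ha hb hab => ?_⟩
    refine hmax _ (convex_Icc 0 l hx hy ha hb hab) _ ?_
    exact hK (hF x hx) (hF y hy) ha hb hab
  have hcont : ContinuousOn F (Icc 0 l) := by
    intro a ha
    by_cases h_int : a ∈ Ioo 0 l
    · have := hconc.continuousOn_interior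
      rw [interior_Icc] at this
      exact (this.continuousAt (Ioo_mem_nhds h_int.1 h_int.2)).continuousWithinAt
    · let Λ : ℝ → ℝ := fun x => ((l - x) * F 0 + x * F l) / l
      have hΛ : Λ a = F a := by
        have : a = 0 ∨ a = l := by
          by_contra hcon
          push Not at hcon
          exact h_int ⟨ha.1.lt_of_ne' hcon.1, ha.2.lt_of_ne hcon.2⟩
        rcases this with rfl | rfl <;> simp only [Λ] <;> field_simp <;> ring
      have hle : ∀ x ∈ Icc 0 l, Λ x ≤ F x := by
        intro x hx
        have := hconc.2 (left_mem_Icc.2 hl.le) (right_mem_Icc.2 hl.le)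
          (div_nonneg (sub_nonneg.2 hx.2) hl.le) (div_nonneg hx.1 hl.le)
          (by field_simp; ring : (l - x) / l + x / l = 1)
        simp only [smul_eq_mul, mul_zero, zero_add, div_mul_cancel₀ _ hl.ne'] at this
        simp only [Λ]
        calc _ = (l - x) / l * F 0 + x / l * F l := by ring
          _ ≤ _ := this
      refine tendsto_order.2 ⟨fun t ht => ?_, fun t ht => ?_⟩
      · have hΛc : ContinuousAt Λ a := by
          have : Continuous Λ := by fun_prop
          exact this.continuousAt
        have h1 : ∀ᶠ x in 𝓝[Icc 0 l] a, t < Λ x :=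
          (hΛc.eventually (lt_mem_nhds (hΛ ▸ ht))).filter_mono nhdsWithin_le_nhds
        filter_upwards [h1, self_mem_nhdsWithin] with x hx hxl
        exact hx.trans_le (hle x hxl)
      · have hcl : IsClosed (Prod.fst '' (K ∩ {p | t ≤ p.2})) :=
          ((hc.inter_right (isClosed_le continuous_const continuous_snd)).image
            continuous_fst).isClosed
        have hna : a ∈ (Prod.fst '' (K ∩ {p | t ≤ p.2}))ᶜ := by
          rintro ⟨p, ⟨hp, ht'⟩, rfl⟩
          exact absurd (hmax _ ha p.2 hp) (not_le.2 (ht.trans_le ht'))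
        filter_upwards [nhdsWithin_le_nhds (hcl.isOpen_compl.mem_nhds hna), self_mem_nhdsWithin]
          with x hx hxl
        by_contra hcon
        exact hx ⟨(x, F x), ⟨hF x hxl, not_lt.1 hcon⟩, rfl⟩
  have hG : ∀ x ∈ Icc 0 l, IccExtend hl.le ((Icc 0 l).domRestrict F) x = F x := fun x hx =>
    IccExtend_of_mem _ _ hx
  refine ⟨IccExtend hl.le ((Icc 0 l).domRestrict F), ?_, hconc.congr fun x hx => (hG x hx).symm,
    fun x hx => ?_⟩
  · exact (continuousOn_iff_continuous_domRestrict.1 hcont).Icc_extend'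
  · rw [hG x hx]
    exact ⟨hF x hx, hmax x hx⟩

lemma exists_graphBody (hl : 0 < l) (hc : IsCompact K) (hK : Convex ℝ K)
    (h_int : (interior K).Nonempty) (hfst : Prod.fst '' K = Icc 0 l) :
    ∃ f b : ℝ → ℝ, GraphBody l f b ∧
      ∀ p : ℝ × ℝ, p ∈ K ↔ p.1 ∈ Icc 0 l ∧ b p.1 ≤ p.2 ∧ p.2 ≤ f p.1 := by
  obtain ⟨f, cf, hf, mf⟩ := exists_upper_graph hl hc hK hfst
  let T : ℝ × ℝ →ₗ[ℝ] ℝ × ℝ := LinearMap.prodMap LinearMap.id (-LinearMap.id)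
  have hT : ∀ x y : ℝ, T (x, y) = (x, -y) := fun x y => by simp [T]
  have hmem : ∀ x y : ℝ, (x, y) ∈ T '' K ↔ (x, -y) ∈ K := fun x y => by
    constructor
    · rintro ⟨⟨a, b⟩, hp, he⟩
      rw [hT, Prod.mk.injEq] at he
      rw [← he.1, ← he.2, neg_neg]
      exact hp
    · intro h
      exact ⟨(x, -y), h, by rw [hT, neg_neg]⟩
  obtain ⟨b, cb, hb, mb⟩ := exists_upper_graph (K := T '' K) hl
    (hc.image T.continuous_of_finiteDimensional) (hK.linear_image T) (by
      rw [← hfst, image_image]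
      refine image_congr fun p _ => ?_
      simp [T])
  have hiff : ∀ p : ℝ × ℝ, p ∈ K ↔ p.1 ∈ Icc 0 l ∧ -b p.1 ≤ p.2 ∧ p.2 ≤ f p.1 := by
    intro p
    constructor
    · intro hp
      have hx : p.1 ∈ Icc 0 l := hfst ▸ mem_image_of_mem _ hp
      refine ⟨hx, ?_, (mf _ hx).2 p.2 hp⟩
      have := (mb _ hx).2 (-p.2) ((hmem _ _).2 (by simpa using hp))
      linarith
    · rintro ⟨hx, h1, h2⟩
      have k1 : (p.1, -b p.1) ∈ K := (hmem _ _).1 (mb _ hx).1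
      have k2 := (mf _ hx).1
      have hconv : Convex ℝ {y | (p.1, y) ∈ K} := fun y hy y' hy' s t hs ht hst => by
        have := hK hy hy' hs ht hst
        have e : s • (p.1, y) + t • (p.1, y') = (p.1, s • y + t • y') := by
          ext
          · simp only [Prod.fst_add, Prod.smul_fst, smul_eq_mul]
            rw [← add_mul, hst, one_mul]
          · simp
        rw [e] at this
        exact this
      exact hconv.ordConnected.out k1 k2 ⟨h1, h2⟩
  have hle : ∀ x ∈ Icc 0 l, -b x ≤ f x := fun x hx =>
    ((hiff _).1 (mf x hx).1).2.1
  refine ⟨f, fun x => -b x, ⟨hl, cf, cb.neg, hf, hb.neg, hle, ?_⟩, hiff⟩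
  obtain ⟨⟨x0, y0⟩, hp0⟩ := h_int
  have hnhds : K ∈ 𝓝 (x0, y0) := mem_interior_iff_mem_nhds.1 hp0
  have hcy : Tendsto (fun y : ℝ => (x0, y)) (𝓝[>] y0) (𝓝 (x0, y0)) :=
    (Continuous.tendsto (by fun_prop : Continuous fun y : ℝ => (x0, y)) y0).mono_left
      nhdsWithin_le_nhds
  obtain ⟨y1, hy1, hlt⟩ := ((hcy.eventually hnhds).and self_mem_nhdsWithin).exists
  have hlt : y0 < y1 := hlt
  have hmem0 := (hiff _).1 (mem_of_mem_nhds hnhds)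
  have hmem1 := (hiff _).1 hy1
  have hpos : 0 < f x0 + b x0 := by linarith [hmem0.2.1, hmem1.2.2]
  have hsum : ConcaveOn ℝ (Icc 0 l) fun x => f x + b x := hf.add hb
  have hx0 : x0 ∈ Icc 0 l := hmem0.1
  intro x hx
  have hxx : 0 < f x + b x := by
    rcases lt_trichotomy x x0 with h | rfl | h
    · have hx0p : 0 < x0 := hx.1.trans h
      have := hsum.2 (left_mem_Icc.2 hl.le) hx0 (div_nonneg (sub_nonneg.2 h.le) hx0p.le)
        (div_nonneg hx.1.le hx0p.le) (by field_simp; ring : (x0 - x) / x0 + x / x0 = 1)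
      simp only [smul_eq_mul, mul_zero, zero_add, div_mul_cancel₀ _ hx0p.ne'] at this
      have h1 : 0 < x / x0 * (f x0 + b x0) := mul_pos (div_pos hx.1 hx0p) hpos
      have h2 : 0 ≤ (x0 - x) / x0 * (f 0 + b 0) := mul_nonneg
        (div_nonneg (sub_nonneg.2 h.le) hx0p.le) (by linarith [hle 0 (left_mem_Icc.2 hl.le)])
      linarith
    · exact hpos
    · have hd : 0 < l - x0 := by linarith [hx.2]
      have e : (l - x) / (l - x0) * x0 + (x - x0) / (l - x0) * l = x := by field_simp; ring
      have := hsum.2 hx0 (right_mem_Icc.2 hl.le) (div_nonneg (sub_nonneg.2 hx.2.le) hd.le)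
        (div_nonneg (sub_nonneg.2 h.le) hd.le)
        (by field_simp; ring : (l - x) / (l - x0) + (x - x0) / (l - x0) = 1)
      simp only [smul_eq_mul, e] at this
      have h1 : 0 < (l - x) / (l - x0) * (f x0 + b x0) :=
        mul_pos (div_pos (sub_pos.2 hx.2) hd) hpos
      have h2 : 0 ≤ (x - x0) / (l - x0) * (f l + b l) := mul_nonneg
        (div_nonneg (sub_nonneg.2 h.le) hd.le) (by linarith [hle l (right_mem_Icc.2 hl.le)])
      linarith
  linarith

end

end Planar

end

section
open MeasureTheory Set Filter Topology
open scoped Convolution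

namespace Planar

section
variable {l : ℝ} {f b : ℝ → ℝ} {K H : Set (ℝ × ℝ)}

lemma sub_mem_of_covariogram_eq (hH : IsCompact H) (hKc : IsCompact K) (hK : Convex ℝ K)
    (h_int : (interior K).Nonempty)
    (hcov : ∀ u, volume.real (K ∩ (fun p => p + u) '' K) =
      volume.real (H ∩ (fun p => p + u) '' H)) {p q : ℝ × ℝ} (hp : p ∈ K) (hq : q ∈ K) :
    ∃ r ∈ H, ∃ s ∈ H, p - q = r - s := by
  let D : Set (ℝ × ℝ) := (fun h : (ℝ × ℝ) × (ℝ × ℝ) => h.1 - h.2) '' (H ×ˢ H)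
  have hD : IsClosed D := ((hH.prod hH).image (by fun_prop)).isClosed
  have hsub : interior K ×ˢ interior K ⊆ {h : (ℝ × ℝ) × (ℝ × ℝ) | h.1 - h.2 ∈ D} := by
    rintro ⟨p, q⟩ ⟨hp, hq⟩
    let u := p - q
    have ho : IsOpen (interior K ∩ (fun p => p + u) '' interior K) :=
      isOpen_interior.inter ((Homeomorph.addRight u).isOpenMap _ isOpen_interior)
    have hne : (interior K ∩ (fun p => p + u) '' interior K).Nonempty :=
      ⟨p, hp, q, hq, by simp [u]⟩
    have hpos : 0 < volume (K ∩ (fun p => p + u) '' K) :=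
      (ho.measure_pos volume hne).trans_le (measure_mono
        (inter_subset_inter interior_subset (image_mono interior_subset)))
    have hfin : volume (K ∩ (fun p => p + u) '' K) < ⊤ :=
      (measure_mono inter_subset_left).trans_lt hKc.measure_lt_top
    have hpos' : 0 < volume.real (H ∩ (fun p => p + u) '' H) := by
      rw [← hcov u]
      exact ENNReal.toReal_pos hpos.ne' hfin.ne
    have hnn : (H ∩ (fun p => p + u) '' H).Nonempty := by
      by_contra hcon
      rw [not_nonempty_iff_eq_empty] at hcon
      rw [hcon, measureReal_empty] at hpos'
      exact lt_irrefl _ hpos'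
    obtain ⟨r, hr, s, hs, e⟩ := hnn
    refine ⟨(r, s), ⟨hr, hs⟩, ?_⟩
    simp only [← e, u]
    abel
  have hcl : IsClosed {h : (ℝ × ℝ) × (ℝ × ℝ) | h.1 - h.2 ∈ D} :=
    hD.preimage (by fun_prop : Continuous fun h : (ℝ × ℝ) × (ℝ × ℝ) => h.1 - h.2)
  have := closure_minimal hsub hcl
  rw [closure_prod_eq, hK.closure_interior_eq_closure_of_nonempty_interior h_int] at this
  obtain ⟨⟨r, s⟩, ⟨hr, hs⟩, e⟩ := this (⟨subset_closure hp, subset_closure hq⟩ :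
    (p, q) ∈ closure K ×ˢ closure K)
  exact ⟨r, hr, s, hs, e.symm⟩

/-- The exponential function on the plane with complex frequency `z`. -/
noncomputable def planeExp (z : ℂ × ℂ) (p : ℝ × ℝ) : ℂ := Complex.exp (z.1 * p.1 + z.2 * p.2)

lemma continuous_planeExp (z : ℂ × ℂ) : Continuous (planeExp z) := by
  unfold planeExp; fun_prop

lemma planeExp_neg (z : ℂ × ℂ) (p : ℝ × ℝ) : planeExp (-z) p = planeExp z (-p) := by
  simp [planeExp]

lemma planeExp_add (z : ℂ × ℂ) (p q : ℝ × ℝ) :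
    planeExp z (p + q) = planeExp z p * planeExp z q := by
  simp only [planeExp, ← Complex.exp_add, Prod.fst_add, Prod.snd_add]
  congr 1; push_cast; ring

lemma laplace_mul_neg (hK : IsCompact K) (z : ℂ × ℂ) :
    (∫ p in K, planeExp z p) * ∫ p in K, planeExp (-z) p =
      ∫ u, planeExp z u * volume.real (K ∩ (fun p => p + -u) '' K) := by
  have hm := hK.measurableSet
  let G : ℝ × ℝ → ℂ := K.indicator (planeExp z)
  let F : ℝ × ℝ → ℂ := fun t => K.indicator (planeExp (-z)) (-t)
  have hG : Integrable G := (integrable_indicator_iff hm).2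
    ((continuous_planeExp z).continuousOn.integrableOn_compact hK)
  have hF : Integrable F := ((integrable_indicator_iff hm).2
    ((continuous_planeExp (-z)).continuousOn.integrableOn_compact hK)).comp_neg
  have key := integral_convolution (L := ContinuousLinearMap.mul ℝ ℂ) hF hG
  have e1 : ∫ t, F t = ∫ p in K, planeExp (-z) p := by
    rw [← integral_indicator hm]
    exact integral_neg_eq_self (K.indicator (planeExp (-z))) volume
  have e2 : ∫ t, G t = ∫ p in K, planeExp z p := integral_indicator hm
  rw [e1, e2, ContinuousLinearMap.mul_apply'] at key
  rw [mul_comm, ← key]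
  refine integral_congr_ae (.of_forall fun u => ?_)
  simp only [convolution_def, ContinuousLinearMap.mul_apply']
  rw [← integral_neg_eq_self]
  have hset : K ∩ (fun p => p + -u) '' K = {p | p ∈ K ∧ u + p ∈ K} := by
    ext p
    constructor
    · rintro ⟨hp, q, hq, rfl⟩
      exact ⟨hp, by simpa using hq⟩
    · rintro ⟨hp, hq⟩
      exact ⟨hp, u + p, hq, by simp⟩
  have hms : MeasurableSet (K ∩ (fun p => p + -u) '' K) :=
    (hK.inter (hK.image (by fun_prop))).measurableSet
  have : ∀ p, F (-p) * G (u - -p) =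
      (K ∩ (fun p => p + -u) '' K).indicator (fun _ => planeExp z u) p := by
    intro p
    simp only [F, G, neg_neg, sub_neg_eq_add, hset]
    by_cases h1 : p ∈ K <;> by_cases h2 : u + p ∈ K
    · rw [indicator_of_mem h1, indicator_of_mem h2,
        indicator_of_mem (show p ∈ {p | p ∈ K ∧ u + p ∈ K} from ⟨h1, h2⟩), planeExp_neg,
        mul_comm, ← planeExp_add, add_neg_cancel_right]
    · rw [indicator_of_notMem h2,
        indicator_of_notMem (show p ∉ {p | p ∈ K ∧ u + p ∈ K} from fun h => h2 h.2), mul_zero]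
    · rw [indicator_of_notMem h1,
        indicator_of_notMem (show p ∉ {p | p ∈ K ∧ u + p ∈ K} from fun h => h1 h.1), zero_mul]
    · rw [indicator_of_notMem h1,
        indicator_of_notMem (show p ∉ {p | p ∈ K ∧ u + p ∈ K} from fun h => h1 h.1), zero_mul]
  simp only [this]
  rw [integral_indicator hms, setIntegral_const, Complex.real_smul, mul_comm]

lemma bodyTr_eq_laplace (h : GraphBody l f b) (hKc : IsCompact K)
    (hK : ∀ p : ℝ × ℝ, p ∈ K ↔ p.1 ∈ Icc 0 l ∧ b p.1 ≤ p.2 ∧ p.2 ≤ f p.1) (z : ℂ × ℂ) :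
    bodyTr l f b z = z.2 * ∫ p in K, planeExp z p := by
  have hm := hKc.measurableSet
  have hG : Integrable (K.indicator (planeExp z)) := (integrable_indicator_iff hm).2
    ((continuous_planeExp z).continuousOn.integrableOn_compact hKc)
  have cf := h.f_cont
  have cb := h.b_cont
  have i1 : IntervalIntegrable
      (fun x : ℝ => ((1 : ℝ) : ℂ) * Complex.exp (z.1 * x + z.2 * f x)) volume 0 l :=
    Continuous.intervalIntegrable (by fun_prop) _ _
  have i2 : IntervalIntegrable
      (fun x : ℝ => ((1 : ℝ) : ℂ) * Complex.exp (z.1 * x + z.2 * b x)) volume 0 l :=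
    Continuous.intervalIntegrable (by fun_prop) _ _
  have inner : ∀ x : ℝ, ∫ y, K.indicator (planeExp z) (x, y) =
      (Icc 0 l).indicator (fun x => ∫ y in (b x)..(f x), planeExp z (x, y)) x := by
    intro x
    by_cases hx : x ∈ Icc 0 l
    · rw [indicator_of_mem hx, intervalIntegral.integral_of_le (h.le x hx),
        ← integral_Icc_eq_integral_Ioc, ← integral_indicator measurableSet_Icc]
      refine integral_congr_ae (.of_forall fun y => ?_)
      beta_reduce
      by_cases hy : y ∈ Icc (b x) (f x)
      · rw [indicator_of_mem hy, indicator_of_mem ((hK (x, y)).2 ⟨hx, hy⟩)]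
      · rw [indicator_of_notMem hy, indicator_of_notMem fun hm => hy ((hK (x, y)).1 hm).2]
    · rw [indicator_of_notMem hx]
      refine integral_eq_zero_of_ae (.of_forall fun y => ?_)
      beta_reduce
      rw [indicator_of_notMem fun hm => hx ((hK (x, y)).1 hm).1]
      rfl
  rw [← integral_indicator hm, Measure.volume_eq_prod, integral_prod _ hG]
  simp only [inner]
  rw [integral_indicator measurableSet_Icc, integral_Icc_eq_integral_Ioc,
    ← intervalIntegral.integral_of_le h.l_pos.le, ← intervalIntegral.integral_const_mul, bodyTr,
    expInt, expInt, ← intervalIntegral.integral_sub i1 i2]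
  refine intervalIntegral.integral_congr fun x _ => ?_
  simp only [planeExp, Complex.ofReal_one, one_mul]
  by_cases hz : z.2 = 0
  · simp [hz]
  · simp only [Complex.exp_add]
    rw [intervalIntegral.integral_const_mul, integral_exp_mul_complex hz]
    field_simp

end

end Planar

end

section
open MeasureTheory Set Filter Topology

namespace Planar

section
variable {l m : ℝ} {f b g c : ℝ → ℝ} {K H : Set (ℝ × ℝ)}

lemma width_le_of_sub_mem (hf : GraphBody l f b) (hg : GraphBody l g c)
    (hK : ∀ p : ℝ × ℝ, p ∈ K ↔ p.1 ∈ Icc 0 l ∧ b p.1 ≤ p.2 ∧ p.2 ≤ f p.1)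
    (hH : ∀ p : ℝ × ℝ, p ∈ H ↔ p.1 ∈ Icc 0 l ∧ c p.1 ≤ p.2 ∧ p.2 ≤ g p.1)
    (hsub : ∀ p ∈ K, ∀ q ∈ K, ∃ r ∈ H, ∃ s ∈ H, p - q = r - s) (q : ℝ) :
    width l f b q ≤ width l g c q := by
  have cb := hf.b_cont
  have cc := hg.b_cont
  obtain ⟨x, hx, ex⟩ := tiltMax_exists hf.l_pos.le hf.f_cont q
  obtain ⟨y, hy, ey⟩ := tiltMax_exists hf.l_pos.le (f := fun x => -b x) (by fun_prop) (-q)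
  obtain ⟨r, hr, s, hs, e⟩ := hsub (x, f x) ((hK _).2 ⟨hx, hf.le x hx, le_rfl⟩)
    (y, b y) ((hK _).2 ⟨hy, le_rfl, hf.le y hy⟩)
  have e1 := congrArg Prod.fst e
  have e2 := congrArg Prod.snd e
  simp only [Prod.fst_sub, Prod.snd_sub] at e1 e2
  have h1 := le_tiltMax hg.f_cont q ((hH r).1 hr).1
  have h2 := le_tiltMax (f := fun x => -c x) (by fun_prop) (-q) ((hH s).1 hs).1
  have h3 := ((hH r).1 hr).2.2
  have h4 := ((hH s).1 hs).2.1
  have h5 : q * (x - y) = q * (r.1 - s.1) := by rw [e1]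
  unfold width
  rw [ex, ey]
  linarith

lemma le_of_sub_mem (hl : 0 ≤ l) (hK : Prod.fst '' K = Icc 0 l) (hH : Prod.fst '' H = Icc 0 m)
    (hsub : ∀ p ∈ K, ∀ q ∈ K, ∃ r ∈ H, ∃ s ∈ H, p - q = r - s) : l ≤ m := by
  obtain ⟨p, hp, ep⟩ := hK.ge (right_mem_Icc.2 hl)
  obtain ⟨q, hq, eq⟩ := hK.ge (left_mem_Icc.2 hl)
  obtain ⟨r, hr, s, hs, e⟩ := hsub p hp q hq
  have h1 := (hH.le (mem_image_of_mem _ hr)).2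
  have h2 := (hH.le (mem_image_of_mem _ hs)).1
  have e1 := congrArg Prod.fst e
  simp only [Prod.fst_sub] at e1
  linarith

lemma exists_congruent_of_fst_image (hKc : IsCompact K) (hHc : IsCompact H) (hK : Convex ℝ K)
    (hH : Convex ℝ H) (iK : (interior K).Nonempty) (iH : (interior H).Nonempty) (hl : 0 < l)
    (hm : 0 < m) (fK : Prod.fst '' K = Icc 0 l) (fH : Prod.fst '' H = Icc 0 m)
    (hcov : ∀ u, volume.real (K ∩ (fun p => p + u) '' K) =
      volume.real (H ∩ (fun p => p + u) '' H)) :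
    ∃ (v : ℝ × ℝ) (ε : ℝ), (ε = 1 ∨ ε = -1) ∧ H = (fun x => ε • x + v) '' K := by
  have s1 : ∀ p ∈ K, ∀ q ∈ K, ∃ r ∈ H, ∃ s ∈ H, p - q = r - s := fun p hp q hq =>
    sub_mem_of_covariogram_eq hHc hKc hK iK hcov hp hq
  have s2 : ∀ p ∈ H, ∀ q ∈ H, ∃ r ∈ K, ∃ s ∈ K, p - q = r - s := fun p hp q hq =>
    sub_mem_of_covariogram_eq hKc hHc hH iH (fun u => (hcov u).symm) hp hq
  obtain rfl : l = m := le_antisymm (le_of_sub_mem hl.le fK fH s1) (le_of_sub_mem hm.le fH fK s2)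
  obtain ⟨f, b, gf, mK⟩ := exists_graphBody hl hKc hK iK fK
  obtain ⟨g, c, gg, mH⟩ := exists_graphBody hl hHc hH iH fH
  have hom : Homometric l f b g c :=
    { left := gf
      right := gg
      width_eq := fun q => le_antisymm (width_le_of_sub_mem gf gg mK mH s1 q)
        (width_le_of_sub_mem gg gf mH mK s2 q)
      tr_eq := fun z => by
        rw [bodyTr_eq_laplace gf hKc mK, bodyTr_eq_laplace gf hKc mK, bodyTr_eq_laplace gg hHc mH,
          bodyTr_eq_laplace gg hHc mH, mul_mul_mul_comm, laplace_mul_neg hKc, mul_mul_mul_comm,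
          laplace_mul_neg hHc]
        simp only [hcov] }
  obtain ⟨C, hC | hC⟩ := hom.eq_or
  · refine ⟨(0, C), 1, .inl rfl, ?_⟩
    ext ⟨x, y⟩
    have : (x, y) ∈ (fun p : ℝ × ℝ => (1 : ℝ) • p + (0, C)) '' K ↔ (x, y - C) ∈ K := by
      constructor
      · rintro ⟨⟨s, t⟩, h, e⟩
        simp only [one_smul, Prod.mk_add_mk, Prod.mk.injEq, add_zero] at e
        obtain ⟨rfl, rfl⟩ := e
        simpa using h
      · exact fun h => ⟨_, h, by simp⟩
    rw [this, mH, mK]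
    refine and_congr_right fun hx => ?_
    dsimp only at hx ⊢
    rw [(hC x hx).1, (hC x hx).2]
    constructor <;> rintro ⟨h1, h2⟩ <;> constructor <;> linarith
  · refine ⟨(l, C), -1, .inr rfl, ?_⟩
    ext ⟨x, y⟩
    have : (x, y) ∈ (fun p : ℝ × ℝ => (-1 : ℝ) • p + (l, C)) '' K ↔ (l - x, C - y) ∈ K := by
      constructor
      · rintro ⟨⟨s, t⟩, h, e⟩
        simp only [neg_smul, one_smul, Prod.neg_mk, Prod.mk_add_mk, Prod.mk.injEq] at e
        obtain ⟨rfl, rfl⟩ := e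
        simpa using h
      · exact fun h => ⟨_, h, by simp⟩
    rw [this, mH, mK]
    have hx' : l - x ∈ Icc 0 l ↔ x ∈ Icc 0 l := by
      constructor <;> rintro ⟨h1, h2⟩ <;> constructor <;> linarith
    dsimp only
    rw [hx']
    refine and_congr_right fun hx => ?_
    rw [(hC x hx).1, (hC x hx).2]
    constructor <;> rintro ⟨h1, h2⟩ <;> constructor <;> linarith

lemma exists_fst_image (hKc : IsCompact K) (hK : Convex ℝ K) (iK : (interior K).Nonempty) :
    ∃ α β, α < β ∧ Prod.fst '' K = Icc α β := by
  have hne : K.Nonempty := iK.mono interior_subset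
  have h1 : IsCompact (Prod.fst '' K) := hKc.image continuous_fst
  have h2 : IsConnected (Prod.fst '' K) :=
    ⟨hne.image _, hK.isPreconnected.image _ continuous_fst.continuousOn⟩
  have e := eq_Icc_of_connected_compact h2 h1
  refine ⟨_, _, ?_, e⟩
  have h3 : (Prod.fst '' interior K) ⊆ interior (Prod.fst '' K) :=
    (isOpenMap_fst _ isOpen_interior).subset_interior_iff.2 (image_mono interior_subset)
  have h4 := (iK.image Prod.fst).mono h3
  rw [e, interior_Icc] at h4
  exact nonempty_Ioo.1 h4

lemma volume_real_inter_translate (K : Set (ℝ × ℝ)) (w u : ℝ × ℝ) :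
    volume.real ((fun p => p + w) '' K ∩ (fun p => p + u) '' ((fun p => p + w) '' K)) =
      volume.real (K ∩ (fun p => p + u) '' K) := by
  have : (fun p => p + u) '' ((fun p => p + w) '' K) =
      (fun p => p + w) '' ((fun p => p + u) '' K) := by
    simp only [image_image, add_right_comm]
  rw [this, ← image_inter (add_left_injective w), Measure.real, Measure.real,
    image_add_right, measure_preimage_add_right]

theorem exists_congruent (hKc : IsCompact K) (hHc : IsCompact H) (hK : Convex ℝ K)
    (hH : Convex ℝ H) (iK : (interior K).Nonempty) (iH : (interior H).Nonempty)
    (hcov : ∀ u, volume.real (K ∩ (fun p => p + u) '' K) =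
      volume.real (H ∩ (fun p => p + u) '' H)) :
    ∃ (v : ℝ × ℝ) (ε : ℝ), (ε = 1 ∨ ε = -1) ∧ H = (fun x => ε • x + v) '' K := by
  have shift : ∀ {K : Set (ℝ × ℝ)}, IsCompact K → Convex ℝ K → (interior K).Nonempty →
      ∃ w : ℝ × ℝ, ∃ l, 0 < l ∧ IsCompact ((fun p => p + w) '' K) ∧
        Convex ℝ ((fun p => p + w) '' K) ∧ (interior ((fun p => p + w) '' K)).Nonempty ∧
        Prod.fst '' ((fun p => p + w) '' K) = Icc 0 l := by
    intro K hKc hK iK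
    obtain ⟨α, β, h, e⟩ := exists_fst_image hKc hK iK
    refine ⟨(-α, 0), β - α, sub_pos.2 h, hKc.image (by fun_prop), ?_, ?_, ?_⟩
    · simpa only [add_comm] using hK.translate (-α, 0)
    · have := (Homeomorph.addRight ((-α, 0) : ℝ × ℝ)).image_interior K
      exact (iK.image _).mono this.le
    · rw [image_image]
      simp only [Prod.fst_add]
      rw [← image_image (fun x => x + -α) Prod.fst, e, image_add_const_Icc]
      simp [sub_eq_add_neg]
  obtain ⟨w, l, hl, c1, c2, c3, c4⟩ := shift hKc hK iK
  obtain ⟨w', m, hm, d1, d2, d3, d4⟩ := shift hHc hH iH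
  obtain ⟨v, ε, hε, e⟩ := exists_congruent_of_fst_image c1 d1 c2 d2 c3 d3 hl hm c4 d4
    (fun u => by rw [volume_real_inter_translate, volume_real_inter_translate, hcov])
  refine ⟨ε • w + v - w', ε, hε, ?_⟩
  have : (fun p => p - w') '' ((fun p => p + w') '' H) = H := by
    rw [image_image]; simp only [add_sub_cancel_right, image_id']
  rw [← this, e, image_image, image_image]
  refine image_congr fun p _ => ?_
  rw [smul_add]; abel

end

end Planar

end

namespace Planar
/-- Cartesian coordinates on the Euclidean plane. -/
noncomputable def coords : EuclideanSpace ℝ (Fin 2) ≃L[ℝ] ℝ × ℝ :=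
  (EuclideanSpace.equiv (Fin 2) ℝ).trans (ContinuousLinearEquiv.finTwoArrow ℝ ℝ)

lemma measurePreserving_coords : MeasurePreserving coords :=
  (volume_preserving_finTwoArrow ℝ).comp (PiLp.volume_preserving_ofLp (Fin 2))

lemma covariogram_eq_coords (P : Set (EuclideanSpace ℝ (Fin 2))) (x : EuclideanSpace ℝ (Fin 2)) :
    covariogram P x =
      volume.real (coords '' P ∩ (fun p => p + coords x) '' (coords '' P)) := by
  have : (fun p => p + coords x) '' (coords '' P) = coords '' ((fun p => p + x) '' P) := by
    simp only [Set.image_image, map_add]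
  rw [this, ← Set.image_inter coords.injective, Measure.real, covariogram,
    ← measurePreserving_coords.measure_preimage_emb
      coords.toHomeomorph.measurableEmbedding, Set.preimage_image_eq _ coords.injective]

end Planar

theorem stmt_6 (P P' : Set (EuclideanSpace ℝ (Fin 2)))
    (hPc : IsCompact P) (hP'c : IsCompact P')
    (hPconv : Convex ℝ P) (hP'conv : Convex ℝ P')
    (hPint : (interior P).Nonempty) (hP'int : (interior P').Nonempty)
    (hcov : ∀ x : EuclideanSpace ℝ (Fin 2), covariogram P x = covariogram P' x) :
    ∃ (v : EuclideanSpace ℝ (Fin 2)) (ε : ℝ), (ε = 1 ∨ ε = -1) ∧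
      P' = (fun x => ε • x + v) '' P := by
  have h_int : ∀ {P : Set (EuclideanSpace ℝ (Fin 2))}, (interior P).Nonempty →
      (interior (Planar.coords '' P)).Nonempty := fun {P} h =>
    (h.image _).mono (Planar.coords.toHomeomorph.image_interior P).le
  obtain ⟨v, ε, hε, e⟩ := Planar.exists_congruent (hPc.image Planar.coords.continuous)
    (hP'c.image Planar.coords.continuous) (hPconv.is_linear_image Planar.coords.isLinear)
    (hP'conv.is_linear_image Planar.coords.isLinear) (h_int hPint) (h_int hP'int) fun u => by
      have := hcov (Planar.coords.symm u)
      rwa [Planar.covariogram_eq_coords, Planar.covariogram_eq_coords,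
        ContinuousLinearEquiv.apply_symm_apply] at this
  refine ⟨Planar.coords.symm v, ε, hε, Planar.coords.injective.image_injective ?_⟩
  rw [e]
  simp only [Set.image_image, map_add, map_smul, ContinuousLinearEquiv.apply_symm_apply]
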